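/- Fix 0 < p < ∞. For every F ∈ ℍ^p there exist a function G ∈ QA and an outer function H which belongs to ℍ^q for every 0 < q < p, such that F'(z) = G'(z) H(z) for all z ∈ 𝔻. -/

import Mathlib

open MeasureTheory Filter Set Topology

noncomputable section

/-- The open unit disc in `ℂ`. -/
def unitDisc : Set ℂ := {z : ℂ | ‖z‖ < 1}

/-- The point `e^{iθ}` on the unit circle. -/
def circlePt (θ : ℝ) : ℂ := Complex.exp ((θ : ℂ) * Complex.I)

/-- The Carleson square based on the arc centered at `e^{iθ₀}` of normalized length `t`. -/
def carlesonSquare (θ₀ t : ℝ) : Set ℂ :=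
  {z : ℂ | z ∈ unitDisc ∧ 1 - t ≤ ‖z‖ ∧
    ∃ θ : ℝ, |θ - θ₀| ≤ Real.pi * t ∧ z = (‖z‖ : ℂ) * circlePt θ}

/-- `μ` is a Carleson measure. -/
def IsCarleson (μ : Measure ℂ) : Prop :=
  ∃ C : ℝ, 0 < C ∧ ∀ θ₀ t : ℝ, 0 < t → t ≤ 1 →
    μ (carlesonSquare θ₀ t) ≤ ENNReal.ofReal (C * t)

/-- `μ` is a vanishing Carleson measure. -/
def IsVanishingCarleson (μ : Measure ℂ) : Prop :=
  IsCarleson μ ∧ ∀ ε : ℝ, 0 < ε → ∃ δ : ℝ, 0 < δ ∧ ∀ θ₀ t : ℝ, 0 < t → t < δ →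
    μ (carlesonSquare θ₀ t) ≤ ENNReal.ofReal (ε * t)

/-- The measure `|E| μ`, i.e. `d(|E|μ)(z) = |E(z)| dμ(z)`. -/
def absDensity (E : ℂ → ℂ) (μ : Measure ℂ) : Measure ℂ :=
  μ.withDensity (fun z => ENNReal.ofReal ‖E z‖)

/-- Average of a boundary function (in the angle variable) over the arc
centered at `e^{iθ₀}` of normalized length `t`; `dm = dθ/(2π)`. -/
def arcAvg (f : ℝ → ℂ) (θ₀ t : ℝ) : ℂ :=
  ((2 * Real.pi * t)⁻¹ : ℝ) •
    ∫ θ in Set.Ioo (θ₀ - Real.pi * t) (θ₀ + Real.pi * t), f θ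

/-- Mean oscillation of a boundary function over the arc centered at `e^{iθ₀}`
of normalized length `t`. -/
def meanOsc (f : ℝ → ℂ) (θ₀ t : ℝ) : ℝ :=
  (2 * Real.pi * t)⁻¹ *
    ∫ θ in Set.Ioo (θ₀ - Real.pi * t) (θ₀ + Real.pi * t), ‖f θ - arcAvg f θ₀ t‖

/-- A (2π-periodic, integrable) boundary function has bounded mean oscillation. -/
def IsBMO (f : ℝ → ℂ) : Prop :=
  (∀ θ : ℝ, f (θ + 2 * Real.pi) = f θ) ∧
  IntegrableOn f (Set.Ioc 0 (2 * Real.pi)) ∧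
  ∃ C : ℝ, ∀ θ₀ t : ℝ, 0 < t → t ≤ 1 → meanOsc f θ₀ t ≤ C

/-- A boundary function has vanishing mean oscillation. -/
def IsVMO (f : ℝ → ℂ) : Prop :=
  IsBMO f ∧ ∀ ε : ℝ, 0 < ε → ∃ δ : ℝ, 0 < δ ∧
    ∀ θ₀ t : ℝ, 0 < t → t < δ → meanOsc f θ₀ t ≤ ε

/-- The BMO seminorm of a boundary function. -/
def bmoSeminorm (f : ℝ → ℂ) : ℝ :=
  sSup {c : ℝ | ∃ θ₀ t : ℝ, 0 < t ∧ t ≤ 1 ∧ c = meanOsc f θ₀ t}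

/-- `Fb` is the (a.e.) radial boundary function of `F`. -/
def HasRadialLimits (F : ℂ → ℂ) (Fb : ℝ → ℂ) : Prop :=
  ∀ᵐ θ ∂(volume.restrict (Set.Ioc 0 (2 * Real.pi))),
    Tendsto (fun r : ℝ => F ((r : ℂ) * circlePt θ))
      (nhdsWithin 1 (Set.Iio 1)) (nhds (Fb θ))

/-- `F` is a bounded analytic function on the unit disc. -/
def MemHinf (F : ℂ → ℂ) : Prop :=
  DifferentiableOn ℂ F unitDisc ∧ ∃ M : ℝ, ∀ z ∈ unitDisc, ‖F z‖ ≤ M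

/-- `F` belongs to `QA` with boundary function `Fb`: it is a bounded analytic
function on the disc whose radial boundary values are in VMO. -/
def MemQA (F : ℂ → ℂ) (Fb : ℝ → ℂ) : Prop :=
  MemHinf F ∧ HasRadialLimits F Fb ∧ IsVMO Fb

/-- `E` is an outer function. -/
def IsOuter (E : ℂ → ℂ) : Prop :=
  DifferentiableOn ℂ E unitDisc ∧
  ∃ h : ℝ → ℝ, IntegrableOn h (Set.Ioc 0 (2 * Real.pi)) ∧ ∀ z ∈ unitDisc,
    E z = Complex.exp (((2 * Real.pi)⁻¹ : ℝ) • ∫ θ in Set.Ioc 0 (2 * Real.pi),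
      ((circlePt θ + z) / (circlePt θ - z)) * (h θ : ℂ))

/-- The integral means appearing in the definition of the Hardy space `ℍ^p`. -/
def hardyIntegral (p : ℝ) (F : ℂ → ℂ) (r : ℝ) : ℝ :=
  ∫ θ in Set.Ioc 0 (2 * Real.pi), ‖F ((r : ℂ) * circlePt θ)‖ ^ p

/-- `F` belongs to the Hardy space `ℍ^p`, `0 < p < ∞`. -/
def MemHardy (p : ℝ) (F : ℂ → ℂ) : Prop :=
  DifferentiableOn ℂ F unitDisc ∧
  ∃ M : ℝ, ∀ r : ℝ, 0 < r → r < 1 → hardyIntegral p F r ≤ M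

/-- `F` belongs to `BMOA` with boundary function `Fb`. -/
def MemBMOA (F : ℂ → ℂ) (Fb : ℝ → ℂ) : Prop :=
  MemHardy 2 F ∧ HasRadialLimits F Fb ∧ IsBMO Fb

/-- `F` belongs to `VMOA` with boundary function `Fb`. -/
def MemVMOA (F : ℂ → ℂ) (Fb : ℝ → ℂ) : Prop :=
  MemHardy 2 F ∧ HasRadialLimits F Fb ∧ IsVMO Fb

/-- The generalized Volterra operator `T_G(F)(z) = ∫₀^z F(w) G'(w) dw`. -/
def volterra (G F : ℂ → ℂ) (z : ℂ) : ℂ :=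
  ∫ t in (0:ℝ)..1, z * F ((t : ℂ) * z) * deriv G ((t : ℂ) * z)


section
open Metric
open Real (circleAverage)
open ComplexConjugate

variable {f g : ℂ → ℂ} {a b : ℕ → ℂ} {r : ℝ}

/-- `f` is represented on the unit disc by the power series with coefficients `a`. -/
def HasDiscSeries (a : ℕ → ℂ) (f : ℂ → ℂ) : Prop :=
  ∀ z ∈ ball (0 : ℂ) 1, HasSum (fun n => a n * z ^ n) (f z)

namespace HasDiscSeries

variable {a b : ℕ → ℂ} {f g : ℂ → ℂ}

lemma hasFPowerSeriesAt (h : HasDiscSeries a f) :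
    HasFPowerSeriesAt f (FormalMultilinearSeries.ofScalars ℂ a) 0 := by
  rw [hasFPowerSeriesAt_iff]
  filter_upwards [ball_mem_nhds (0 : ℂ) one_pos] with z hz
  simpa [FormalMultilinearSeries.coeff_ofScalars, mul_comm] using h z hz

lemma unique (h : HasDiscSeries a f) (h' : HasDiscSeries b f) : a = b := by
  have := h.hasFPowerSeriesAt.eq_formalMultilinearSeries h'.hasFPowerSeriesAt
  ext n
  have := congrArg (fun p => p.coeff n) this
  simpa [FormalMultilinearSeries.coeff_ofScalars] using this

lemma exists_norm_le (h : HasDiscSeries a f) {s : ℝ} (hs0 : 0 ≤ s) (hs : s < 1) :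
    ∃ C, ∀ n, ‖a n‖ * s ^ n ≤ C := by
  have h1 : (s : ℂ) ∈ ball (0 : ℂ) 1 := by simpa [abs_of_nonneg hs0] using hs
  have h2 := (h _ h1).summable.tendsto_atTop_zero.norm
  obtain ⟨C, hC⟩ := h2.bddAbove_range
  refine ⟨C, fun n => ?_⟩
  have := hC (mem_range_self n)
  simpa [abs_of_nonneg hs0] using this

lemma summable_norm (h : HasDiscSeries a f) {s : ℝ} (hs0 : 0 ≤ s) (hs : s < 1) :
    Summable fun n => ‖a n‖ * s ^ n := by
  obtain ⟨t, ht0, ht1⟩ := exists_between hs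
  have htp : 0 < t := hs0.trans_lt ht0
  obtain ⟨C, hC⟩ := h.exists_norm_le htp.le ht1
  have hq : s / t < 1 := (div_lt_one htp).2 ht0
  refine Summable.of_nonneg_of_le (fun n => by positivity) (fun n => ?_)
    ((summable_geometric_of_lt_one (by positivity) hq).mul_left C)
  calc ‖a n‖ * s ^ n = (‖a n‖ * t ^ n) * (s / t) ^ n := by
        rw [div_pow]; field_simp
    _ ≤ C * (s / t) ^ n := by gcongr; exact hC n

lemma analyticOnNhd (h : HasDiscSeries a f) : AnalyticOnNhd ℂ f (ball 0 1) := by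
  have : DifferentiableOn ℂ f (ball 0 1) := by
    intro z hz
    obtain ⟨s, hs0, hs1⟩ := exists_between (mem_ball_zero_iff.1 hz)
    have hs : DifferentiableOn ℂ (fun z => ∑' n, a n * z ^ n) (ball 0 s) := by
      refine Complex.differentiableOn_tsum_of_summable_norm
        (h.summable_norm ((norm_nonneg z).trans hs0.le) hs1) (fun n => by fun_prop) isOpen_ball ?_
      intro n w hw
      rw [norm_mul, norm_pow]
      have := (mem_ball_zero_iff.1 hw).le
      gcongr
    have hzs : z ∈ ball (0 : ℂ) s := by simpa using hs0
    have hev : f =ᶠ[𝓝 z] (fun z => ∑' n, a n * z ^ n) := by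
      filter_upwards [isOpen_ball.mem_nhds hz] with w hw
      exact (h w hw).tsum_eq.symm
    exact ((hs.differentiableAt (isOpen_ball.mem_nhds hzs)).congr_of_eventuallyEq
      hev).differentiableWithinAt
  exact this.analyticOnNhd isOpen_ball

lemma differentiableOn (h : HasDiscSeries a f) : DifferentiableOn ℂ f (ball 0 1) :=
  h.analyticOnNhd.differentiableOn

end HasDiscSeries

/-- The Taylor coefficients of `f` at `0`. -/
def taylorCoef (f : ℂ → ℂ) (n : ℕ) : ℂ := ((n.factorial : ℂ))⁻¹ * iteratedDeriv n f 0


lemma DifferentiableOn.hasDiscSeries (h : DifferentiableOn ℂ f (ball 0 1)) :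
    HasDiscSeries (taylorCoef f) f := by
  intro z hz
  have := Complex.hasSum_taylorSeries_on_ball h hz
  have he : (fun n => taylorCoef f n * z ^ n) =
      fun n : ℕ => (n.factorial : ℂ)⁻¹ • (z - 0) ^ n • iteratedDeriv n f 0 := by
    ext n
    simp only [taylorCoef, sub_zero, smul_eq_mul]; ring
  rwa [he]

lemma HasDiscSeries.deriv (h : HasDiscSeries a f) :
    HasDiscSeries (fun n => (n + 1 : ℂ) * a (n + 1)) (deriv f) := by
  have hd : DifferentiableOn ℂ (_root_.deriv f) (ball 0 1) := h.differentiableOn.deriv isOpen_ball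
  have ha : a = taylorCoef f := h.unique h.differentiableOn.hasDiscSeries
  convert hd.hasDiscSeries using 2 with n
  subst ha
  rw [taylorCoef, taylorCoef, iteratedDeriv_succ', Nat.factorial_succ]
  push_cast
  have : (n + 1 : ℂ) ≠ 0 := by exact_mod_cast n.succ_ne_zero
  field_simp

lemma HasDiscSeries.apply_zero (h : HasDiscSeries a f) : f 0 = a 0 := by
  have h1 := h 0 (by simp)
  have h2 : HasSum (fun n => a n * (0 : ℂ) ^ n) (a 0) := by
    convert hasSum_single (f := fun n => a n * (0 : ℂ) ^ n) 0 ?_ using 1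
    · simp
    · intro n hn; simp [hn]
  exact h1.unique h2

/-- Power series with bounded coefficients converge on the disc. -/
lemma hasDiscSeries_of_norm_le {C : ℝ} (ha : ∀ n, ‖a n‖ ≤ C) :
    HasDiscSeries a (fun z => ∑' n, a n * z ^ n) := by
  intro z hz
  refine Summable.hasSum (.of_norm_bounded
    ((summable_geometric_of_lt_one (norm_nonneg z) (mem_ball_zero_iff.1 hz)).mul_left C) ?_)
  intro n
  rw [norm_mul, norm_pow]
  gcongr
  exact ha n

lemma ContinuousOn.circleIntegrable_of_ball {E : Type*} [NormedAddCommGroup E] {f : ℂ → E} {r : ℝ}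
    (hf : ContinuousOn f (ball 0 1)) (hr0 : 0 ≤ r) (hr : r < 1) : CircleIntegrable f 0 r :=
  ContinuousOn.circleIntegrable hr0 (hf.mono fun z hz => by
    simp only [mem_sphere_iff_norm, sub_zero] at hz; simpa [hz] using hr)

/-- Termwise circle averages of a normally convergent series. -/
lemma hasSum_circleAverage {E : Type*} [NormedAddCommGroup E] [NormedSpace ℝ E] [CompleteSpace E]
    {F : ℕ → ℂ → E} {f : ℂ → E} {r : ℝ} {u : ℕ → ℝ}
    (hF : ∀ n, ContinuousOn (F n) (sphere 0 |r|)) (hu : Summable u)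
    (hb : ∀ n, ∀ z ∈ sphere (0 : ℂ) |r|, ‖F n z‖ ≤ u n)
    (hs : ∀ z ∈ sphere (0 : ℂ) |r|, HasSum (fun n => F n z) (f z)) :
    HasSum (fun n => circleAverage (F n) 0 r) (circleAverage f 0 r) := by
  have hm : ∀ θ, circleMap 0 r θ ∈ sphere (0 : ℂ) |r| := fun θ => circleMap_mem_sphere' 0 r θ
  simp only [Real.circleAverage_def]
  refine HasSum.const_smul _ ?_
  refine intervalIntegral.hasSum_integral_of_dominated_convergence (fun n _ => u n) ?_ ?_ ?_ ?_ ?_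
  · intro n
    refine Continuous.aestronglyMeasurable ?_
    exact (hF n).comp_continuous (continuous_circleMap 0 r) hm
  · exact fun n => .of_forall fun t _ => hb n _ (hm t)
  · exact .of_forall fun t _ => hu
  · exact intervalIntegrable_const
  · exact .of_forall fun t _ => hs _ (hm t)

lemma circleAverage_pow_mul_conj_pow (m n : ℕ) (r : ℝ) :
    circleAverage (fun z => z ^ m * conj z ^ n) 0 r = if m = n then (r : ℂ) ^ (2 * n) else 0 := by
  have he : ∀ θ : ℝ, (circleMap 0 r θ) ^ m * conj (circleMap 0 r θ) ^ n =
      (r : ℂ) ^ (m + n) * Complex.exp (((m : ℂ) - n) * Complex.I * θ) := by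
    intro θ
    simp only [circleMap, zero_add, map_mul, Complex.conj_ofReal, ← Complex.exp_conj,
      Complex.conj_I, mul_pow, ← Complex.exp_nat_mul]
    rw [show ((m : ℂ) - n) * Complex.I * θ = m * (θ * Complex.I) + n * (θ * -Complex.I) by ring,
      Complex.exp_add]
    ring
  rw [Real.circleAverage_def]
  simp only [he]
  split_ifs with h
  · subst h
    simp only [sub_self, zero_mul, Complex.exp_zero, mul_one, intervalIntegral.integral_const,
      sub_zero, Complex.real_smul, Complex.ofReal_inv]
    rw [← mul_assoc, inv_mul_cancel₀ (by simp [Real.pi_ne_zero]), one_mul, two_mul]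
  · have hc : ((m : ℂ) - n) * Complex.I ≠ 0 :=
      mul_ne_zero (sub_ne_zero.2 (by exact_mod_cast h)) Complex.I_ne_zero
    rw [intervalIntegral.integral_const_mul, integral_exp_mul_complex hc]
    have : Complex.exp (((m : ℂ) - n) * Complex.I * (2 * Real.pi : ℝ)) = 1 := by
      rw [Complex.exp_eq_one_iff]
      exact ⟨m - n, by push_cast; ring⟩
    rw [this]; simp

variable {r : ℝ}

lemma HasDiscSeries.hasSum_on_sphere (h : HasDiscSeries a f) (hr0 : 0 ≤ r) (hr : r < 1) {z : ℂ}
    (hz : z ∈ sphere (0 : ℂ) |r|) : HasSum (fun n => a n * z ^ n) (f z) :=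
  h z (by simpa [mem_sphere_zero_iff_norm.1 hz, abs_of_nonneg hr0] using hr)

lemma HasDiscSeries.continuousOn_sphere (h : HasDiscSeries a f) (hr0 : 0 ≤ r) (hr : r < 1) :
    ContinuousOn f (sphere 0 |r|) :=
  h.differentiableOn.continuousOn.mono fun z hz => by
    simpa [mem_sphere_zero_iff_norm.1 hz, abs_of_nonneg hr0] using hr

lemma HasDiscSeries.circleAverage_mul_conj_pow (h : HasDiscSeries a f) (hr0 : 0 ≤ r) (hr : r < 1)
    (n : ℕ) : circleAverage (fun z => f z * conj z ^ n) 0 r = a n * (r : ℂ) ^ (2 * n) := by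
  have hs := hasSum_circleAverage (r := r) (F := fun m z => a m * z ^ m * conj z ^ n)
    (f := fun z => f z * conj z ^ n) (u := fun m => ‖a m‖ * r ^ m * r ^ n)
    (fun m => by fun_prop) ((h.summable_norm hr0 hr).mul_right _)
    (fun m z hz => by
      simp [mem_sphere_zero_iff_norm.1 hz, abs_of_nonneg hr0])
    (fun z hz => (h.hasSum_on_sphere hr0 hr hz).mul_right _)
  refine hs.unique ?_
  have : ∀ m, circleAverage (fun z => a m * z ^ m * conj z ^ n) 0 r =
      if m = n then a n * (r : ℂ) ^ (2 * n) else 0 := by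
    intro m
    have := Real.circleAverage_fun_smul (𝕜 := ℂ) (a := a m) (f := fun z => z ^ m * conj z ^ n)
      (c := 0) (R := r)
    simp only [smul_eq_mul, ← mul_assoc] at this
    rw [this, circleAverage_pow_mul_conj_pow]
    split_ifs with hmn <;> simp [hmn]
  simp only [this]
  exact hasSum_ite_eq n _

/-- Parseval's formula for the pairing of two analytic functions on a circle. -/
lemma HasDiscSeries.hasSum_circleAverage_mul_conj (h : HasDiscSeries a f) (h' : HasDiscSeries b g)
    (hr0 : 0 ≤ r) (hr : r < 1) :
    HasSum (fun n => a n * conj (b n) * (r : ℂ) ^ (2 * n))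
      (circleAverage (fun z => f z * conj (g z)) 0 r) := by
  obtain ⟨C, hC⟩ := (isCompact_sphere (0 : ℂ) |r|).exists_bound_of_continuousOn
    (h.continuousOn_sphere hr0 hr)
  have hs := hasSum_circleAverage (r := r) (F := fun n z => f z * conj (b n * z ^ n))
    (f := fun z => f z * conj (g z)) (u := fun n => C * (‖b n‖ * r ^ n))
    (fun n => (h.continuousOn_sphere hr0 hr).mul (by fun_prop))
    ((h'.summable_norm hr0 hr).mul_left _)
    (fun n z hz => by
      rw [norm_mul, RCLike.norm_conj, norm_mul, norm_pow, mem_sphere_zero_iff_norm.1 hz,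
        abs_of_nonneg hr0]
      gcongr
      exact hC z hz)
    (fun z hz => ((Complex.hasSum_conj'.2 (by simpa using h'.hasSum_on_sphere hr0 hr hz))).mul_left _)
  have he : ∀ n, circleAverage (fun z => f z * conj (b n * z ^ n)) 0 r =
      a n * conj (b n) * (r : ℂ) ^ (2 * n) := by
    intro n
    have := Real.circleAverage_fun_smul (𝕜 := ℂ) (a := conj (b n)) (f := fun z => f z * conj z ^ n)
      (c := 0) (R := r)
    rw [h.circleAverage_mul_conj_pow hr0 hr] at this
    rw [mul_comm (a n), mul_assoc, ← smul_eq_mul (conj (b n)), ← this]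
    congr 1; ext z
    simp; ring
  simpa only [he] using hs

lemma HasDiscSeries.hasSum_circleAverage_norm_sq (h : HasDiscSeries a f)
    (hr0 : 0 ≤ r) (hr : r < 1) :
    HasSum (fun n => ‖a n‖ ^ 2 * r ^ (2 * n)) (circleAverage (fun z => ‖f z‖ ^ 2) 0 r) := by
  have h1 := h.hasSum_circleAverage_mul_conj h hr0 hr
  have hci : CircleIntegrable (fun z => f z * conj (f z)) 0 r := by
    refine ContinuousOn.circleIntegrable hr0 ?_
    have := h.continuousOn_sphere hr0 hr
    rw [abs_of_nonneg hr0] at this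
    fun_prop
  have h2 := Complex.hasSum_re h1
  have h3 : (circleAverage (fun z => f z * conj (f z)) 0 r).re =
      circleAverage (fun z => ‖f z‖ ^ 2) 0 r := by
    rw [← Complex.reCLM_apply, ← ContinuousLinearMap.circleAverage_comp_comm _ hci]
    congr 1; ext z
    simp only [Complex.mul_conj, Complex.normSq_eq_norm_sq, Function.comp_apply, Complex.reCLM_apply,
      Complex.ofReal_re]
  rw [h3] at h2
  have he : ∀ n, (a n * conj (a n) * (r : ℂ) ^ (2 * n)).re = ‖a n‖ ^ 2 * r ^ (2 * n) := by
    intro n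
    rw [Complex.mul_conj, Complex.normSq_eq_norm_sq, ← Complex.ofReal_pow, ← Complex.ofReal_mul,
      Complex.ofReal_re]
  simpa only [he] using h2

/-- The radial weight `4 r log (1 / r)` of the Littlewood-Paley area integral. -/
def areaWeight (r : ℝ) : ℝ := 4 * Real.negMulLog r

lemma continuous_areaWeight : Continuous areaWeight := by
  unfold areaWeight; fun_prop

lemma areaWeight_nonneg {r : ℝ} (h0 : 0 ≤ r) (h1 : r ≤ 1) : 0 ≤ areaWeight r :=
  mul_nonneg (by norm_num) (Real.negMulLog_nonneg h0 h1)

/-- The integral over `[0, ρ]` of `(n + 1) ^ 2 * r ^ (2 * n)` against `areaWeight`. -/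
def areaMoment (n : ℕ) (ρ : ℝ) : ℝ :=
  2 * (n + 1) * ρ ^ (2 * n + 1) * Real.negMulLog ρ + ρ ^ (2 * n + 2)

lemma areaMoment_one (n : ℕ) : areaMoment n 1 = 1 := by simp [areaMoment]

lemma continuous_areaMoment (n : ℕ) : Continuous (areaMoment n) := by
  unfold areaMoment; fun_prop

lemma integral_areaWeight (n : ℕ) {ρ : ℝ} (h0 : 0 ≤ ρ) :
    ∫ r in 0..ρ, areaWeight r * ((n + 1) ^ 2 * r ^ (2 * n)) = areaMoment n ρ := by
  have h := intervalIntegral.integral_eq_sub_of_hasDerivAt_of_le (f := areaMoment n)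
    (f' := fun r => areaWeight r * ((n + 1) ^ 2 * r ^ (2 * n))) h0
    (continuous_areaMoment n).continuousOn ?_ ?_
  · rw [h, show areaMoment n 0 = 0 by simp [areaMoment], sub_zero]
  · intro x hx
    have h1 := (((hasDerivAt_pow (2 * n + 1) x).const_mul (2 * (n + 1 : ℝ))).mul
      (Real.hasDerivAt_negMulLog hx.1.ne')).add (hasDerivAt_pow (2 * n + 2) x)
    refine (show HasDerivAt (areaMoment n) _ x from h1).congr_deriv ?_
    simp only [areaWeight, Real.negMulLog]
    rw [show 2 * n + 1 - 1 = 2 * n by omega, show 2 * n + 2 - 1 = 2 * n + 1 by omega]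
    push_cast
    ring
  · have := continuous_areaWeight
    exact Continuous.intervalIntegrable (by fun_prop) _ _

lemma areaMoment_nonneg (n : ℕ) {ρ : ℝ} (h0 : 0 ≤ ρ) (h1 : ρ ≤ 1) : 0 ≤ areaMoment n ρ := by
  have := Real.negMulLog_nonneg h0 h1
  unfold areaMoment; positivity

lemma areaMoment_le_one (n : ℕ) {ρ : ℝ} (h0 : 0 ≤ ρ) (h1 : ρ ≤ 1) : areaMoment n ρ ≤ 1 := by
  rw [← areaMoment_one n, ← integral_areaWeight n h0, ← integral_areaWeight n zero_le_one]
  have := continuous_areaWeight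
  refine intervalIntegral.integral_mono_interval le_rfl h0 h1 ?_
    (Continuous.intervalIntegrable (by fun_prop) _ _)
  filter_upwards [ae_restrict_mem measurableSet_Ioc] with r hr
  have := areaWeight_nonneg hr.1.le hr.2
  exact mul_nonneg this (by have := hr.1.le; positivity)

lemma areaWeight_le_four {r : ℝ} (h0 : 0 ≤ r) : areaWeight r ≤ 4 := by
  have : Real.negMulLog r ≤ 1 := by
    have := Real.negMulLog_le_one_sub_self h0
    linarith
  unfold areaWeight; linarith

/-- The area integral pairing of two analytic functions, in terms of coefficients. -/
lemma HasDiscSeries.hasSum_area_pairing (h : HasDiscSeries a f) (h' : HasDiscSeries b g) {ρ : ℝ}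
    (h0 : 0 ≤ ρ) (h1 : ρ < 1) :
    HasSum (fun n => a (n + 1) * conj (b (n + 1)) * (areaMoment n ρ : ℂ))
      (∫ r in 0..ρ, (areaWeight r : ℂ) *
        circleAverage (fun z => _root_.deriv f z * conj (_root_.deriv g z)) 0 r) := by
  have hf := h.deriv
  have hg := h'.deriv
  obtain ⟨C, hC⟩ := hg.exists_norm_le h0 h1
  have hsum := (hf.summable_norm h0 h1).mul_left (4 * C)
  have hs := intervalIntegral.hasSum_integral_of_dominated_convergence (a := 0) (b := ρ)
    (μ := volume)
    (F := fun (n : ℕ) (r : ℝ) => (areaWeight r : ℂ) * ((((n + 1 : ℂ) * a (n + 1)) *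
      conj ((n + 1 : ℂ) * b (n + 1))) * (r : ℂ) ^ (2 * n)))
    (f := fun r => (areaWeight r : ℂ) *
        circleAverage (fun z => _root_.deriv f z * conj (_root_.deriv g z)) 0 r)
    (fun (n : ℕ) _ => 4 * C * (‖(n + 1 : ℂ) * a (n + 1)‖ * ρ ^ n)) ?_ ?_ ?_ ?_ ?_
  · have he : ∀ n : ℕ, ∫ r in 0..ρ, (areaWeight r : ℂ) * ((((n + 1 : ℂ) * a (n + 1)) *
      conj ((n + 1 : ℂ) * b (n + 1))) * (r : ℂ) ^ (2 * n)) =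
        a (n + 1) * conj (b (n + 1)) * (areaMoment n ρ : ℂ) := by
      intro n
      rw [← integral_areaWeight n h0, ← intervalIntegral.integral_ofReal,
        ← intervalIntegral.integral_const_mul]
      congr 1; ext r
      simp; ring
    simpa only [he] using hs
  · intro n
    have := continuous_areaWeight
    exact Continuous.aestronglyMeasurable (by fun_prop)
  · intro n
    refine .of_forall fun r hr => ?_
    rw [uIoc_of_le h0] at hr
    have hw := areaWeight_nonneg hr.1.le (hr.2.trans h1.le)
    rw [norm_mul, norm_mul, norm_mul, RCLike.norm_conj, norm_pow, Complex.norm_real,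
      Complex.norm_real, Real.norm_eq_abs, Real.norm_eq_abs, abs_of_nonneg hw, abs_of_pos hr.1]
    calc areaWeight r * (‖(n + 1 : ℂ) * a (n + 1)‖ * ‖(n + 1 : ℂ) * b (n + 1)‖ * r ^ (2 * n))
        ≤ 4 * (‖(n + 1 : ℂ) * a (n + 1)‖ * ‖(n + 1 : ℂ) * b (n + 1)‖ * ρ ^ (2 * n)) := by
          have := hr.1.le
          gcongr
          · exact areaWeight_le_four hr.1.le
          · exact hr.2
      _ = 4 * (‖(n + 1 : ℂ) * b (n + 1)‖ * ρ ^ n) * (‖(n + 1 : ℂ) * a (n + 1)‖ * ρ ^ n) := by ring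
      _ ≤ 4 * C * (‖(n + 1 : ℂ) * a (n + 1)‖ * ρ ^ n) := by gcongr; exact hC n
  · exact .of_forall fun r hr => hsum
  · exact intervalIntegrable_const
  · refine .of_forall fun r hr => ?_
    rw [uIoc_of_le h0] at hr
    exact (hf.hasSum_circleAverage_mul_conj hg hr.1.le (hr.2.trans_lt h1)).mul_left _

lemma HasDiscSeries.sum_norm_sq_le (h : HasDiscSeries a f) {M : ℝ}
    (hM : ∀ r, 0 < r → r < 1 → circleAverage (fun z => ‖f z‖ ^ 2) 0 r ≤ M) (s : Finset ℕ) :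
    ∑ n ∈ s, ‖a n‖ ^ 2 ≤ M := by
  have hlim : Tendsto (fun r : ℝ => ∑ n ∈ s, ‖a n‖ ^ 2 * r ^ (2 * n)) (𝓝[<] 1)
      (𝓝 (∑ n ∈ s, ‖a n‖ ^ 2)) := by
    have : Continuous (fun r : ℝ => ∑ n ∈ s, ‖a n‖ ^ 2 * r ^ (2 * n)) := by fun_prop
    have := (this.tendsto 1).mono_left (nhdsWithin_le_nhds (s := Iio 1))
    simpa using this
  refine le_of_tendsto hlim ?_
  filter_upwards [Ioo_mem_nhdsLT (zero_lt_one' ℝ)] with r hr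
  refine (sum_le_hasSum s (fun n _ => ?_) (h.hasSum_circleAverage_norm_sq hr.1.le hr.2)).trans
    (hM r hr.1 hr.2)
  have := hr.1
  positivity

lemma ContinuousOn.circleAverage_of_ball {E : Type*} [NormedAddCommGroup E] [NormedSpace ℝ E]
    {f : ℂ → E} (hf : ContinuousOn f (ball 0 1)) : ContinuousOn (circleAverage f 0) (Ico 0 1) :=
  Real.ContinuousOn.circleAverage (hf.mono fun z hz => by simpa using hz.2) fun r hr => hr.1

/-- The Littlewood-Paley area integral is controlled by the Hardy norm. -/
lemma area_integral_le (hf : DifferentiableOn ℂ f (ball 0 1)) {M : ℝ}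
    (hM : ∀ r, 0 < r → r < 1 → circleAverage (fun z => ‖f z‖ ^ 2) 0 r ≤ M) {ρ : ℝ}
    (h0 : 0 ≤ ρ) (h1 : ρ < 1) :
    ∫ r in 0..ρ, areaWeight r * circleAverage (fun z => ‖deriv f z‖ ^ 2) 0 r ≤ M := by
  have h := hf.hasDiscSeries
  have hs := h.hasSum_area_pairing h h0 h1
  have hd : ContinuousOn (deriv f) (ball 0 1) := (hf.deriv isOpen_ball).continuousOn
  have he : (∫ r in 0..ρ, (areaWeight r : ℂ) *
      circleAverage (fun z => deriv f z * conj (deriv f z)) 0 r) =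
      ((∫ r in 0..ρ, areaWeight r * circleAverage (fun z => ‖deriv f z‖ ^ 2) 0 r : ℝ) : ℂ) := by
    rw [← intervalIntegral.integral_ofReal]
    refine intervalIntegral.integral_congr fun r hr => ?_
    rw [uIcc_of_le h0] at hr
    simp only [Complex.ofReal_mul]
    congr 1
    have hci : CircleIntegrable (fun z => ‖deriv f z‖ ^ 2) 0 r :=
      ContinuousOn.circleIntegrable_of_ball (by fun_prop) hr.1 (hr.2.trans_lt h1)
    rw [← Complex.ofRealCLM_apply, ← ContinuousLinearMap.circleAverage_comp_comm _ hci]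
    congr 1; ext z
    simp [Complex.mul_conj, Complex.normSq_eq_norm_sq]
  rw [he] at hs
  have hs' := Complex.hasSum_re hs
  rw [Complex.ofReal_re] at hs'
  refine hasSum_le_of_sum_le hs' fun s => ?_
  calc ∑ n ∈ s, (taylorCoef f (n + 1) * conj (taylorCoef f (n + 1)) * (areaMoment n ρ : ℂ)).re
      ≤ ∑ n ∈ s, ‖taylorCoef f (n + 1)‖ ^ 2 := by
        refine Finset.sum_le_sum fun n _ => ?_
        rw [Complex.mul_conj, Complex.normSq_eq_norm_sq, ← Complex.ofReal_mul, Complex.ofReal_re]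
        exact mul_le_of_le_one_right (by positivity) (areaMoment_le_one n h0 h1.le)
    _ = ∑ n ∈ s.map (addRightEmbedding 1), ‖taylorCoef f n‖ ^ 2 := by simp
    _ ≤ M := h.sum_norm_sq_le hM _

/-- The Szegő kernel of the disc. -/
def szegoKernel (w z : ℂ) : ℂ := (1 - conj w * z)⁻¹

lemma hasDiscSeries_szegoKernel {w : ℂ} (hw : w ∈ ball (0 : ℂ) 1) :
    HasDiscSeries (fun n => conj w ^ n) (szegoKernel w) := by
  intro z hz
  simp only [← mul_pow]
  refine hasSum_geometric_of_norm_lt_one ?_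
  rw [norm_mul, RCLike.norm_conj]
  rw [mem_ball_zero_iff] at hw hz
  nlinarith [norm_nonneg w, norm_nonneg z]

lemma tendsto_area_pairing_szegoKernel (hf : DifferentiableOn ℂ f (ball 0 1)) {w : ℂ}
    (hw : w ∈ ball (0 : ℂ) 1) :
    Tendsto (fun ρ : ℝ => ∫ r in 0..ρ, (areaWeight r : ℂ) *
        circleAverage (fun z => deriv f z * conj (deriv (szegoKernel w) z)) 0 r)
      (𝓝[<] 1) (𝓝 (f w - f 0)) := by
  have h := hf.hasDiscSeries
  have hk := hasDiscSeries_szegoKernel hw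
  have hsum : ∑' n, taylorCoef f (n + 1) * w ^ (n + 1) = f w - f 0 := by
    have h1 := (h w hw)
    rw [h.apply_zero, ← h1.tsum_eq,
      h1.summable.tsum_eq_zero_add]
    simp
  rw [← hsum]
  have hlim : Tendsto (fun ρ : ℝ => ∑' n, taylorCoef f (n + 1) * conj (conj w ^ (n + 1)) *
      (areaMoment n ρ : ℂ)) (𝓝[<] 1) (𝓝 (∑' n, taylorCoef f (n + 1) * w ^ (n + 1))) := by
    refine tendsto_tsum_of_dominated_convergence
      (bound := fun n => ‖taylorCoef f (n + 1)‖ * ‖w‖ ^ (n + 1)) ?_ ?_ ?_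
    · exact (summable_nat_add_iff 1).2
        (h.summable_norm (norm_nonneg w) (mem_ball_zero_iff.1 hw))
    · intro n
      have h1 : Continuous fun ρ : ℝ => taylorCoef f (n + 1) * conj (conj w ^ (n + 1)) *
        (areaMoment n ρ : ℂ) := by
        have := continuous_areaMoment n
        fun_prop
      have := (h1.tendsto 1).mono_left (nhdsWithin_le_nhds (s := Iio 1))
      simpa [areaMoment_one] using this
    · filter_upwards [Ioo_mem_nhdsLT (zero_lt_one' ℝ)] with ρ hρ n
      rw [norm_mul, norm_mul, RCLike.norm_conj, norm_pow, RCLike.norm_conj, Complex.norm_real,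
        Real.norm_eq_abs, abs_of_nonneg (areaMoment_nonneg n hρ.1.le hρ.2.le)]
      exact mul_le_of_le_one_right (by positivity) (areaMoment_le_one n hρ.1.le hρ.2.le)
  refine hlim.congr' ?_
  filter_upwards [Ioo_mem_nhdsLT (zero_lt_one' ℝ)] with ρ hρ
  exact (h.hasSum_area_pairing hk hρ.1.le hρ.2).tsum_eq

lemma norm_circleAverage_le {E : Type*} [NormedAddCommGroup E] [NormedSpace ℝ E] (f : ℂ → E)
    (c : ℂ) (r : ℝ) : ‖circleAverage f c r‖ ≤ circleAverage (fun z => ‖f z‖) c r := by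
  rw [Real.circleAverage_def, Real.circleAverage_def, norm_smul, smul_eq_mul, norm_inv,
    Real.norm_of_nonneg Real.two_pi_pos.le]
  gcongr
  exact intervalIntegral.norm_integral_le_integral_norm Real.two_pi_pos.le

/-- The real part of the Herglotz-Riesz kernel of the unit disc. -/
def discPoisson (w ζ : ℂ) : ℝ := (herglotzRieszKernel 0 w ζ).re

lemma discPoisson_nonneg {w ζ : ℂ} (hw : w ∈ ball (0 : ℂ) 1) (hζ : ζ ∈ sphere (0 : ℂ) 1) :
    0 ≤ discPoisson w ζ := by
  have h := congrFun (poissonKernel_eq_re_herglotzRieszKernel (c := 0) (w := w)) ζ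
  simp only [Function.comp_apply, poissonKernel_def, sub_zero] at h
  rw [discPoisson, ← h, mem_sphere_zero_iff_norm.1 hζ]
  have := mem_ball_zero_iff.1 hw
  have : ‖w‖ ^ 2 ≤ 1 := by nlinarith [norm_nonneg w]
  exact div_nonneg (by linarith) (by positivity)

lemma continuousOn_discPoisson {w : ℂ} (hw : w ∈ ball (0 : ℂ) 1) :
    ContinuousOn (discPoisson w) (sphere 0 1) := by
  have := continuousOn_herglotzRieszKernel_sphere hw
  rw [abs_one] at this
  exact Complex.continuous_re.comp_continuousOn this

lemma diffContOnCl_one_sub_mul_cpow {p : ℝ} (hp : 0 < p) {b : ℂ} (hb : ‖b‖ ≤ 1) :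
    DiffContOnCl ℂ (fun z => (1 - b * z) ^ (p : ℂ)) (ball 0 1) := by
  have hlt : ∀ z : ℂ, ‖b * z‖ < 1 → 1 - b * z ∈ Complex.slitPlane := fun z hz => by
    have := Complex.mem_slitPlane_of_norm_lt_one (z := - (b * z)) (by rwa [norm_neg])
    rwa [← sub_eq_add_neg] at this
  refine ⟨fun z hz => ?_, ?_⟩
  · have h1 : ‖b * z‖ < 1 := by
      rw [norm_mul]
      have := mem_ball_zero_iff.1 hz
      nlinarith [norm_nonneg b, norm_nonneg z]
    have h2 : DifferentiableAt ℂ (fun z : ℂ => 1 - b * z) z :=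
      (differentiableAt_id.const_mul b).const_sub 1
    exact (h2.cpow (differentiableAt_const _) (hlt z h1)).differentiableWithinAt
  · rw [closure_ball 0 one_ne_zero]
    intro z hz
    have hc : ContinuousAt (fun z : ℂ => 1 - b * z) z := by fun_prop
    refine ContinuousAt.continuousWithinAt ?_
    by_cases h0 : 1 - b * z = 0
    · have h1 := Complex.continuousAt_cpow_zero_of_re_pos (z := (p : ℂ)) (by simpa using hp)
      rw [← h0] at h1
      exact ContinuousAt.comp (f := fun z : ℂ => (1 - b * z, (p : ℂ))) h1
        (hc.prodMk continuousAt_const)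
    · refine hc.cpow continuousAt_const ?_
      have h1 : ‖b * z‖ ≤ 1 := by
        rw [norm_mul]
        have := mem_closedBall_zero_iff.1 hz
        nlinarith [norm_nonneg b, norm_nonneg z]
      rw [Complex.mem_slitPlane_iff]
      by_contra! hcon
      obtain ⟨h2, h3⟩ := hcon
      simp only [Complex.sub_re, Complex.one_re] at h2
      have h4 := Complex.re_le_norm (b * z)
      refine h0 (Complex.ext ?_ h3)
      simp only [Complex.sub_re, Complex.one_re, Complex.zero_re]
      linarith

/-- A continuous function on a closed ball that is holomorphic inside and whose modulus is
`‖∏ (z - a)‖ ^ p` on the circle and larger inside. -/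
lemma exists_outer_part_of_multiset {p : ℝ} (hp : 0 < p) (s : Multiset ℂ) :
    ∃ g : ℂ → ℂ, DiffContOnCl ℂ g (ball 0 1) ∧
      (∀ z ∈ ball (0 : ℂ) 1, ‖(s.map fun a => z - a).prod‖ ^ p ≤ ‖g z‖) ∧
      ∀ z ∈ sphere (0 : ℂ) 1, ‖g z‖ = ‖(s.map fun a => z - a).prod‖ ^ p := by
  induction s using Multiset.induction_on with
  | empty => exact ⟨fun _ => 1, diffContOnCl_const, by simp, by simp⟩
  | cons a s ih =>
    obtain ⟨g, hg, hg1, hg2⟩ := ih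
    suffices h : ∃ k : ℂ → ℂ, DiffContOnCl ℂ k (ball 0 1) ∧
        (∀ z ∈ ball (0 : ℂ) 1, ‖z - a‖ ^ p ≤ ‖k z‖) ∧
        ∀ z ∈ sphere (0 : ℂ) 1, ‖k z‖ = ‖z - a‖ ^ p by
      obtain ⟨k, hk, hk1, hk2⟩ := h
      refine ⟨fun z => k z • g z, hk.smul hg, fun z hz => ?_, fun z hz => ?_⟩
      · rw [Multiset.map_cons, Multiset.prod_cons, norm_mul, norm_smul,
          Real.mul_rpow (norm_nonneg _) (norm_nonneg _)]
        exact mul_le_mul (hk1 z hz) (hg1 z hz) (by positivity) (by positivity)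
      · rw [Multiset.map_cons, Multiset.prod_cons, norm_mul, norm_smul,
          Real.mul_rpow (norm_nonneg _) (norm_nonneg _), hk2 z hz, hg2 z hz]
    have hnorm : ∀ z : ℂ, ‖z ^ (p : ℂ)‖ = ‖z‖ ^ p := fun z =>
      Complex.norm_cpow_real z p
    by_cases ha : ‖a‖ < 1
    · have key : ∀ z : ℂ, ‖1 - conj a * z‖ ^ 2 - ‖z - a‖ ^ 2 =
          (1 - ‖z‖ ^ 2) * (1 - ‖a‖ ^ 2) := by
        intro z
        simp only [← Complex.normSq_eq_norm_sq, Complex.normSq_apply]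
        simp
        ring
      refine ⟨fun z => (1 - conj a * z) ^ (p : ℂ),
        diffContOnCl_one_sub_mul_cpow hp (by simpa using ha.le), fun z hz => ?_, fun z hz => ?_⟩
      · rw [hnorm]
        refine Real.rpow_le_rpow (norm_nonneg _) ?_ hp.le
        refine le_of_sq_le_sq ?_ (norm_nonneg _)
        have h1 : 0 ≤ 1 - ‖z‖ ^ 2 := by
          have := mem_ball_zero_iff.1 hz
          nlinarith [norm_nonneg z]
        have h2 : 0 ≤ 1 - ‖a‖ ^ 2 := by nlinarith [norm_nonneg a]
        nlinarith [key z, mul_nonneg h1 h2]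
      · rw [hnorm]
        congr 1
        refine (sq_eq_sq₀ (norm_nonneg _) (norm_nonneg _)).1 ?_
        have := key z
        rw [mem_sphere_zero_iff_norm.1 hz] at this
        linarith
    · push Not at ha
      have ha0 : a ≠ 0 := by rintro rfl; simp at ha; linarith
      have he : ∀ z, ‖((‖a‖ ^ p : ℝ) : ℂ) • (1 - a⁻¹ * z) ^ (p : ℂ)‖ = ‖z - a‖ ^ p := by
        intro z
        rw [norm_smul, hnorm, Complex.norm_real, Real.norm_of_nonneg (by positivity),
          ← Real.mul_rpow (norm_nonneg _) (norm_nonneg _), ← norm_mul, norm_sub_rev]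
        congr 2
        field_simp
      refine ⟨fun z => ((‖a‖ ^ p : ℝ) : ℂ) • (1 - a⁻¹ * z) ^ (p : ℂ),
        diffContOnCl_const.smul (diffContOnCl_one_sub_mul_cpow hp ?_), fun z _ => (he z).ge,
        fun z _ => he z⟩
      rw [norm_inv]
      exact inv_le_one_of_one_le₀ ha

lemma circleIntegrable_discPoisson_mul {w : ℂ} (hw : w ∈ ball (0 : ℂ) 1) {u : ℂ → ℝ}
    (hu : ContinuousOn u (sphere 0 1)) : CircleIntegrable (fun ζ => discPoisson w ζ * u ζ) 0 1 :=
  ((continuousOn_discPoisson hw).mul hu).circleIntegrable zero_le_one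

lemma norm_le_poisson {w : ℂ} (hw : w ∈ ball (0 : ℂ) 1) (hg : DiffContOnCl ℂ g (ball 0 1)) :
    ‖g w‖ ≤ circleAverage (fun ζ => discPoisson w ζ * ‖g ζ‖) 0 1 := by
  rw [← hg.circleAverage_re_herglotzRieszKernel_smul hw]
  refine (norm_circleAverage_le _ _ _).trans_eq (Real.circleAverage_congr_sphere fun ζ hζ => ?_)
  rw [abs_one] at hζ
  simp only [Pi.smul_apply', Function.comp_apply, norm_smul]
  rw [← discPoisson, Real.norm_of_nonneg (discPoisson_nonneg hw hζ)]

lemma Polynomial.norm_rpow_le_poisson {p : ℝ} (hp : 0 < p) (P : Polynomial ℂ) {w : ℂ}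
    (hw : w ∈ ball (0 : ℂ) 1) :
    ‖P.eval w‖ ^ p ≤ circleAverage (fun ζ => discPoisson w ζ * ‖P.eval ζ‖ ^ p) 0 1 := by
  have he : ∀ z, ‖P.eval z‖ ^ p =
      ‖P.leadingCoeff‖ ^ p * ‖(P.roots.map fun a => z - a).prod‖ ^ p := by
    intro z
    rw [← Real.mul_rpow (norm_nonneg _) (norm_nonneg _), ← norm_mul]
    conv_lhs => rw [(IsAlgClosed.splits P).eq_prod_roots]
    simp [Polynomial.eval_multiset_prod]
  obtain ⟨g, hg, hg1, hg2⟩ := exists_outer_part_of_multiset hp P.roots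
  have h := norm_le_poisson hw hg
  calc ‖P.eval w‖ ^ p ≤ ‖P.leadingCoeff‖ ^ p *
        circleAverage (fun ζ => discPoisson w ζ * ‖g ζ‖) 0 1 := by
        rw [he]
        gcongr
        exact (hg1 w hw).trans h
    _ = circleAverage (fun ζ => discPoisson w ζ * ‖P.eval ζ‖ ^ p) 0 1 := by
        rw [← smul_eq_mul, ← Real.circleAverage_fun_smul]
        refine Real.circleAverage_congr_sphere fun ζ hζ => ?_
        rw [abs_one] at hζ
        simp only [smul_eq_mul, he, hg2 ζ hζ]
        ring

/-- Powers of moduli of holomorphic functions are subharmonic. -/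
lemma norm_rpow_le_poisson {p : ℝ} (hp : 0 < p) (hf : DifferentiableOn ℂ f (ball 0 1)) {R : ℝ}
    (hR0 : 0 ≤ R) (hR : R < 1) {w : ℂ} (hw : w ∈ ball (0 : ℂ) 1) :
    ‖f (R * w)‖ ^ p ≤ circleAverage (fun ζ => discPoisson w ζ * ‖f (R * ζ)‖ ^ p) 0 1 := by
  have h := hf.hasDiscSeries
  set a := taylorCoef f with ha
  let P : ℕ → Polynomial ℂ := fun N =>
    ∑ n ∈ Finset.range N, Polynomial.monomial n (a n * (R : ℂ) ^ n)
  have hP : ∀ N z, (P N).eval z = ∑ n ∈ Finset.range N, a n * (R * z) ^ n := by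
    intro N z
    simp [P, Polynomial.eval_finsetSum, mul_pow, mul_assoc]
  have hsum := h.summable_norm hR0 hR
  have hmem : ∀ z ∈ closedBall (0 : ℂ) 1, (R : ℂ) * z ∈ ball (0 : ℂ) 1 := by
    intro z hz
    rw [mem_ball_zero_iff, norm_mul, Complex.norm_real, Real.norm_of_nonneg hR0]
    have := mem_closedBall_zero_iff.1 hz
    nlinarith [norm_nonneg z]
  have hlim : ∀ z ∈ closedBall (0 : ℂ) 1,
      Tendsto (fun N => ‖(P N).eval z‖ ^ p) atTop (𝓝 (‖f (R * z)‖ ^ p)) := by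
    intro z hz
    simp only [hP]
    exact ((h _ (hmem z hz)).tendsto_sum_nat.norm).rpow_const (Or.inr hp.le)
  have hbd : ∀ z ∈ closedBall (0 : ℂ) 1, ∀ N,
      ‖(P N).eval z‖ ^ p ≤ (∑' n, ‖a n‖ * R ^ n) ^ p := by
    intro z hz N
    refine Real.rpow_le_rpow (norm_nonneg _) ?_ hp.le
    rw [hP]
    refine (norm_sum_le _ _).trans ((Finset.sum_le_sum fun n _ => ?_).trans
      (hsum.sum_le_tsum (Finset.range N) fun n _ => by positivity))
    rw [norm_mul, norm_pow, norm_mul, Complex.norm_real, Real.norm_of_nonneg hR0]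
    have := mem_closedBall_zero_iff.1 hz
    gcongr
    exact mul_le_of_le_one_right hR0 this
  refine le_of_tendsto_of_tendsto' (hlim w (ball_subset_closedBall hw)) ?_
    fun N => (P N).norm_rpow_le_poisson hp hw
  have hm : ∀ θ, circleMap 0 1 θ ∈ sphere (0 : ℂ) 1 := fun θ => by simp
  simp only [Real.circleAverage_def]
  refine Tendsto.const_smul ?_ _
  have hK : Continuous fun θ => discPoisson w (circleMap 0 1 θ) :=
    (continuousOn_discPoisson hw).comp_continuous (continuous_circleMap 0 1) hm
  refine intervalIntegral.tendsto_integral_filter_of_dominated_convergence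
    (fun θ => discPoisson w (circleMap 0 1 θ) * (∑' n, ‖a n‖ * R ^ n) ^ p) ?_ ?_ ?_ ?_
  · refine .of_forall fun N => Continuous.aestronglyMeasurable ?_
    refine hK.mul (Continuous.rpow_const ?_ fun _ => Or.inr hp.le)
    exact ((P N).continuous.comp (continuous_circleMap 0 1)).norm
  · refine .of_forall fun N => .of_forall fun θ _ => ?_
    have := discPoisson_nonneg hw (hm θ)
    rw [Real.norm_of_nonneg (by positivity)]
    refine mul_le_mul_of_nonneg_left ?_ this
    exact hbd _ (sphere_subset_closedBall (hm θ)) N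
  · exact (hK.mul continuous_const).intervalIntegrable _ _
  · exact .of_forall fun θ _ => (hlim _ (sphere_subset_closedBall (hm θ))).const_mul _

lemma circleAverage_eq_apply_zero (hf : DifferentiableOn ℂ f (ball 0 1)) (hr0 : 0 ≤ r)
    (hr : r < 1) : circleAverage f 0 r = f 0 := by
  have h := hf.hasDiscSeries
  have := h.circleAverage_mul_conj_pow hr0 hr 0
  simpa [h.apply_zero] using this

lemma circleAverage_conj (f : ℂ → ℂ) (r : ℝ) :
    circleAverage (fun z => conj (f z)) 0 r = conj (circleAverage f 0 r) := by
  simp only [Real.circleAverage_def, Complex.real_smul, map_mul, Complex.conj_ofReal]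
  congr 1
  simp only [intervalIntegral.integral_of_le Real.two_pi_pos.le]
  exact integral_conj

lemma circleAverage_ofReal (u : ℂ → ℝ) (r : ℝ) :
    circleAverage (fun z => (u z : ℂ)) 0 r = (circleAverage u 0 r : ℝ) := by
  simp only [Real.circleAverage_def, Complex.real_smul, smul_eq_mul, Complex.ofReal_mul]
  congr 1
  exact intervalIntegral.integral_ofReal

lemma circleAverage_re_eq (hf : DifferentiableOn ℂ f (ball 0 1)) (hr0 : 0 ≤ r) (hr : r < 1) :
    circleAverage (fun z => (f z).re) 0 r = (f 0).re := by
  have h1 := Complex.reCLM.circleAverage_comp_comm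
    (hf.continuousOn.circleIntegrable_of_ball hr0 hr)
  rw [circleAverage_eq_apply_zero hf hr0 hr] at h1
  exact h1

/-- Carathéodory's coefficient bound. -/
lemma HasDiscSeries.norm_coef_le_of_re_nonneg (h : HasDiscSeries a f)
    (hre : ∀ z ∈ ball (0 : ℂ) 1, 0 ≤ (f z).re) {n : ℕ} (hn : n ≠ 0) :
    ‖a n‖ ≤ 2 * (f 0).re := by
  have key : ∀ r ∈ Ioo (0 : ℝ) 1, ‖a n‖ * r ^ n ≤ 2 * (f 0).re := by
    rintro r ⟨hr0, hr⟩
    have hc := h.continuousOn_sphere hr0.le hr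
    rw [abs_of_pos hr0] at hc
    have hci : ∀ {k : ℂ → ℂ}, ContinuousOn k (sphere 0 r) → CircleIntegrable k 0 r :=
      fun hk => hk.circleIntegrable hr0.le
    have h1 := h.circleAverage_mul_conj_pow hr0.le hr n
    have h2 : circleAverage (fun z => f z * z ^ n) 0 r = 0 := by
      rw [circleAverage_eq_apply_zero
        (f := fun z => f z * z ^ n) (h.differentiableOn.mul (differentiableOn_id.pow n)) hr0.le hr]
      simp [hn]
    have h3 : circleAverage (fun z => ((2 * (f z).re : ℝ) : ℂ) * conj z ^ n) 0 r =
        a n * r ^ (2 * n) := by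
      have h4 : circleAverage (fun z => conj (f z * z ^ n)) 0 r = 0 := by
        rw [circleAverage_conj, h2, map_zero]
      refine Eq.trans ?_ ((congrArg₂ (· + ·) h1 h4).trans (add_zero _))
      rw [← Real.circleAverage_fun_add]
      · congr 1
        ext z
        have : ((2 * (f z).re : ℝ) : ℂ) = f z + conj (f z) := by
          rw [Complex.add_conj]
        rw [this]
        simp only [map_mul, map_pow]
        ring
      · refine hci (hc.mul ?_)
        fun_prop
      · refine hci ?_
        exact Complex.continuous_conj.comp_continuousOn (hc.mul (by fun_prop))
    have hsp : ∀ z ∈ sphere (0 : ℂ) r, z ∈ ball (0 : ℂ) 1 := fun z hz => by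
      rw [mem_sphere_zero_iff_norm] at hz
      rw [mem_ball_zero_iff, hz]; exact hr
    have h5 : ‖a n‖ * r ^ (2 * n) ≤ 2 * (f 0).re * r ^ n := by
      calc ‖a n‖ * r ^ (2 * n) = ‖a n * r ^ (2 * n)‖ := by
            rw [norm_mul, norm_pow, Complex.norm_real, Real.norm_of_nonneg hr0.le]
        _ ≤ circleAverage (fun z => ‖((2 * (f z).re : ℝ) : ℂ) * conj z ^ n‖) 0 r := by
            rw [← h3]; exact norm_circleAverage_le _ _ _
        _ = circleAverage (fun z => (2 * r ^ n) • (f z).re) 0 r := by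
            refine Real.circleAverage_congr_sphere fun z hz => ?_
            rw [abs_of_pos hr0] at hz
            have := hre z (hsp z hz)
            simp only [norm_mul, Complex.norm_real, norm_pow, RCLike.norm_conj,
              mem_sphere_zero_iff_norm.1 hz, smul_eq_mul, Real.norm_eq_abs, abs_of_nonneg this,
              abs_two]
            ring
        _ = 2 * (f 0).re * r ^ n := by
            rw [Real.circleAverage_fun_smul, circleAverage_re_eq h.differentiableOn hr0.le hr,
              smul_eq_mul]
            ring
    have hp : 0 < r ^ n := by positivity
    rw [show 2 * n = n + n by ring, pow_add, ← mul_assoc] at h5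
    exact le_of_mul_le_mul_right h5 hp
  have hlim : Tendsto (fun r : ℝ => ‖a n‖ * r ^ n) (𝓝[<] 1) (𝓝 (‖a n‖ * 1 ^ n)) :=
    ((continuous_const.mul (continuous_pow n)).tendsto 1).mono_left nhdsWithin_le_nhds
  rw [one_pow, mul_one] at hlim
  exact le_of_tendsto hlim (by
    filter_upwards [Ioo_mem_nhdsLT (zero_lt_one (α := ℝ))] with r hr using key r hr)

/-- Compactness of families of holomorphic functions with nonnegative real part. -/
lemma exists_tendstoUniformlyOn_of_re_nonneg {ι : Type*} (U : Ultrafilter ι) {F : ι → ℂ → ℂ}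
    (hF : ∀ i, DifferentiableOn ℂ (F i) (ball 0 1))
    (hre : ∀ i, ∀ z ∈ ball (0 : ℂ) 1, 0 ≤ (F i z).re) {M : ℝ} (hM : ∀ i, ‖F i 0‖ ≤ M) :
    ∃ f : ℂ → ℂ, DifferentiableOn ℂ f (ball 0 1) ∧
      ∀ s < 1, TendstoUniformlyOn F f U (closedBall 0 s) := by
  have hC : ∀ i n, ‖taylorCoef (F i) n‖ ≤ 2 * M := by
    intro i n
    have h := (hF i).hasDiscSeries
    have hM0 := (norm_nonneg _).trans (hM i)
    by_cases hn : n = 0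
    · rw [hn, ← h.apply_zero]
      linarith [hM i]
    · have := h.norm_coef_le_of_re_nonneg (hre i) hn
      linarith [Complex.re_le_norm (F i 0), hM i]
  have hlim : ∀ n, ∃ c ∈ closedBall (0 : ℂ) (2 * M),
      Tendsto (fun i => taylorCoef (F i) n) U (𝓝 c) := by
    intro n
    obtain ⟨c, hc, hle⟩ := (isCompact_closedBall (0 : ℂ) (2 * M)).ultrafilter_le_nhds
      (U.map fun i => taylorCoef (F i) n) (by
        rw [le_principal_iff]
        exact Filter.mem_map.2 (univ_mem' fun i => mem_closedBall_zero_iff.2 (hC i n)))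
    exact ⟨c, hc, hle⟩
  choose c hc hcl using hlim
  have hser := hasDiscSeries_of_norm_le fun n => mem_closedBall_zero_iff.1 (hc n)
  refine ⟨_, hser.differentiableOn, fun s hs => ?_⟩
  rcases lt_or_ge s 0 with hs0 | hs0
  · rw [closedBall_eq_empty.2 hs0]
    exact tendstoUniformlyOn_empty
  have hb : ∀ i n, ‖taylorCoef (F i) n - c n‖ * s ^ n ≤ (4 * M) * s ^ n := by
    intro i n
    gcongr
    have := norm_sub_le (taylorCoef (F i) n) (c n)
    linarith [hC i n, mem_closedBall_zero_iff.1 (hc n)]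
  have hgeo : Summable fun n : ℕ => (4 * M) * s ^ n :=
    (summable_geometric_of_lt_one hs0 hs).mul_left _
  have hT : Tendsto (fun i => ∑' n, ‖taylorCoef (F i) n - c n‖ * s ^ n) U (𝓝 0) := by
    have := tendsto_tsum_of_dominated_convergence (𝓕 := (U : Filter ι))
      (f := fun i n => ‖taylorCoef (F i) n - c n‖ * s ^ n) (g := fun n => 0) hgeo
      (fun n => by
        have h := (((hcl n).sub_const (c n)).norm).mul_const (s ^ n)
        simpa using h)
      (.of_forall fun i n => by
        rw [Real.norm_of_nonneg (by positivity)]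
        exact hb i n)
    simpa using this
  rw [Metric.tendstoUniformlyOn_iff]
  intro ε hε
  filter_upwards [hT.eventually (gt_mem_nhds hε)] with i hi z hz
  rw [mem_closedBall_zero_iff] at hz
  have hzb : z ∈ ball (0 : ℂ) 1 := by rw [mem_ball_zero_iff]; linarith
  have h1 := ((hF i).hasDiscSeries z hzb).sub (hser z hzb)
  have hsumm : Summable fun n => ‖taylorCoef (F i) n - c n‖ * s ^ n :=
    hgeo.of_nonneg_of_le (fun n => by positivity) (hb i)
  rw [dist_comm, dist_eq_norm]
  refine lt_of_le_of_lt ?_ hi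
  have h2 := tsum_of_norm_bounded hsumm.hasSum (f := fun n =>
    taylorCoef (F i) n * z ^ n - c n * z ^ n) (fun n => by
      rw [← sub_mul, norm_mul, norm_pow]
      gcongr)
  rwa [h1.tsum_eq] at h2

/-- The Herglotz integral of a boundary function. -/
def herglotz (u : ℂ → ℝ) (w : ℂ) : ℂ :=
  circleAverage (fun ζ => herglotzRieszKernel 0 w ζ • (u ζ : ℂ)) 0 1

lemma differentiableOn_herglotz {u : ℂ → ℝ} (hu : ContinuousOn u (sphere 0 1)) :
    DifferentiableOn ℂ (herglotz u) (ball 0 1) :=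
  differentiableOn_circleAverage_herglotzRieszKernel_smul
    ((Complex.continuous_ofReal.comp_continuousOn hu).circleIntegrable zero_le_one)

lemma herglotz_re {u : ℂ → ℝ} (hu : ContinuousOn u (sphere 0 1)) {w : ℂ}
    (hw : w ∈ ball (0 : ℂ) 1) :
    (herglotz u w).re = circleAverage (fun ζ => discPoisson w ζ * u ζ) 0 1 :=
  re_circleAverage_herglotzRieszKernel_smul (hu.circleIntegrable zero_le_one) hw

lemma herglotz_zero (u : ℂ → ℝ) : herglotz u 0 = (circleAverage u 0 1 : ℝ) := by
  rw [herglotz, ← circleAverage_ofReal]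
  refine Real.circleAverage_congr_sphere fun ζ hζ => ?_
  have : ζ ≠ 0 := by rintro rfl; simp at hζ
  simp [herglotzRieszKernel_def, this]

/-- The `p`-th power of a dilate of a holomorphic function is dominated by the real part of a
holomorphic function. -/
lemma norm_rpow_le_re_herglotz {p : ℝ} (hp : 0 < p) (hf : DifferentiableOn ℂ f (ball 0 1)) {R : ℝ}
    (hR0 : 0 ≤ R) (hR : R < 1) {w : ℂ} (hw : w ∈ ball (0 : ℂ) 1) :
    ‖f (R * w)‖ ^ p ≤ (herglotz (fun ζ => ‖f (R * ζ)‖ ^ p) w).re := by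
  rw [herglotz_re _ hw]
  · exact norm_rpow_le_poisson hp hf hR0 hR hw
  · refine ContinuousOn.rpow_const ?_ fun _ _ => Or.inr hp.le
    refine (hf.continuousOn.comp (by fun_prop) fun z hz => ?_).norm
    rw [mem_sphere_zero_iff_norm] at hz
    rw [mem_ball_zero_iff, norm_mul, hz, Complex.norm_real, Real.norm_of_nonneg hR0]
    linarith

/-- Holomorphic functions on the disc with real part at least one that are real at the origin. -/
structure OneLeRe (U : ℂ → ℂ) : Prop where
  differentiableOn : DifferentiableOn ℂ U (ball 0 1)
  im_zero : (U 0).im = 0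
  one_le_re : ∀ z ∈ ball (0 : ℂ) 1, 1 ≤ (U z).re

lemma OneLeRe.re_zero_eq_norm {U : ℂ → ℂ} (h : OneLeRe U) : (U 0).re = ‖U 0‖ := by
  have h1 := h.one_le_re 0 (by simp)
  rw [← Complex.re_add_im (U 0), h.im_zero]
  simp only [Complex.ofReal_zero, zero_mul, add_zero, Complex.ofReal_re, Complex.norm_real]
  rw [Real.norm_of_nonneg (by linarith)]

lemma exists_tendstoUniformlyOn_oneLeRe {ι : Type*} (U : Ultrafilter ι) {F : ι → ℂ → ℂ}
    (hF : ∀ i, OneLeRe (F i)) {M : ℝ} (hM : ∀ i, (F i 0).re ≤ M) :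
    ∃ f : ℂ → ℂ, OneLeRe f ∧ ∀ s < 1, TendstoUniformlyOn F f U (closedBall 0 s) := by
  obtain ⟨f, hf, hlim⟩ := exists_tendstoUniformlyOn_of_re_nonneg U
    (fun i => (hF i).differentiableOn) (fun i z hz => by linarith [(hF i).one_le_re z hz])
    (M := M) (fun i => by rw [← (hF i).re_zero_eq_norm]; exact hM i)
  have ht : ∀ z ∈ ball (0 : ℂ) 1, Tendsto (fun i => F i z) U (𝓝 (f z)) := fun z hz =>
    (hlim ‖z‖ (mem_ball_zero_iff.1 hz)).tendsto_at (by simp)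
  refine ⟨f, ⟨hf, ?_, fun z hz => ?_⟩, hlim⟩
  · have := (Complex.continuous_im.tendsto _).comp (ht 0 (by simp))
    refine tendsto_nhds_unique this (tendsto_const_nhds.congr fun i => ?_)
    exact ((hF i).im_zero).symm
  · exact ge_of_tendsto ((Complex.continuous_re.tendsto _).comp (ht z hz))
      (.of_forall fun i => (hF i).one_le_re z hz)

lemma tendsto_of_tendstoUniformlyOn_closedBall {ι : Type*} {l : Filter ι} {F : ι → ℂ → ℂ}
    (h : ∀ s < 1, TendstoUniformlyOn F f l (closedBall 0 s)) {z : ℂ} (hz : z ∈ ball (0 : ℂ) 1) :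
    Tendsto (fun i => F i z) l (𝓝 (f z)) :=
  (h ‖z‖ (mem_ball_zero_iff.1 hz)).tendsto_at (by simp)

lemma circleAverage_dilate {E : Type*} [NormedAddCommGroup E] [NormedSpace ℝ E] (k : ℂ → E)
    (R r : ℝ) : circleAverage (fun z => k (R * z)) 0 r = circleAverage k 0 (R * r) := by
  simp only [Real.circleAverage_def, circleMap, zero_add, Complex.ofReal_mul, mul_assoc]

lemma herglotz_re_nonneg {u : ℂ → ℝ} (hu : ContinuousOn u (sphere 0 1))
    (h0 : ∀ z ∈ sphere (0 : ℂ) 1, 0 ≤ u z) {w : ℂ} (hw : w ∈ ball (0 : ℂ) 1) :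
    0 ≤ (herglotz u w).re := by
  rw [herglotz_re hu hw]
  have : circleAverage (fun _ : ℂ => (0 : ℝ)) 0 1 ≤
      circleAverage (fun ζ => discPoisson w ζ * u ζ) 0 1 := by
    refine Real.circleAverage_mono (circleIntegrable_const _ _ _)
      (circleIntegrable_discPoisson_mul hw hu) fun ζ hζ => ?_
    rw [abs_one] at hζ
    exact mul_nonneg (discPoisson_nonneg hw hζ) (h0 ζ hζ)
  rwa [Real.circleAverage_const] at this

lemma oneLeRe_one_add_herglotz {u : ℂ → ℝ} (hu : ContinuousOn u (sphere 0 1))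
    (h0 : ∀ z ∈ sphere (0 : ℂ) 1, 0 ≤ u z) : OneLeRe fun w => 1 + herglotz u w where
  differentiableOn := (differentiableOn_herglotz hu).const_add _
  im_zero := by simp [herglotz_zero]
  one_le_re z hz := by
    have := herglotz_re_nonneg hu h0 hz
    simp only [Complex.add_re, Complex.one_re]
    linarith

/-- A function in a Hardy space has a holomorphic majorant with integrable real part. -/
lemma exists_majorant_of_circleAverage_le {p M : ℝ} (hp : 0 < p)
    (hf : DifferentiableOn ℂ f (ball 0 1))
    (hM : ∀ r, 0 < r → r < 1 → circleAverage (fun z => ‖f z‖ ^ p) 0 r ≤ M) :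
    ∃ U, OneLeRe U ∧ ∀ z ∈ ball (0 : ℂ) 1, ‖f z‖ ^ p ≤ (U z).re := by
  obtain ⟨R, hR1, hR2, hR3⟩ := exists_seq_strictMono_tendsto' (zero_lt_one (α := ℝ))
  have hcont : ∀ k, ContinuousOn (fun ζ : ℂ => ‖f (R k * ζ)‖ ^ p) (sphere 0 1) := fun k => by
    refine ContinuousOn.rpow_const ?_ fun _ _ => Or.inr hp.le
    refine (hf.continuousOn.comp (by fun_prop) fun z hz => ?_).norm
    rw [mem_sphere_zero_iff_norm] at hz
    rw [mem_ball_zero_iff, norm_mul, hz, Complex.norm_real, Real.norm_of_nonneg (hR2 k).1.le]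
    linarith [(hR2 k).2]
  obtain ⟨U, hU, hlim⟩ := exists_tendstoUniformlyOn_oneLeRe (hyperfilter ℕ)
    (fun k => oneLeRe_one_add_herglotz (hcont k) fun z _ => by positivity) (M := 1 + M)
    (fun k => by
      have := hM (R k) (hR2 k).1 (hR2 k).2
      simp only [Complex.add_re, Complex.one_re, herglotz_zero, Complex.ofReal_re]
      rw [circleAverage_dilate (fun z => ‖f z‖ ^ p), mul_one]
      linarith)
  refine ⟨U, hU, fun z hz => ?_⟩
  have h1 : Tendsto (fun k => f (R k * z)) atTop (𝓝 (f z)) := by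
    have h2 : Tendsto (fun k => (R k : ℂ) * z) atTop (𝓝 z) := by
      have := ((Complex.continuous_ofReal.tendsto 1).comp hR3).mul_const z
      simpa using this
    exact ((hf.continuousOn.continuousAt (isOpen_ball.mem_nhds hz)).tendsto).comp h2
  have h2 := (h1.norm.rpow_const (p := p) (Or.inr hp.le)).mono_left Nat.hyperfilter_le_atTop
  refine le_of_tendsto_of_tendsto h2 ((Complex.continuous_re.tendsto _).comp
    (tendsto_of_tendstoUniformlyOn_closedBall hlim hz)) (.of_forall fun k => ?_)
  have := norm_rpow_le_re_herglotz hp hf (hR2 k).1.le (hR2 k).2 hz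
  simp only [Function.comp_apply, Complex.add_re, Complex.one_re]
  linarith

lemma norm_sq_le_re_herglotz (hf : DiffContOnCl ℂ f (ball 0 1)) {w : ℂ}
    (hw : w ∈ ball (0 : ℂ) 1) : ‖f w‖ ^ 2 ≤ (herglotz (fun ζ => ‖f ζ‖ ^ 2) w).re := by
  have hc : ContinuousOn f (sphere 0 1) :=
    hf.continuousOn.mono (by rw [closure_ball 0 one_ne_zero]; exact sphere_subset_closedBall)
  rw [herglotz_re (u := fun ζ => ‖f ζ‖ ^ 2) (hc.norm.pow 2) hw, ← norm_pow]
  simp only [← norm_pow]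
  have := norm_le_poisson hw (hf.smul hf)
  simpa only [Pi.smul_apply', smul_eq_mul, ← sq] using this

/-- A holomorphic majorant of a weighted sequence of squares. -/
lemma exists_majorant_of_summable {φ : ℕ → ℂ → ℂ} (hφ : ∀ n, DiffContOnCl ℂ (φ n) (ball 0 1))
    {A c : ℕ → ℝ} (hA : ∀ n, 0 ≤ A n) (hc : Summable c)
    (h : ∀ n, A n * circleAverage (fun z => ‖φ n z‖ ^ 2) 0 1 ≤ c n) :
    ∃ U, OneLeRe U ∧ ∀ z ∈ ball (0 : ℂ) 1, ∀ n, A n * ‖φ n z‖ ^ 2 ≤ (U z).re := by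
  have hcont : ∀ n, ContinuousOn (fun ζ : ℂ => ‖φ n ζ‖ ^ 2) (sphere 0 1) := fun n =>
    ((hφ n).continuousOn.mono (by
      rw [closure_ball 0 one_ne_zero]; exact sphere_subset_closedBall)).norm.pow 2
  have hH : ∀ n, ∀ z ∈ ball (0 : ℂ) 1,
      A n * ‖φ n z‖ ^ 2 ≤ (A n * herglotz (fun ζ => ‖φ n ζ‖ ^ 2) z).re := fun n z hz => by
    rw [Complex.re_ofReal_mul]
    exact mul_le_mul_of_nonneg_left (norm_sq_le_re_herglotz (hφ n) hz) (hA n)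
  have hH0 : ∀ n, ∀ z ∈ ball (0 : ℂ) 1,
      0 ≤ (A n * herglotz (fun ζ => ‖φ n ζ‖ ^ 2) z).re := fun n z hz =>
    (mul_nonneg (hA n) (by positivity)).trans (hH n z hz)
  have hc0 : ∀ n, 0 ≤ c n := fun n => by
    have := hH0 n 0 (by simp)
    rw [herglotz_zero, Complex.re_ofReal_mul, Complex.ofReal_re] at this
    exact this.trans (h n)
  obtain ⟨U, hU, hlim⟩ := exists_tendstoUniformlyOn_oneLeRe (hyperfilter ℕ) (M := 1 + ∑' n, c n)
    (F := fun N z => 1 + ∑ n ∈ Finset.range N, A n * herglotz (fun ζ => ‖φ n ζ‖ ^ 2) z)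
    (fun N => by
      refine ⟨(DifferentiableOn.fun_sum fun n _ =>
        (differentiableOn_herglotz (hcont n)).const_mul _).const_add _, ?_, fun z hz => ?_⟩
      · simp only [herglotz_zero, ← Complex.ofReal_mul, ← Complex.ofReal_sum]
        simp
      · rw [Complex.add_re, Complex.re_sum, Complex.one_re]
        linarith [Finset.sum_nonneg fun n (_ : n ∈ Finset.range N) => hH0 n z hz])
    (fun N => by
      rw [Complex.add_re, Complex.re_sum, Complex.one_re]
      gcongr
      refine (Finset.sum_le_sum fun n _ => ?_).trans
        (hc.sum_le_tsum (Finset.range N) fun n _ => hc0 n)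
      rw [herglotz_zero, Complex.re_ofReal_mul, Complex.ofReal_re]
      exact h n)
  refine ⟨U, hU, fun z hz n => ?_⟩
  refine ge_of_tendsto ((Complex.continuous_re.tendsto _).comp
    (tendsto_of_tendstoUniformlyOn_closedBall hlim hz)) ?_
  refine Nat.hyperfilter_le_atTop ?_
  filter_upwards [eventually_gt_atTop n] with N hN
  simp only [Function.comp_apply]
  rw [Complex.add_re, Complex.re_sum, Complex.one_re]
  have := Finset.single_le_sum (fun m (_ : m ∈ Finset.range N) => hH0 m z hz)
    (Finset.mem_range.2 hN)
  linarith [hH n z hz]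

/-- The integral of `φ` over the disc of radius `ρ` against the weighted area measure. -/
def areaIntegral {E : Type*} [NormedAddCommGroup E] [NormedSpace ℝ E] (ρ : ℝ) (φ : ℂ → E) : E :=
  ∫ r in 0..ρ, areaWeight r • circleAverage φ 0 r

lemma continuousOn_areaWeight_smul {E : Type*} [NormedAddCommGroup E] [NormedSpace ℝ E]
    {φ : ℂ → E} (hφ : ContinuousOn φ (ball 0 1)) :
    ContinuousOn (fun r => areaWeight r • circleAverage φ 0 r) (Ico 0 1) :=
  continuous_areaWeight.continuousOn.smul hφ.circleAverage_of_ball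

lemma intervalIntegrable_areaWeight_smul {E : Type*} [NormedAddCommGroup E] [NormedSpace ℝ E]
    {φ : ℂ → E} (hφ : ContinuousOn φ (ball 0 1)) {ρ : ℝ} (h0 : 0 ≤ ρ) (h1 : ρ < 1) :
    IntervalIntegrable (fun r => areaWeight r • circleAverage φ 0 r) volume 0 ρ := by
  refine ((continuousOn_areaWeight_smul hφ).mono ?_).intervalIntegrable
  rw [uIcc_of_le h0]
  exact fun r hr => ⟨hr.1, hr.2.trans_lt h1⟩

lemma sphere_subset_ball_one {r : ℝ} (hr : r < 1) : sphere (0 : ℂ) r ⊆ ball 0 1 := fun z hz => by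
  rw [mem_sphere_zero_iff_norm] at hz
  rwa [mem_ball_zero_iff, hz]

lemma circleAverage_mono_of_ball {φ ψ : ℂ → ℝ} (hφ : ContinuousOn φ (ball 0 1))
    (hψ : ContinuousOn ψ (ball 0 1)) (h : ∀ z ∈ ball (0 : ℂ) 1, φ z ≤ ψ z) {r : ℝ} (h0 : 0 ≤ r)
    (h1 : r < 1) : circleAverage φ 0 r ≤ circleAverage ψ 0 r :=
  Real.circleAverage_mono (hφ.circleIntegrable_of_ball h0 h1) (hψ.circleIntegrable_of_ball h0 h1)
    fun z hz => h z (sphere_subset_ball_one h1 (by rwa [abs_of_nonneg h0] at hz))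

lemma areaIntegral_mono {φ ψ : ℂ → ℝ} (hφ : ContinuousOn φ (ball 0 1))
    (hψ : ContinuousOn ψ (ball 0 1)) (h : ∀ z ∈ ball (0 : ℂ) 1, φ z ≤ ψ z) {ρ : ℝ} (h0 : 0 ≤ ρ)
    (h1 : ρ < 1) : areaIntegral ρ φ ≤ areaIntegral ρ ψ := by
  refine intervalIntegral.integral_mono_on h0 (intervalIntegrable_areaWeight_smul hφ h0 h1)
    (intervalIntegrable_areaWeight_smul hψ h0 h1) fun r hr => ?_
  have hr1 : r < 1 := hr.2.trans_lt h1
  exact mul_le_mul_of_nonneg_left (circleAverage_mono_of_ball hφ hψ h hr.1 hr1)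
    (areaWeight_nonneg hr.1 hr1.le)

lemma areaIntegral_add {E : Type*} [NormedAddCommGroup E] [NormedSpace ℝ E] {φ ψ : ℂ → E}
    (hφ : ContinuousOn φ (ball 0 1))
    (hψ : ContinuousOn ψ (ball 0 1)) {ρ : ℝ} (h0 : 0 ≤ ρ) (h1 : ρ < 1) :
    areaIntegral ρ (fun z => φ z + ψ z) = areaIntegral ρ φ + areaIntegral ρ ψ := by
  rw [areaIntegral, areaIntegral, areaIntegral,
    ← intervalIntegral.integral_add (intervalIntegrable_areaWeight_smul hφ h0 h1)
    (intervalIntegrable_areaWeight_smul hψ h0 h1)]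
  refine intervalIntegral.integral_congr fun r hr => ?_
  rw [uIcc_of_le h0] at hr
  have hr1 : r < 1 := hr.2.trans_lt h1
  rw [← smul_add, ← Real.circleAverage_fun_add (hφ.circleIntegrable_of_ball hr.1 hr1)
    (hψ.circleIntegrable_of_ball hr.1 hr1)]

lemma areaIntegral_const_mul (c : ℝ) (φ : ℂ → ℝ) (ρ : ℝ) :
    areaIntegral ρ (fun z => c * φ z) = c * areaIntegral ρ φ := by
  rw [areaIntegral, areaIntegral, ← intervalIntegral.integral_const_mul]
  refine intervalIntegral.integral_congr fun r hr => ?_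
  simp only [← smul_eq_mul c, Real.circleAverage_fun_smul]
  simp only [smul_eq_mul]
  ring

lemma areaIntegral_norm_deriv_sq_le (hf : DifferentiableOn ℂ f (ball 0 1)) {M : ℝ}
    (hM : ∀ r, 0 < r → r < 1 → circleAverage (fun z => ‖f z‖ ^ 2) 0 r ≤ M) {ρ : ℝ} (h0 : 0 ≤ ρ)
    (h1 : ρ < 1) : areaIntegral ρ (fun z => ‖deriv f z‖ ^ 2) ≤ M :=
  area_integral_le hf hM h0 h1

lemma nonneg_of_circleAverage_norm_sq_le {M : ℝ}
    (hM : ∀ r, 0 < r → r < 1 → circleAverage (fun z => ‖f z‖ ^ 2) 0 r ≤ M) : 0 ≤ M :=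
  (Real.circleAverage_nonneg_of_nonneg fun z _ => by positivity).trans
    (hM 2⁻¹ (by norm_num) (by norm_num))

/-- The weight `‖D‖` is a Littlewood-Paley weight: it pairs products `h * h'` with constant `δ`. -/
def LPBound (D : ℂ → ℂ) (δ : ℝ) : Prop :=
  ∀ h : ℂ → ℂ, DifferentiableOn ℂ h (ball 0 1) → ∀ M : ℝ,
    (∀ r, 0 < r → r < 1 → circleAverage (fun z => ‖h z‖ ^ 2) 0 r ≤ M) →
    ∀ ρ, 0 ≤ ρ → ρ < 1 → areaIntegral ρ (fun z => ‖D z‖ * (‖h z‖ * ‖deriv h z‖)) ≤ δ * M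

lemma DifferentiableOn.continuousOn_deriv_ball (hf : DifferentiableOn ℂ f (ball 0 1)) :
    ContinuousOn (_root_.deriv f) (ball 0 1) :=
  (hf.deriv isOpen_ball).continuousOn

lemma LPBound.add {D₁ D₂ : ℂ → ℂ} {δ₁ δ₂ : ℝ} (h₁ : LPBound D₁ δ₁) (h₂ : LPBound D₂ δ₂)
    (hc₁ : ContinuousOn D₁ (ball 0 1)) (hc₂ : ContinuousOn D₂ (ball 0 1)) :
    LPBound (fun z => D₁ z + D₂ z) (δ₁ + δ₂) := by
  intro h hh M hM ρ h0 h1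
  have hc : ContinuousOn (fun z => ‖h z‖ * ‖deriv h z‖) (ball 0 1) :=
    hh.continuousOn.norm.mul hh.continuousOn_deriv_ball.norm
  calc _ ≤ areaIntegral ρ (fun z => ‖D₁ z‖ * (‖h z‖ * ‖deriv h z‖) +
        ‖D₂ z‖ * (‖h z‖ * ‖deriv h z‖)) := by
        refine areaIntegral_mono ((hc₁.add hc₂).norm.mul hc)
          ((hc₁.norm.mul hc).add (hc₂.norm.mul hc)) (fun z _ => ?_) h0 h1
        rw [← add_mul]
        exact mul_le_mul_of_nonneg_right (norm_add_le _ _) (by positivity)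
    _ ≤ (δ₁ + δ₂) * M := by
        rw [areaIntegral_add (φ := fun z => ‖D₁ z‖ * (‖h z‖ * ‖deriv h z‖))
          (ψ := fun z => ‖D₂ z‖ * (‖h z‖ * ‖deriv h z‖)) (hc₁.norm.mul hc) (hc₂.norm.mul hc) h0 h1,
          add_mul]
        exact add_le_add (h₁ h hh M hM ρ h0 h1) (h₂ h hh M hM ρ h0 h1)

lemma LPBound.of_norm_le {D₁ D₂ : ℂ → ℂ} {δ : ℝ} (h₂ : LPBound D₂ δ)
    (hc₁ : ContinuousOn D₁ (ball 0 1)) (hc₂ : ContinuousOn D₂ (ball 0 1))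
    (hle : ∀ z ∈ ball (0 : ℂ) 1, ‖D₁ z‖ ≤ ‖D₂ z‖) : LPBound D₁ δ := by
  intro h hh M hM ρ h0 h1
  have hc : ContinuousOn (fun z => ‖h z‖ * ‖deriv h z‖) (ball 0 1) :=
    hh.continuousOn.norm.mul hh.continuousOn_deriv_ball.norm
  refine le_trans ?_ (h₂ h hh M hM ρ h0 h1)
  refine areaIntegral_mono (hc₁.norm.mul hc) (hc₂.norm.mul hc) (fun z hz => ?_) h0 h1
  exact mul_le_mul_of_nonneg_right (hle z hz) (by positivity)

lemma LPBound.mono {D : ℂ → ℂ} {δ₁ δ₂ : ℝ} (h : LPBound D δ₁) (hle : δ₁ ≤ δ₂) : LPBound D δ₂ :=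
  fun k hk M hM ρ h0 h1 => (h k hk M hM ρ h0 h1).trans
    (mul_le_mul_of_nonneg_right hle (nonneg_of_circleAverage_norm_sq_le hM))

lemma LPBound.const_mul {D : ℂ → ℂ} {δ : ℝ} (hD : LPBound D δ) (c : ℂ) :
    LPBound (fun z => c * D z) (‖c‖ * δ) := by
  intro h hh M hM ρ h0 h1
  have := hD h hh M hM ρ h0 h1
  simp only [norm_mul, mul_assoc]
  rw [areaIntegral_const_mul]
  exact mul_le_mul_of_nonneg_left this (norm_nonneg _)

lemma circleAverage_norm_mul_sq_le {ψ h : ℂ → ℂ} {γ M : ℝ}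
    (hψ : ContinuousOn ψ (ball 0 1)) (hψγ : ∀ z ∈ ball (0 : ℂ) 1, ‖ψ z‖ ≤ γ)
    (hh : ContinuousOn h (ball 0 1))
    (hM : ∀ r, 0 < r → r < 1 → circleAverage (fun z => ‖h z‖ ^ 2) 0 r ≤ M)
    (r : ℝ) (h0 : 0 < r) (h1 : r < 1) :
    circleAverage (fun z => ‖ψ z * h z‖ ^ 2) 0 r ≤ γ ^ 2 * M := by
  calc _ ≤ circleAverage (fun z => γ ^ 2 • ‖h z‖ ^ 2) 0 r := by
        refine circleAverage_mono_of_ball ((hψ.mul hh).norm.pow 2)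
          (continuousOn_const.mul (hh.norm.pow 2)) (fun z hz => ?_) h0.le h1
        have h2 : ‖ψ z * h z‖ ^ 2 ≤ γ ^ 2 * ‖h z‖ ^ 2 := by
          rw [norm_mul, mul_pow]
          gcongr
          exact hψγ z hz
        exact h2
    _ ≤ γ ^ 2 * M := by
        rw [Real.circleAverage_fun_smul, smul_eq_mul]
        exact mul_le_mul_of_nonneg_left (hM r h0 h1) (by positivity)

/-- Derivatives of bounded holomorphic functions are Littlewood-Paley weights. -/
lemma lpBound_mul_deriv {b ψ : ℂ → ℂ} {β γ : ℝ} (hβ : 0 ≤ β) (hγ : 0 < γ)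
    (hb : ContinuousOn b (ball 0 1)) (hbβ : ∀ z ∈ ball (0 : ℂ) 1, ‖b z‖ ≤ β)
    (hψ : DifferentiableOn ℂ ψ (ball 0 1)) (hψγ : ∀ z ∈ ball (0 : ℂ) 1, ‖ψ z‖ ≤ γ) :
    LPBound (fun z => b z * deriv ψ z) (2 * β * γ) := by
  intro h hh M hM ρ h0 h1
  have hc := hh.continuousOn.norm
  have hc' := hh.continuousOn_deriv_ball.norm
  have hψc := hψ.continuousOn_deriv_ball
  have hk : DifferentiableOn ℂ (fun z => ψ z * h z) (ball 0 1) := hψ.mul hh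
  have hkc := hk.continuousOn_deriv_ball.norm
  have hkM := circleAverage_norm_mul_sq_le hψ.continuousOn hψγ hh.continuousOn hM
  have hderiv : ∀ z ∈ ball (0 : ℂ) 1,
      deriv (fun z => ψ z * h z) z = deriv ψ z * h z + ψ z * deriv h z := fun z hz =>
    deriv_fun_mul (hψ.differentiableAt (isOpen_ball.mem_nhds hz))
      (hh.differentiableAt (isOpen_ball.mem_nhds hz))
  calc _ ≤ areaIntegral ρ (fun z => β * ((2 * γ)⁻¹ * ‖deriv (fun z => ψ z * h z) z‖ ^ 2 +
        (3 * γ / 2) * ‖deriv h z‖ ^ 2)) := by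
        refine areaIntegral_mono ((hb.mul hψc).norm.mul (hc.mul hc')) ?_ (fun z hz => ?_) h0 h1
        · exact continuousOn_const.mul ((continuousOn_const.mul (hkc.pow 2)).add
            (continuousOn_const.mul (hc'.pow 2)))
        · set X := ‖deriv (fun z => ψ z * h z) z‖
          set Y := ‖deriv h z‖
          have e1 : ‖deriv ψ z‖ * ‖h z‖ ≤ X + γ * Y := by
            rw [← norm_mul]
            have : deriv ψ z * h z = deriv (fun z => ψ z * h z) z - ψ z * deriv h z := by
              rw [hderiv z hz]; ring
            rw [this]
            refine (norm_sub_le _ _).trans ?_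
            rw [norm_mul]
            gcongr
            exact hψγ z hz
          have e2 : (X + γ * Y) * Y ≤ (2 * γ)⁻¹ * X ^ 2 + (3 * γ / 2) * Y ^ 2 := by
            have : (2 * γ)⁻¹ * X ^ 2 + (3 * γ / 2) * Y ^ 2 - (X + γ * Y) * Y =
                (2 * γ)⁻¹ * (X - γ * Y) ^ 2 := by field_simp; ring
            have h4 : 0 ≤ (2 * γ)⁻¹ * (X - γ * Y) ^ 2 := by positivity
            linarith
          have hY : 0 ≤ Y := norm_nonneg _
          calc ‖b z * deriv ψ z‖ * (‖h z‖ * Y) = ‖b z‖ * (‖deriv ψ z‖ * ‖h z‖ * Y) := by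
                rw [norm_mul]; ring
            _ ≤ β * ((X + γ * Y) * Y) := by
                refine mul_le_mul (hbβ z hz) ?_ (by positivity) hβ
                gcongr
            _ ≤ _ := mul_le_mul_of_nonneg_left e2 hβ
    _ ≤ 2 * β * γ * M := by
        rw [areaIntegral_const_mul, areaIntegral_add
          (φ := fun z => (2 * γ)⁻¹ * ‖deriv (fun z => ψ z * h z) z‖ ^ 2)
          (ψ := fun z => 3 * γ / 2 * ‖deriv h z‖ ^ 2) (continuousOn_const.mul (hkc.pow 2))
          (continuousOn_const.mul (hc'.pow 2)) h0 h1, areaIntegral_const_mul,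
          areaIntegral_const_mul]
        have i1 := areaIntegral_norm_deriv_sq_le hk hkM h0 h1
        have i2 := areaIntegral_norm_deriv_sq_le hh hM h0 h1
        calc _ ≤ β * ((2 * γ)⁻¹ * (γ ^ 2 * M) + 3 * γ / 2 * M) := by gcongr
          _ = _ := by field_simp; ring

section FourAddLog
variable {x : ℂ}

lemma one_le_norm_of_one_le_re (hx : 1 ≤ x.re) : 1 ≤ ‖x‖ := hx.trans (Complex.re_le_norm x)

lemma mem_slitPlane_of_one_le_re (hx : 1 ≤ x.re) : x ∈ Complex.slitPlane := Or.inl (by linarith)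

lemma ne_zero_of_one_le_re (hx : 1 ≤ x.re) : x ≠ 0 := by rintro rfl; norm_num at hx

lemma re_four_add_log : 4 + Real.log ‖x‖ = (4 + Complex.log x).re := by
  simp [Complex.log_re]

lemma four_add_log_norm_le : 4 + Real.log ‖x‖ ≤ ‖4 + Complex.log x‖ := by
  rw [re_four_add_log]; exact Complex.re_le_norm _

lemma four_le_norm_four_add_log (hx : 1 ≤ x.re) : 4 ≤ ‖4 + Complex.log x‖ := by
  linarith [four_add_log_norm_le (x := x), Real.log_nonneg (one_le_norm_of_one_le_re hx)]

lemma abs_arg_le_of_one_le_re (hx : 1 ≤ x.re) : |x.arg| ≤ Real.pi / 2 :=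
  Complex.abs_arg_le_pi_div_two_iff.2 (by linarith)

lemma abs_im_four_add_log_le (hx : 1 ≤ x.re) : |(4 + Complex.log x).im| ≤ 2 := by
  have : (4 + Complex.log x).im = x.arg := by simp [Complex.log_im]
  rw [this]
  linarith [abs_arg_le_of_one_le_re hx, Real.pi_le_four]

lemma norm_four_add_log_le (hx : 1 ≤ x.re) : ‖4 + Complex.log x‖ ≤ 6 + Real.log ‖x‖ := by
  refine (Complex.norm_le_abs_re_add_abs_im _).trans ?_
  rw [← re_four_add_log, abs_of_nonneg]
  · linarith [abs_im_four_add_log_le hx]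
  · linarith [Real.log_nonneg (one_le_norm_of_one_le_re hx)]

lemma norm_inv_four_add_log_le (hx : 1 ≤ x.re) : ‖(4 + Complex.log x)⁻¹‖ ≤ 1 / 4 := by
  rw [norm_inv, one_div]
  exact inv_anti₀ (by norm_num) (four_le_norm_four_add_log hx)

lemma four_add_log_ne_zero (hx : 1 ≤ x.re) : 4 + Complex.log x ≠ 0 := by
  rw [← norm_pos_iff]
  linarith [four_le_norm_four_add_log hx]

end FourAddLog

namespace OneLeRe
variable {U : ℂ → ℂ}

lemma differentiableOn_log (h : OneLeRe U) :
    DifferentiableOn ℂ (fun z => Complex.log (U z)) (ball 0 1) :=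
  h.differentiableOn.clog fun z hz => mem_slitPlane_of_one_le_re (h.one_le_re z hz)

lemma differentiableOn_four_add_log (h : OneLeRe U) :
    DifferentiableOn ℂ (fun z => 4 + Complex.log (U z)) (ball 0 1) :=
  h.differentiableOn_log.const_add _

lemma differentiableOn_inv_four_add_log (h : OneLeRe U) :
    DifferentiableOn ℂ (fun z => (4 + Complex.log (U z))⁻¹) (ball 0 1) :=
  h.differentiableOn_four_add_log.inv fun z hz => four_add_log_ne_zero (h.one_le_re z hz)

lemma log_zero_eq (h : OneLeRe U) : Complex.log (U 0) = Real.log (U 0).re := by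
  have : U 0 = ((U 0).re : ℂ) := Complex.ext (by simp) (by simp [h.im_zero])
  conv_lhs => rw [this]
  rw [Complex.ofReal_log]
  linarith [h.one_le_re 0 (by simp)]

lemma differentiableOn_exp_log (h : OneLeRe U) (s : ℝ) :
    DifferentiableOn ℂ (fun z => Complex.exp (s * Complex.log (U z))) (ball 0 1) :=
  (h.differentiableOn_log.const_mul _).cexp

lemma _root_.norm_exp_mul_log {x : ℂ} (hx : x ≠ 0) (s : ℝ) :
    ‖Complex.exp (s * Complex.log x)‖ = ‖x‖ ^ s := by
  rw [Complex.norm_exp, Complex.re_ofReal_mul, Complex.log_re, Real.rpow_def_of_pos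
    (norm_pos_iff.2 hx), mul_comm]

lemma _root_.rpow_mul_cos_le_re_exp_mul_log {x : ℂ} (hx : 1 ≤ x.re) {s : ℝ} (hs0 : 0 ≤ s)
    (hs1 : s ≤ 1) :
    ‖x‖ ^ s * Real.cos (s * (Real.pi / 2)) ≤ (Complex.exp (s * Complex.log x)).re := by
  rw [Complex.exp_re, ← norm_exp_mul_log (ne_zero_of_one_le_re hx), Complex.norm_exp,
    Complex.im_ofReal_mul, Complex.log_im]
  gcongr
  rw [← Real.cos_abs (s * x.arg), abs_mul, abs_of_nonneg hs0]
  have h1 := abs_arg_le_of_one_le_re hx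
  refine Real.cos_le_cos_of_nonneg_of_le_pi (by positivity) ?_ (by gcongr)
  nlinarith [Real.pi_pos]

/-- Kolmogorov's theorem. -/
lemma exists_circleAverage_rpow_le (h : OneLeRe U) {s : ℝ} (hs0 : 0 ≤ s) (hs1 : s < 1) :
    ∃ C, ∀ r, 0 ≤ r → r < 1 → circleAverage (fun z => ‖U z‖ ^ s) 0 r ≤ C := by
  have hcos : 0 < Real.cos (s * (Real.pi / 2)) := by
    refine Real.cos_pos_of_mem_Ioo ⟨?_, ?_⟩ <;> nlinarith [Real.pi_pos]
  refine ⟨(Real.cos (s * (Real.pi / 2)))⁻¹ * (Complex.exp (s * Complex.log (U 0))).re,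
    fun r h0 h1 => ?_⟩
  have hd := h.differentiableOn_exp_log s
  rw [← circleAverage_re_eq hd h0 h1, ← smul_eq_mul, ← Real.circleAverage_fun_smul]
  refine circleAverage_mono_of_ball ?_ ?_ (fun z hz => ?_) h0 h1
  · exact h.differentiableOn.continuousOn.norm.rpow_const fun _ _ => Or.inr hs0
  · exact continuousOn_const.mul (Complex.continuous_re.comp_continuousOn hd.continuousOn)
  · rw [smul_eq_mul, inv_mul_eq_div, le_div_iff₀ hcos]
    exact rpow_mul_cos_le_re_exp_mul_log (h.one_le_re z hz) hs0 hs1.le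

end OneLeRe

/-- Powers of the logarithm grow slower than any power. -/
lemma exists_log_rpow_le {s ε : ℝ} (hs : 0 < s) (hε : 0 < ε) :
    ∃ C : ℝ, 0 < C ∧ ∀ x : ℝ, 1 ≤ x → (6 + Real.log x) ^ s ≤ C * x ^ ε := by
  refine ⟨(6 + s / ε) ^ s, by positivity, fun x hx => ?_⟩
  have h1 : Real.log x ≤ x ^ (ε / s) / (ε / s) := Real.log_le_rpow_div (by linarith) (by positivity)
  have h2 : 1 ≤ x ^ (ε / s) := Real.one_le_rpow hx (by positivity)
  have h3 : 6 + Real.log x ≤ (6 + s / ε) * x ^ (ε / s) := by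
    have : x ^ (ε / s) / (ε / s) = s / ε * x ^ (ε / s) := by field_simp
    nlinarith
  calc (6 + Real.log x) ^ s ≤ ((6 + s / ε) * x ^ (ε / s)) ^ s := by
        refine Real.rpow_le_rpow ?_ h3 hs.le
        linarith [Real.log_nonneg hx]
    _ = _ := by
        rw [Real.mul_rpow (by positivity) (by positivity), ← Real.rpow_mul (by linarith),
          div_mul_cancel₀ _ (ne_of_gt hs)]

/-- `√x / (4 + log x)` -/
def sqrtDivLog (x : ℂ) : ℂ := Complex.exp ((2⁻¹ : ℝ) * Complex.log x) * (4 + Complex.log x)⁻¹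

lemma OneLeRe.hasDerivAt_log {U : ℂ → ℂ} (h : OneLeRe U) {z : ℂ} (hz : z ∈ ball (0 : ℂ) 1) :
    HasDerivAt (fun z => Complex.log (U z)) (deriv U z / U z) z :=
  (h.differentiableOn.differentiableAt (isOpen_ball.mem_nhds hz)).hasDerivAt.clog
    (mem_slitPlane_of_one_le_re (h.one_le_re z hz))

lemma OneLeRe.norm_deriv_le_sqrtDivLog {U : ℂ → ℂ} (h : OneLeRe U) {z : ℂ}
    (hz : z ∈ ball (0 : ℂ) 1) :
    ‖(4 + Complex.log (U z))⁻¹‖ ^ 2 * ‖deriv U z‖ ≤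
      4 * (‖sqrtDivLog (U z)‖ * ‖deriv (fun z => sqrtDivLog (U z)) z‖) := by
  have hre := h.one_le_re z hz
  have hx := ne_zero_of_one_le_re hre
  have h4 := four_add_log_ne_zero hre
  have hl := h.hasDerivAt_log hz
  have hd : HasDerivAt (fun z => sqrtDivLog (U z))
      (Complex.exp ((2⁻¹ : ℝ) * Complex.log (U z)) * (deriv U z / U z) *
        (4 + Complex.log (U z))⁻¹ * (2⁻¹ - (4 + Complex.log (U z))⁻¹)) z := by
    refine (show HasDerivAt (fun z => sqrtDivLog (U z)) _ z from
      ((hl.const_mul ((2⁻¹ : ℝ) : ℂ)).cexp.mul ((hl.const_add 4).inv h4))).congr_deriv ?_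
    push_cast
    field_simp
    ring
  rw [hd.deriv, sqrtDivLog]
  simp only [norm_mul, norm_div, norm_exp_mul_log hx]
  have h14 : 1 / 4 ≤ ‖2⁻¹ - (4 + Complex.log (U z))⁻¹‖ := by
    have h1 := norm_sub_norm_le (2⁻¹ : ℂ) (4 + Complex.log (U z))⁻¹
    have h2 := norm_inv_four_add_log_le hre
    have h3 : ‖(2⁻¹ : ℂ)‖ = 1 / 2 := by norm_num
    linarith
  have hs : ‖U z‖ ^ (2⁻¹ : ℝ) * ‖U z‖ ^ (2⁻¹ : ℝ) = ‖U z‖ := by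
    rw [← Real.rpow_add (norm_pos_iff.2 hx)]; norm_num
  set t := ‖(4 + Complex.log (U z))⁻¹‖
  calc t ^ 2 * ‖deriv U z‖ = 4 * (t ^ 2 * ‖deriv U z‖ * (1 / 4)) := by ring
    _ ≤ 4 * (t ^ 2 * ‖deriv U z‖ * ‖2⁻¹ - (4 + Complex.log (U z))⁻¹‖) := by gcongr
    _ = 4 * (t ^ 2 * ((‖U z‖ ^ (2⁻¹ : ℝ) * ‖U z‖ ^ (2⁻¹ : ℝ)) / ‖U z‖) * ‖deriv U z‖ *
          ‖2⁻¹ - (4 + Complex.log (U z))⁻¹‖) := by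
        rw [hs, div_self (norm_ne_zero_iff.2 hx), mul_one]
    _ = _ := by ring

lemma norm_sqrtDivLog_sq_le {x : ℂ} (hx : 1 ≤ x.re) :
    ‖sqrtDivLog x‖ ^ 2 ≤ (x * (4 + Complex.log x)⁻¹).re := by
  have hx0 := ne_zero_of_one_le_re hx
  have hn : 0 < ‖x‖ := norm_pos_iff.2 hx0
  have h4 : 0 < ‖4 + Complex.log x‖ ^ 2 := by
    have := four_le_norm_four_add_log hx
    positivity
  have hs : (‖x‖ ^ (2⁻¹ : ℝ)) ^ 2 = ‖x‖ := by
    rw [← Real.rpow_natCast, ← Real.rpow_mul hn.le]; norm_num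
  have hl := Real.log_nonneg (one_le_norm_of_one_le_re hx)
  have hcos : 0 ≤ Real.cos x.arg := by
    have := abs_le.1 (abs_arg_le_of_one_le_re hx)
    exact Real.cos_nonneg_of_mem_Icc ⟨by linarith, this.2⟩
  have hsin : Real.sin x.arg ^ 2 ≤ x.arg * Real.sin x.arg := by
    have h1 : |Real.sin x.arg| ≤ |x.arg| := Real.abs_sin_le_abs
    have h2 : 0 ≤ x.arg * Real.sin x.arg := by
      rcases le_total 0 x.arg with h | h
      · exact mul_nonneg h (Real.sin_nonneg_of_nonneg_of_le_pi h (Complex.arg_le_pi x))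
      · exact mul_nonneg_of_nonpos_of_nonpos h
          (Real.sin_nonpos_of_nonpos_of_neg_pi_le h (Complex.neg_pi_lt_arg x).le)
    rw [← abs_of_nonneg h2, abs_mul, ← sq_abs, sq]
    gcongr
  have key : 1 ≤ Real.cos x.arg * (4 + Real.log ‖x‖) + Real.sin x.arg * x.arg := by
    have h1 := Real.sin_sq_add_cos_sq x.arg
    have h2 := Real.cos_le_one x.arg
    nlinarith
  rw [sqrtDivLog, norm_mul, norm_exp_mul_log hx0, mul_pow, hs, norm_inv, inv_pow,
    Complex.inv_def, ← mul_assoc, Complex.re_mul_ofReal, Complex.normSq_eq_norm_sq]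
  refine mul_le_mul_of_nonneg_right ?_ (inv_nonneg.2 h4.le)
  rw [Complex.mul_re, Complex.conj_re, Complex.conj_im, ← re_four_add_log]
  have him : (4 + Complex.log x).im = x.arg := by simp [Complex.log_im]
  rw [him]
  conv_rhs => rw [← Complex.norm_mul_cos_arg x, ← Complex.norm_mul_sin_arg x]
  nlinarith

lemma OneLeRe.differentiableOn_sqrtDivLog {U : ℂ → ℂ} (h : OneLeRe U) :
    DifferentiableOn ℂ (fun z => sqrtDivLog (U z)) (ball 0 1) :=
  (h.differentiableOn_exp_log 2⁻¹).mul h.differentiableOn_inv_four_add_log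

lemma OneLeRe.circleAverage_sqrtDivLog_le {U : ℂ → ℂ} (h : OneLeRe U) {r : ℝ} (h0 : 0 < r)
    (h1 : r < 1) : circleAverage (fun z => ‖sqrtDivLog (U z)‖ ^ 2) 0 r ≤ (U 0).re / 4 := by
  have hd : DifferentiableOn ℂ (fun z => U z * (4 + Complex.log (U z))⁻¹) (ball 0 1) :=
    h.differentiableOn.mul h.differentiableOn_inv_four_add_log
  calc _ ≤ circleAverage (fun z => (U z * (4 + Complex.log (U z))⁻¹).re) 0 r := by
        refine circleAverage_mono_of_ball ?_ ?_ (fun z hz => ?_) h0.le h1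
        · exact h.differentiableOn_sqrtDivLog.continuousOn.norm.pow 2
        · exact Complex.continuous_re.comp_continuousOn hd.continuousOn
        · exact norm_sqrtDivLog_sq_le (h.one_le_re z hz)
    _ = (U 0 * (4 + Complex.log (U 0))⁻¹).re := circleAverage_re_eq hd h0.le h1
    _ ≤ ‖U 0 * (4 + Complex.log (U 0))⁻¹‖ := Complex.re_le_norm _
    _ ≤ (U 0).re * (1 / 4) := by
        rw [norm_mul, h.re_zero_eq_norm]
        gcongr
        exact norm_inv_four_add_log_le (h.one_le_re 0 (by simp))
    _ = _ := by ring

lemma LPBound.areaIntegral_le {D e Y : ℂ → ℂ} {δ c : ℝ} (hD : LPBound D δ)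
    (hDc : ContinuousOn D (ball 0 1)) (hδ : 0 ≤ δ) (hY : OneLeRe Y) (hY0 : (Y 0).re ≤ 2)
    (hec : ContinuousOn e (ball 0 1)) (hc : 0 ≤ c)
    (he : ∀ z ∈ ball (0 : ℂ) 1, ‖e z‖ ≤ c * ‖(4 + Complex.log (Y z))⁻¹‖ ^ 2) {ρ : ℝ} (h0 : 0 ≤ ρ)
    (h1 : ρ < 1) : areaIntegral ρ (fun z => ‖D z‖ * (‖e z‖ * ‖deriv Y z‖)) ≤ 2 * c * δ := by
  have hB := hY.differentiableOn_sqrtDivLog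
  have hBc := hB.continuousOn.norm.mul hB.continuousOn_deriv_ball.norm
  calc _ ≤ areaIntegral ρ (fun z => (4 * c) * (‖D z‖ *
        (‖sqrtDivLog (Y z)‖ * ‖deriv (fun z => sqrtDivLog (Y z)) z‖))) := by
        refine areaIntegral_mono (hDc.norm.mul (hec.norm.mul
          hY.differentiableOn.continuousOn_deriv_ball.norm))
          (continuousOn_const.mul (hDc.norm.mul hBc)) (fun z hz => ?_) h0 h1
        have h2 := hY.norm_deriv_le_sqrtDivLog hz
        have h3 := mul_le_mul_of_nonneg_right (he z hz) (norm_nonneg (deriv Y z))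
        have h4 := mul_le_mul_of_nonneg_left h2 hc
        have h5 : ‖D z‖ * (‖e z‖ * ‖deriv Y z‖) ≤ ‖D z‖ * (c * (4 * (‖sqrtDivLog (Y z)‖ *
          ‖deriv (fun z => sqrtDivLog (Y z)) z‖))) := by
          refine mul_le_mul_of_nonneg_left ?_ (norm_nonneg _)
          linarith
        refine h5.trans (le_of_eq ?_)
        simp only [Pi.mul_apply]
        ring
    _ ≤ (4 * c) * (δ * ((Y 0).re / 4)) := by
        rw [areaIntegral_const_mul]
        refine mul_le_mul_of_nonneg_left ?_ (by positivity)
        exact hD _ hB _ (fun r hr0 hr1 => hY.circleAverage_sqrtDivLog_le hr0 hr1) ρ h0 h1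
    _ ≤ (4 * c) * (δ * (2 / 4)) := by gcongr
    _ = _ := by ring

/-- The primitive vanishing at the origin. -/
def primitive (f : ℂ → ℂ) (w : ℂ) : ℂ := w * ∫ t in (0 : ℝ)..1, f (t * w)

lemma primitive_zero (f : ℂ → ℂ) : primitive f 0 = 0 := by simp [primitive]

lemma ofReal_mul_mem_ball {w : ℂ} (hw : w ∈ ball (0 : ℂ) 1) {t : ℝ} (ht : t ∈ Icc (0 : ℝ) 1) :
    (t : ℂ) * w ∈ ball (0 : ℂ) 1 := by
  rw [mem_ball_zero_iff] at hw ⊢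
  rw [norm_mul, Complex.norm_real, Real.norm_of_nonneg ht.1]
  exact (mul_le_of_le_one_left (norm_nonneg _) ht.2).trans_lt hw

lemma primitive_eq_sub (hf : ContinuousOn f (ball 0 1))
    (hg : ∀ z ∈ ball (0 : ℂ) 1, HasDerivAt g (f z) z) {w : ℂ} (hw : w ∈ ball (0 : ℂ) 1) :
    primitive f w = g w - g 0 := by
  have h := intervalIntegral.integral_eq_sub_of_hasDerivAt (a := 0) (b := 1)
    (f := fun t : ℝ => g (t * w)) (f' := fun t : ℝ => f (t * w) * w) (fun t ht => by
      rw [uIcc_of_le zero_le_one] at ht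
      have h1 : HasDerivAt (fun t : ℂ => t * w) w (t : ℂ) := by
        simpa using (hasDerivAt_id (t : ℂ)).mul_const w
      exact ((hg _ (ofReal_mul_mem_ball hw ht)).comp (t : ℂ) h1).comp_ofReal) (by
      refine ContinuousOn.intervalIntegrable ?_
      rw [uIcc_of_le zero_le_one]
      exact (hf.comp (by fun_prop) fun t ht => ofReal_mul_mem_ball hw ht).mul continuousOn_const)
  rw [intervalIntegral.integral_mul_const] at h
  rw [primitive, mul_comm, h]
  simp

lemma hasDerivAt_primitive (hf : DifferentiableOn ℂ f (ball 0 1)) {w : ℂ}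
    (hw : w ∈ ball (0 : ℂ) 1) : HasDerivAt (primitive f) (f w) w := by
  obtain ⟨g, hg⟩ := hf.isExactOn_ball
  have h1 : HasDerivAt (fun z => g z - g 0) (f w) w := (hg w hw).sub_const _
  refine h1.congr_of_eventuallyEq ?_
  filter_upwards [isOpen_ball.mem_nhds hw] with z hz
  exact primitive_eq_sub hf.continuousOn hg hz

lemma differentiableOn_primitive (hf : DifferentiableOn ℂ f (ball 0 1)) :
    DifferentiableOn ℂ (primitive f) (ball 0 1) := fun _ hw =>
  (hasDerivAt_primitive hf hw).differentiableAt.differentiableWithinAt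

lemma areaIntegral_const_smul {E : Type*} [NormedAddCommGroup E] [NormedSpace ℝ E] (c : ℝ)
    (φ : ℂ → E) (ρ : ℝ) : areaIntegral ρ (fun z => c • φ z) = c • areaIntegral ρ φ := by
  rw [areaIntegral, areaIntegral, ← intervalIntegral.integral_smul]
  refine intervalIntegral.integral_congr fun r hr => ?_
  simp only [Real.circleAverage_fun_smul]
  rw [smul_comm]

lemma areaIntegral_sum {ι : Type*} {E : Type*} [NormedAddCommGroup E] [NormedSpace ℝ E]
    (s : Finset ι) (φ : ι → ℂ → E) (hφ : ∀ j ∈ s, ContinuousOn (φ j) (ball 0 1)) {ρ : ℝ}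
    (h0 : 0 ≤ ρ) (h1 : ρ < 1) :
    areaIntegral ρ (fun z => ∑ j ∈ s, φ j z) = ∑ j ∈ s, areaIntegral ρ (φ j) := by
  induction s using Finset.cons_induction with
  | empty => simp [areaIntegral, Real.circleAverage_def]
  | cons j s hj ih =>
    simp only [Finset.sum_cons]
    rw [areaIntegral_add (hφ j (by simp))
      (continuousOn_finsetSum s fun i hi => hφ i (by simp [hi])) h0 h1,
      ih fun i hi => hφ i (by simp [hi])]

lemma norm_areaIntegral_le {E : Type*} [NormedAddCommGroup E] [NormedSpace ℝ E]
    (φ : ℂ → E) (hφ : ContinuousOn φ (ball 0 1)) {ρ : ℝ} (h0 : 0 ≤ ρ) (h1 : ρ < 1) :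
    ‖areaIntegral ρ φ‖ ≤ areaIntegral ρ fun z => ‖φ z‖ := by
  refine (intervalIntegral.norm_integral_le_integral_norm h0).trans ?_
  refine intervalIntegral.integral_mono_on h0
    (intervalIntegrable_areaWeight_smul hφ h0 h1).norm
    (intervalIntegrable_areaWeight_smul hφ.norm h0 h1) fun r hr => ?_
  rw [norm_smul, smul_eq_mul, Real.norm_of_nonneg (areaWeight_nonneg hr.1 (hr.2.trans h1.le))]
  refine mul_le_mul_of_nonneg_left ?_ (areaWeight_nonneg hr.1 (hr.2.trans h1.le))
  rw [Real.circleAverage_def, Real.circleAverage_def, norm_smul, smul_eq_mul, norm_inv,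
    Real.norm_of_nonneg Real.two_pi_pos.le]
  gcongr
  exact intervalIntegral.norm_integral_le_integral_norm Real.two_pi_pos.le

lemma tendsto_areaIntegral_szegoKernel (hf : DifferentiableOn ℂ f (ball 0 1)) {w : ℂ}
    (hw : w ∈ ball (0 : ℂ) 1) :
    Tendsto (fun ρ => areaIntegral ρ fun z => f z * conj (deriv (szegoKernel w) z)) (𝓝[<] 1)
      (𝓝 (primitive f w)) := by
  have h := tendsto_area_pairing_szegoKernel (differentiableOn_primitive hf) hw
  rw [primitive_zero, sub_zero] at h
  refine h.congr' ?_
  filter_upwards [Ioo_mem_nhdsLT (zero_lt_one (α := ℝ))] with ρ hρ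
  refine intervalIntegral.integral_congr fun r hr => ?_
  rw [uIcc_of_le hρ.1.le] at hr
  simp only [Complex.real_smul]
  congr 1
  refine Real.circleAverage_congr_sphere fun z hz => ?_
  rw [abs_of_nonneg hr.1] at hz
  rw [(hasDerivAt_primitive hf (sphere_subset_ball_one (hr.2.trans_lt hρ.2) hz)).deriv]

lemma one_sub_conj_mul_mem {w z : ℂ} (hw : w ∈ ball (0 : ℂ) 1) (hz : z ∈ ball (0 : ℂ) 1) :
    ‖conj w * z‖ < 1 := by
  rw [mem_ball_zero_iff] at hw hz
  rw [norm_mul, RCLike.norm_conj]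
  nlinarith [norm_nonneg w, norm_nonneg z]

lemma re_szegoKernel_ge {w z : ℂ} (hw : w ∈ ball (0 : ℂ) 1) (hz : z ∈ ball (0 : ℂ) 1) :
    1 / 2 ≤ (szegoKernel w z).re := by
  have hu := one_sub_conj_mul_mem hw hz
  rw [szegoKernel]
  set u := conj w * z
  have h1 : Complex.normSq u ≤ 1 := by
    rw [Complex.normSq_eq_norm_sq]
    nlinarith [norm_nonneg u]
  rw [Complex.normSq_apply] at h1
  have h2 : u.re < 1 := (Complex.re_le_norm u).trans_lt hu
  have h3 : 0 < Complex.normSq (1 - u) := by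
    rw [Complex.normSq_pos]
    intro h
    have := congrArg Complex.re h
    simp at this
    linarith
  rw [Complex.inv_re, le_div_iff₀ h3, Complex.normSq_apply]
  simp only [Complex.sub_re, Complex.one_re, Complex.sub_im, Complex.one_im]
  nlinarith

lemma differentiableOn_szegoKernel {w : ℂ} (hw : w ∈ ball (0 : ℂ) 1) :
    DifferentiableOn ℂ (szegoKernel w) (ball 0 1) :=
  (hasDiscSeries_szegoKernel hw).differentiableOn

section HerglotzSum
variable {ι : Type*} (s : Finset ι) (l : ι → ℝ) (w : ι → ℂ)

/-- A finite positive combination of Herglotz kernels, plus one. -/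
def herglotzSum (z : ℂ) : ℂ := 1 + ∑ j ∈ s, l j * (2 * szegoKernel (w j) z - 1)

variable {s l w}

lemma herglotzSum_zero : herglotzSum s l w 0 = ((1 + ∑ j ∈ s, l j : ℝ) : ℂ) := by
  simp [herglotzSum, szegoKernel]
  norm_num

lemma oneLeRe_herglotzSum (hw : ∀ j ∈ s, w j ∈ ball (0 : ℂ) 1) (hl : ∀ j ∈ s, 0 ≤ l j) : OneLeRe (herglotzSum s l w) where
  differentiableOn := (DifferentiableOn.fun_sum fun j hj =>
    (((differentiableOn_szegoKernel (hw j hj)).const_mul _).sub_const _).const_mul _).const_add _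
  im_zero := by rw [herglotzSum_zero, Complex.ofReal_im]
  one_le_re z hz := by
    rw [herglotzSum, Complex.add_re, Complex.re_sum, Complex.one_re]
    refine le_add_of_nonneg_right (Finset.sum_nonneg fun j hj => ?_)
    rw [Complex.re_ofReal_mul]
    refine mul_nonneg (hl j hj) ?_
    have := re_szegoKernel_ge (hw j hj) hz
    simp only [Complex.sub_re, Complex.mul_re, Complex.re_ofNat, Complex.im_ofNat, Complex.one_re]
    linarith

lemma deriv_herglotzSum (hw : ∀ j ∈ s, w j ∈ ball (0 : ℂ) 1) {z : ℂ} (hz : z ∈ ball (0 : ℂ) 1) :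
    deriv (herglotzSum s l w) z = 2 * ∑ j ∈ s, l j * deriv (szegoKernel (w j)) z := by
  have h : HasDerivAt (herglotzSum s l w)
      (∑ j ∈ s, l j * (2 * deriv (szegoKernel (w j)) z)) z :=
    (HasDerivAt.fun_sum fun j hj => ((((differentiableOn_szegoKernel (hw j hj)).differentiableAt
      (isOpen_ball.mem_nhds hz)).hasDerivAt.const_mul _).sub_const _).const_mul _).const_add _
  rw [h.deriv, Finset.mul_sum]
  exact Finset.sum_congr rfl fun j _ => by ring

end HerglotzSum

lemma inv_two_mul_norm_sq_le_re {x : ℂ} (hx : 1 ≤ x.re) :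
    (2 * ‖4 + Complex.log x‖ ^ 2)⁻¹ ≤ (((4 + Complex.log x)⁻¹) ^ 2).re := by
  have hne := four_add_log_ne_zero hx
  have hre : 4 ≤ (4 + Complex.log x).re := by
    rw [← re_four_add_log]
    linarith [Real.log_nonneg (one_le_norm_of_one_le_re hx)]
  have him := abs_im_four_add_log_le hx
  set y := 4 + Complex.log x
  have hy : 0 < Complex.normSq y := Complex.normSq_pos.2 hne
  have hyy : Complex.normSq y = y.re * y.re + y.im * y.im := Complex.normSq_apply y
  have h1 : ((y⁻¹) ^ 2).re = (y.re * y.re - y.im * y.im) / Complex.normSq y ^ 2 := by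
    rw [sq, Complex.mul_re, Complex.inv_re, Complex.inv_im]
    field_simp
  rw [h1, ← Complex.normSq_eq_norm_sq, le_div_iff₀ (by positivity), inv_mul_le_iff₀ (by positivity)]
  have h2 : y.im * y.im ≤ 4 := by
    have := abs_mul_abs_self y.im
    nlinarith [abs_nonneg y.im]
  rw [sq, mul_comm 2, mul_assoc]
  refine mul_le_mul_of_nonneg_left ?_ hy.le
  nlinarith

/-- Constants controlling the loss in powers of `Re (4 + log x)⁻²` by a multiple of `Re x`. -/
def LogPowerBound (C : ℕ → ℝ) : Prop :=
  ∀ m, 0 ≤ C m ∧ ∀ x : ℂ, 1 ≤ x.re → ‖x‖ ≤ 2 * x.re →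
    1 ≤ C m * x.re * (((4 + Complex.log x)⁻¹) ^ 2).re ^ m

lemma exists_logPowerBound : ∃ C, LogPowerBound C := by
  have h : ∀ m : ℕ, ∃ C : ℝ, 0 ≤ C ∧ ∀ x : ℂ, 1 ≤ x.re → ‖x‖ ≤ 2 * x.re →
      1 ≤ C * x.re * (((4 + Complex.log x)⁻¹) ^ 2).re ^ m := by
    intro m
    obtain ⟨C, hC, h⟩ := exists_log_rpow_le (s := 2 * m + 1) (ε := 1) (by positivity) one_pos
    refine ⟨2 * 2 ^ m * C, by positivity, fun x hx hx2 => ?_⟩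
    have h1 := one_le_norm_of_one_le_re hx
    have h2 := h ‖x‖ h1
    rw [Real.rpow_one] at h2
    have h3 : (6 + Real.log ‖x‖) ^ (2 * m) ≤ C * ‖x‖ := by
      refine le_trans ?_ h2
      rw [← Real.rpow_natCast]
      refine Real.rpow_le_rpow_of_exponent_le (by linarith [Real.log_nonneg h1]) ?_
      push_cast; linarith
    have h4 : ‖4 + Complex.log x‖ ^ (2 * m) ≤ C * ‖x‖ :=
      (pow_le_pow_left₀ (norm_nonneg _) (norm_four_add_log_le hx) _).trans h3
    have hp : 0 < ‖4 + Complex.log x‖ := by linarith [four_le_norm_four_add_log hx]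
    have h5 := pow_le_pow_left₀ (by positivity) (inv_two_mul_norm_sq_le_re hx) m
    rw [inv_pow, mul_pow, ← pow_mul] at h5
    calc (1 : ℝ) = (2 ^ m * ‖4 + Complex.log x‖ ^ (2 * m)) *
          (2 ^ m * ‖4 + Complex.log x‖ ^ (2 * m))⁻¹ := by
            rw [mul_inv_cancel₀ (by positivity)]
      _ ≤ (2 * 2 ^ m * C * x.re) * (2 ^ m * ‖4 + Complex.log x‖ ^ (2 * m))⁻¹ := by
          refine mul_le_mul_of_nonneg_right ?_ (by positivity)
          calc _ ≤ 2 ^ m * (C * ‖x‖) := by gcongr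
            _ ≤ 2 ^ m * (C * (2 * x.re)) := by gcongr
            _ = _ := by ring
      _ ≤ _ := by gcongr
  choose C hC using h
  exact ⟨C, hC⟩

/-- Multipliers in the unit ball of `H^∞` with nonnegative real part whose inverse powers are
controlled by a common majorant. -/
structure AdmissibleMultiplier (C : ℕ → ℝ) (e : ℂ → ℂ) : Prop where
  differentiableOn : DifferentiableOn ℂ e (ball 0 1)
  im_zero : (e 0).im = 0
  norm_le_one : ∀ z ∈ ball (0 : ℂ) 1, ‖e z‖ ≤ 1
  re_nonneg : ∀ z ∈ ball (0 : ℂ) 1, 0 ≤ (e z).re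
  exists_majorant : ∃ P, OneLeRe P ∧ (P 0).re ≤ 4 ∧
    ∀ z ∈ ball (0 : ℂ) 1, ∀ m, 1 ≤ C m * (P z).re * (e z).re ^ m

namespace AdmissibleMultiplier
variable {C : ℕ → ℝ} {e e₁ e₂ : ℂ → ℂ}

lemma re_pos (he : AdmissibleMultiplier C e) {z : ℂ} (hz : z ∈ ball (0 : ℂ) 1) :
    0 < (e z).re := by
  obtain ⟨P, -, -, h⟩ := he.exists_majorant
  refine lt_of_le_of_ne (he.re_nonneg z hz) fun h0 => ?_
  have := h z hz 1
  rw [← h0] at this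
  norm_num at this

lemma convexCombination (h₁ : AdmissibleMultiplier C e₁)
    (h₂ : AdmissibleMultiplier C e₂) {s t : ℝ} (hs : 0 ≤ s) (ht : 0 ≤ t) (hst : s + t = 1) :
    AdmissibleMultiplier C (fun z => s * e₁ z + t * e₂ z) where
  differentiableOn := (h₁.differentiableOn.const_mul _).add (h₂.differentiableOn.const_mul _)
  im_zero := by simp [h₁.im_zero, h₂.im_zero]
  norm_le_one z hz := by
    refine (norm_add_le _ _).trans ?_
    rw [norm_mul, norm_mul, Complex.norm_real, Complex.norm_real, Real.norm_of_nonneg hs,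
      Real.norm_of_nonneg ht]
    nlinarith [h₁.norm_le_one z hz, h₂.norm_le_one z hz]
  re_nonneg z hz := by
    rw [Complex.add_re, Complex.re_ofReal_mul, Complex.re_ofReal_mul]
    have := h₁.re_nonneg z hz
    have := h₂.re_nonneg z hz
    positivity
  exists_majorant := by
    obtain ⟨P₁, hP₁, hP₁0, hb₁⟩ := h₁.exists_majorant
    obtain ⟨P₂, hP₂, hP₂0, hb₂⟩ := h₂.exists_majorant
    refine ⟨fun z => s * P₁ z + t * P₂ z, ⟨(hP₁.differentiableOn.const_mul _).add
      (hP₂.differentiableOn.const_mul _), by simp [hP₁.im_zero, hP₂.im_zero], fun z hz => ?_⟩,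
      ?_, fun z hz m => ?_⟩
    · rw [Complex.add_re, Complex.re_ofReal_mul, Complex.re_ofReal_mul]
      nlinarith [hP₁.one_le_re z hz, hP₂.one_le_re z hz]
    · rw [Complex.add_re, Complex.re_ofReal_mul, Complex.re_ofReal_mul]
      nlinarith
    · simp only [Complex.add_re, Complex.re_ofReal_mul]
      have hx := h₁.re_pos hz
      have hy := h₂.re_pos hz
      have hc := (convexOn_zpow (-(m : ℤ))).2 (mem_Ioi.2 hx) (mem_Ioi.2 hy) hs ht hst
      simp only [smul_eq_mul, zpow_neg, zpow_natCast] at hc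
      have hpos : 0 < s * (e₁ z).re + t * (e₂ z).re := by
        rcases hs.eq_or_lt with h | h
        · have : t = 1 := by linarith
          rw [← h, this]; linarith
        · positivity
      have i₁ : ((e₁ z).re ^ m)⁻¹ ≤ C m * (P₁ z).re :=
        (inv_le_iff_one_le_mul₀ (by positivity)).2 (hb₁ z hz m)
      have i₂ : ((e₂ z).re ^ m)⁻¹ ≤ C m * (P₂ z).re :=
        (inv_le_iff_one_le_mul₀ (by positivity)).2 (hb₂ z hz m)
      refine (inv_le_iff_one_le_mul₀ (by positivity)).1 (hc.trans ?_)
      calc _ ≤ s * (C m * (P₁ z).re) + t * (C m * (P₂ z).re) := by gcongr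
        _ = _ := by ring

lemma exists_tendstoUniformlyOn {ι : Type*} (U : Ultrafilter ι) {F : ι → ℂ → ℂ}
    (hF : ∀ i, AdmissibleMultiplier C (F i)) :
    ∃ e, AdmissibleMultiplier C e ∧ ∀ s < 1, TendstoUniformlyOn F e U (closedBall 0 s) := by
  obtain ⟨e, hed, he⟩ := exists_tendstoUniformlyOn_of_re_nonneg U
    (fun i => (hF i).differentiableOn) (fun i => (hF i).re_nonneg) (M := 1)
    (fun i => (hF i).norm_le_one 0 (by simp))
  choose P hP hP0 hb using fun i => (hF i).exists_majorant
  obtain ⟨Q, hQ, hQl⟩ := exists_tendstoUniformlyOn_oneLeRe U hP hP0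
  have hte : ∀ {z : ℂ}, z ∈ ball (0 : ℂ) 1 → Tendsto (fun i => F i z) U (𝓝 (e z)) :=
    fun hz => tendsto_of_tendstoUniformlyOn_closedBall he hz
  have hre : ∀ {z : ℂ}, z ∈ ball (0 : ℂ) 1 → Tendsto (fun i => (F i z).re) U (𝓝 (e z).re) :=
    fun hz => (Complex.continuous_re.tendsto _).comp (hte hz)
  have htQ : ∀ {z : ℂ}, z ∈ ball (0 : ℂ) 1 → Tendsto (fun i => (P i z).re) U (𝓝 (Q z).re) :=
    fun hz => (Complex.continuous_re.tendsto _).comp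
      (tendsto_of_tendstoUniformlyOn_closedBall hQl hz)
  refine ⟨e, ⟨hed, ?_, fun z hz => ?_, fun z hz => ?_, Q, hQ, ?_, fun z hz m => ?_⟩, he⟩
  · have := (Complex.continuous_im.tendsto _).comp (hte (z := 0) (by simp))
    exact tendsto_nhds_unique this
      (tendsto_const_nhds.congr fun i => ((hF i).im_zero).symm)
  · exact le_of_tendsto (hte hz).norm (.of_forall fun i => (hF i).norm_le_one z hz)
  · exact ge_of_tendsto (hre hz) (.of_forall fun i => (hF i).re_nonneg z hz)
  · exact le_of_tendsto (htQ (by simp)) (.of_forall hP0)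
  · exact ge_of_tendsto (((htQ hz).const_mul _).mul ((hre hz).pow m))
      (.of_forall fun i => hb i z hz m)

end AdmissibleMultiplier

/-- A weighted sum of square roots of the functions `Y k`, plus one. -/
def sqrtSum (N : ℕ) (Y : ℕ → ℂ → ℂ) (z : ℂ) : ℂ :=
  1 + ∑ k ∈ Finset.range N,
    (((1 / 2 : ℝ) ^ (k + 1) : ℝ) : ℂ) * Complex.exp ((1 / 2 : ℝ) * Complex.log (Y k z))

section SqrtSum
variable {N : ℕ} {Y : ℕ → ℂ → ℂ}

lemma half_sqrt_norm_le_re (hY : ∀ k, OneLeRe (Y k)) {z : ℂ} (hz : z ∈ ball (0 : ℂ) 1) (k : ℕ) :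
    ‖Y k z‖ ^ (1 / 2 : ℝ) * (1 / 2) ≤ (Complex.exp ((1 / 2 : ℝ) * Complex.log (Y k z))).re := by
  refine le_trans ?_ (rpow_mul_cos_le_re_exp_mul_log ((hY k).one_le_re z hz) (by norm_num)
    (by norm_num))
  have h : (1 / 2 : ℝ) ≤ Real.cos (1 / 2 * (Real.pi / 2)) := by
    rw [show (1 / 2 * (Real.pi / 2) : ℝ) = Real.pi / 4 by ring, Real.cos_pi_div_four]
    have : (1 : ℝ) ≤ √2 := Real.one_le_sqrt.2 (by norm_num)
    linarith
  gcongr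

lemma sqrtSum_re_ge (hY : ∀ k, OneLeRe (Y k)) {z : ℂ} (hz : z ∈ ball (0 : ℂ) 1) :
    1 + ∑ k ∈ Finset.range N, (1 / 2 : ℝ) ^ (k + 1) * (‖Y k z‖ ^ (1 / 2 : ℝ) * (1 / 2)) ≤
      (sqrtSum N Y z).re := by
  rw [sqrtSum, Complex.add_re, Complex.re_sum, Complex.one_re]
  refine add_le_add_right (Finset.sum_le_sum fun k _ => ?_) _
  rw [Complex.re_ofReal_mul]
  exact mul_le_mul_of_nonneg_left (half_sqrt_norm_le_re hY hz k) (by positivity)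

lemma oneLeRe_sqrtSum (hY : ∀ k, OneLeRe (Y k)) : OneLeRe (sqrtSum N Y) where
  differentiableOn := (DifferentiableOn.fun_sum fun k _ =>
    ((hY k).differentiableOn_exp_log _).const_mul _).const_add _
  im_zero := by
    simp only [sqrtSum, (hY _).log_zero_eq, ← Complex.ofReal_mul, ← Complex.ofReal_exp,
      ← Complex.ofReal_sum, ← Complex.ofReal_one, ← Complex.ofReal_add, Complex.ofReal_im]
  one_le_re z hz := by
    refine le_trans ?_ (sqrtSum_re_ge hY hz)
    exact le_add_of_nonneg_right (Finset.sum_nonneg fun k _ => by positivity)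

lemma norm_sqrtSum_le (hY : ∀ k, OneLeRe (Y k)) {z : ℂ} (hz : z ∈ ball (0 : ℂ) 1) :
    ‖sqrtSum N Y z‖ ≤ 1 + ∑ k ∈ Finset.range N, (1 / 2 : ℝ) ^ (k + 1) * ‖Y k z‖ ^ (1 / 2 : ℝ) := by
  refine (norm_add_le _ _).trans ?_
  rw [norm_one]
  refine add_le_add_right ((norm_sum_le _ _).trans (Finset.sum_le_sum fun k _ => ?_)) _
  rw [norm_mul, norm_exp_mul_log (ne_zero_of_one_le_re ((hY k).one_le_re z hz)),
    Complex.norm_real, Real.norm_of_nonneg (by positivity)]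

lemma norm_sqrtSum_le_two_mul_re (hY : ∀ k, OneLeRe (Y k)) {z : ℂ} (hz : z ∈ ball (0 : ℂ) 1) :
    ‖sqrtSum N Y z‖ ≤ 2 * (sqrtSum N Y z).re := by
  refine (norm_sqrtSum_le hY hz).trans ?_
  have := sqrtSum_re_ge (N := N) hY hz
  have h : ∑ k ∈ Finset.range N, (1 / 2 : ℝ) ^ (k + 1) * (‖Y k z‖ ^ (1 / 2 : ℝ) * (1 / 2)) =
      (∑ k ∈ Finset.range N, (1 / 2 : ℝ) ^ (k + 1) * ‖Y k z‖ ^ (1 / 2 : ℝ)) * (1 / 2) := by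
    rw [Finset.sum_mul]
    exact Finset.sum_congr rfl fun k _ => by ring
  rw [h] at this
  linarith

lemma sqrtSum_zero_re_le (hY : ∀ k, OneLeRe (Y k)) (hY0 : ∀ k, (Y k 0).re ≤ 2) : (sqrtSum N Y 0).re ≤ 4 := by
  have h1 : ∑ k ∈ Finset.range N, (1 / 2 : ℝ) ^ (k + 1) ≤ 1 := by
    have := (summable_geometric_two' (1 : ℝ)).sum_le_tsum (Finset.range N)
      (fun k _ => by positivity)
    rw [tsum_geometric_two'] at this
    refine le_trans (Finset.sum_le_sum fun k _ => ?_) this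
    rw [pow_succ, one_div_pow]
    exact le_of_eq (by ring)
  refine (Complex.re_le_norm _).trans ((norm_sqrtSum_le hY (by simp)).trans ?_)
  have h2 : ∑ k ∈ Finset.range N, (1 / 2 : ℝ) ^ (k + 1) * ‖Y k 0‖ ^ (1 / 2 : ℝ) ≤
      (∑ k ∈ Finset.range N, (1 / 2 : ℝ) ^ (k + 1)) * 2 := by
    rw [Finset.sum_mul]
    refine Finset.sum_le_sum fun k _ => mul_le_mul_of_nonneg_left ?_ (by positivity)
    rw [← (hY k).re_zero_eq_norm]
    have h1 := (hY k).one_le_re 0 (by simp)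
    calc _ ≤ (Y k 0).re ^ (1 : ℝ) := Real.rpow_le_rpow_of_exponent_le h1 (by norm_num)
      _ ≤ 2 := by rw [Real.rpow_one]; exact hY0 k
  linarith

lemma norm_four_add_log_le_sqrtSum (hY : ∀ k, OneLeRe (Y k)) {z : ℂ} (hz : z ∈ ball (0 : ℂ) 1) {k : ℕ} (hk : k < N) :
    ‖4 + Complex.log (Y k z)‖ ≤ (3 + k) * ‖4 + Complex.log (sqrtSum N Y z)‖ := by
  have hP := (oneLeRe_sqrtSum (N := N) hY).one_le_re z hz
  have hYk := (hY k).one_le_re z hz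
  have h1 : (1 / 2 : ℝ) ^ (k + 2) * ‖Y k z‖ ^ (1 / 2 : ℝ) ≤ ‖sqrtSum N Y z‖ := by
    refine le_trans ?_ ((sqrtSum_re_ge hY hz).trans (Complex.re_le_norm _))
    have := Finset.single_le_sum (f := fun k => (1 / 2 : ℝ) ^ (k + 1) *
      (‖Y k z‖ ^ (1 / 2 : ℝ) * (1 / 2))) (fun k _ => by positivity) (Finset.mem_range.2 hk)
    rw [pow_succ (1 / 2 : ℝ) (k + 1)]
    linarith
  have hYp : 0 < ‖Y k z‖ := by linarith [one_le_norm_of_one_le_re hYk]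
  have h2 := Real.log_le_log (by positivity) h1
  rw [Real.log_mul (by positivity) (by positivity), Real.log_pow, Real.log_rpow hYp, one_div,
    Real.log_inv] at h2
  push_cast at h2
  have h3 := norm_four_add_log_le hYk
  have h4 := four_add_log_norm_le (x := sqrtSum N Y z)
  have h5 := Real.log_nonneg (one_le_norm_of_one_le_re hP)
  have h6 := Real.log_two_lt_d9
  have hk0 : (0 : ℝ) ≤ k := k.cast_nonneg
  refine h3.trans (le_trans ?_ (mul_le_mul_of_nonneg_left h4 (by positivity)))
  nlinarith [mul_nonneg hk0 h5, mul_nonneg hk0 (sub_nonneg.2 h6.le)]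

lemma norm_inv_sq_sqrtSum_le (hY : ∀ k, OneLeRe (Y k)) {z : ℂ} (hz : z ∈ ball (0 : ℂ) 1) {k : ℕ} (hk : k < N) :
    ‖((4 + Complex.log (sqrtSum N Y z))⁻¹) ^ 2‖ ≤
      (3 + k) ^ 2 * ‖(4 + Complex.log (Y k z))⁻¹‖ ^ 2 := by
  rw [norm_pow, ← mul_pow]
  refine pow_le_pow_left₀ (norm_nonneg _) ?_ 2
  have h1 := four_le_norm_four_add_log ((oneLeRe_sqrtSum (N := N) hY).one_le_re z hz)
  have h2 := four_le_norm_four_add_log ((hY k).one_le_re z hz)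
  rw [norm_inv, norm_inv, ← div_eq_mul_inv, le_div_iff₀ (by linarith),
    inv_mul_le_iff₀ (by linarith), mul_comm]
  exact norm_four_add_log_le_sqrtSum hY hz hk

lemma admissibleMultiplier_sqrtSum (hY : ∀ k, OneLeRe (Y k)) {C : ℕ → ℝ} (hC : LogPowerBound C)
    (hY0 : ∀ k, (Y k 0).re ≤ 2) :
    AdmissibleMultiplier C (fun z => ((4 + Complex.log (sqrtSum N Y z))⁻¹) ^ 2) where
  differentiableOn := (oneLeRe_sqrtSum hY).differentiableOn_inv_four_add_log.pow 2
  im_zero := by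
    rw [(oneLeRe_sqrtSum hY).log_zero_eq]
    norm_cast
  norm_le_one z hz := by
    have := norm_inv_four_add_log_le ((oneLeRe_sqrtSum (N := N) hY).one_le_re z hz)
    rw [norm_pow]
    exact pow_le_one₀ (norm_nonneg _) (by linarith)
  re_nonneg z hz := le_trans (by positivity)
    (inv_two_mul_norm_sq_le_re ((oneLeRe_sqrtSum (N := N) hY).one_le_re z hz))
  exists_majorant := ⟨sqrtSum N Y, oneLeRe_sqrtSum hY, sqrtSum_zero_re_le hY hY0,
    fun z hz m => (hC m).2 _ ((oneLeRe_sqrtSum hY).one_le_re z hz)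
      (norm_sqrtSum_le_two_mul_re hY hz)⟩

end SqrtSum

lemma areaIntegral_congr {E : Type*} [NormedAddCommGroup E] [NormedSpace ℝ E] {φ ψ : ℂ → E}
    (h : ∀ z ∈ ball (0 : ℂ) 1, φ z = ψ z) {ρ : ℝ} (h0 : 0 ≤ ρ) (h1 : ρ < 1) :
    areaIntegral ρ φ = areaIntegral ρ ψ := by
  refine intervalIntegral.integral_congr fun r hr => ?_
  rw [uIcc_of_le h0] at hr
  have : circleAverage φ 0 r = circleAverage ψ 0 r :=
    Real.circleAverage_congr_sphere fun z hz => h z (sphere_subset_ball_one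
      (hr.2.trans_lt h1) (by rwa [abs_of_nonneg hr.1] at hz))
  simp only [this]

section Minimax
variable {ι : Type*} {D : ℕ → ℂ → ℂ} {δ : ℕ → ℝ} {C : ℕ → ℝ}

lemma norm_sum_areaIntegral_szegoKernel_le {s : Finset ι} {l : ι → ℝ} {w : ι → ℂ}
    {D e : ℂ → ℂ} {δ c : ℝ} (hw : ∀ j ∈ s, w j ∈ ball (0 : ℂ) 1) (hl : ∀ j ∈ s, 0 ≤ l j)
    (hl1 : ∑ j ∈ s, l j ≤ 1) (hD : DifferentiableOn ℂ D (ball 0 1)) (hLP : LPBound D δ)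
    (hδ : 0 ≤ δ) (hed : DifferentiableOn ℂ e (ball 0 1)) (hc : 0 ≤ c)
    (he : ∀ z ∈ ball (0 : ℂ) 1, ‖e z‖ ≤ c * ‖(4 + Complex.log (herglotzSum s l w z))⁻¹‖ ^ 2)
    {ρ : ℝ} (h0 : 0 ≤ ρ) (h1 : ρ < 1) :
    ‖∑ j ∈ s, l j • areaIntegral ρ (fun z => D z * e z * conj (deriv (szegoKernel (w j)) z))‖ ≤
      c * δ := by
  have hY := oneLeRe_herglotzSum hw hl
  have hY0 : (herglotzSum s l w 0).re ≤ 2 := by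
    rw [herglotzSum_zero, Complex.ofReal_re]; linarith
  have hcK : ∀ j ∈ s, ContinuousOn (fun z => D z * e z * conj (deriv (szegoKernel (w j)) z))
      (ball 0 1) := fun j hj => (hD.continuousOn.mul hed.continuousOn).mul
    (Complex.continuous_conj.comp_continuousOn
      (differentiableOn_szegoKernel (hw j hj)).continuousOn_deriv_ball)
  have hcY : ContinuousOn (fun z => ‖D z‖ * (‖e z‖ * ‖deriv (herglotzSum s l w) z‖)) (ball 0 1) :=
    hD.continuousOn.norm.mul (hed.continuousOn.norm.mul
      hY.differentiableOn.continuousOn_deriv_ball.norm)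
  have hcs : ∀ j ∈ s, ContinuousOn
      (fun z => l j • (D z * e z * conj (deriv (szegoKernel (w j)) z))) (ball 0 1) :=
    fun j hj => (hcK j hj).const_smul (l j)
  have hsum : ∑ j ∈ s, l j • areaIntegral ρ
        (fun z => D z * e z * conj (deriv (szegoKernel (w j)) z)) =
      areaIntegral ρ fun z => ∑ j ∈ s, l j • (D z * e z * conj (deriv (szegoKernel (w j)) z)) := by
    rw [areaIntegral_sum s _ hcs h0 h1]
    exact Finset.sum_congr rfl fun j _ => (areaIntegral_const_smul _ _ _).symm
  rw [hsum]
  refine (norm_areaIntegral_le _ (continuousOn_finsetSum s hcs) h0 h1).trans ?_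
  calc _ = areaIntegral ρ (fun z => (1 / 2 : ℝ) *
        (‖D z‖ * (‖e z‖ * ‖deriv (herglotzSum s l w) z‖))) := by
          refine areaIntegral_congr (fun z hz => ?_) h0 h1
          rw [deriv_herglotzSum hw hz, norm_mul, Complex.norm_ofNat]
          have : ∑ j ∈ s, l j • (D z * e z * conj (deriv (szegoKernel (w j)) z)) =
              D z * e z * conj (∑ j ∈ s, l j * deriv (szegoKernel (w j)) z) := by
            rw [map_sum, Finset.mul_sum]
            refine Finset.sum_congr rfl fun j _ => ?_
            rw [map_mul, Complex.conj_ofReal, Complex.real_smul]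
            ring
          rw [this, norm_mul, norm_mul, RCLike.norm_conj]
          ring
    _ = 1 / 2 * areaIntegral ρ (fun z => ‖D z‖ * (‖e z‖ * ‖deriv (herglotzSum s l w) z‖)) :=
        areaIntegral_const_smul (1 / 2 : ℝ) _ _
    _ ≤ 1 / 2 * (2 * c * δ) := by
        gcongr
        exact hLP.areaIntegral_le hD.continuousOn hδ hY hY0 hed.continuousOn hc he h0 h1
    _ = c * δ := by ring

lemma exists_admissibleMultiplier_sum_le (hC : LogPowerBound C)
    (hD : ∀ k, DifferentiableOn ℂ (D k) (ball 0 1))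
    (hLP : ∀ k, LPBound (D k) (δ k)) (hδ : ∀ k, 0 ≤ δ k)
    (hsum : ∀ N, ∑ k ∈ Finset.range N, (3 + k : ℝ) ^ 2 * δ k ≤ 1 / 2)
    (s : Finset ι) (κ : ι → ℕ) {l : ι → ℝ} {w : ι → ℂ}
    (hw : ∀ j ∈ s, w j ∈ ball (0 : ℂ) 1) (hl : ∀ j ∈ s, 0 ≤ l j) (hl1 : ∑ j ∈ s, l j ≤ 1) :
    ∃ e, AdmissibleMultiplier C e ∧
      ∑ j ∈ s, l j * (primitive (fun z => D (κ j) z * e z) (w j)).re ≤ 1 / 2 := by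
  classical
  set Y : ℕ → ℂ → ℂ := fun k => herglotzSum (s.filter (κ · = k)) l w with hYdef
  have hwk : ∀ k, ∀ j ∈ s.filter (κ · = k), w j ∈ ball (0 : ℂ) 1 :=
    fun k j hj => hw j (Finset.mem_of_mem_filter j hj)
  have hlk : ∀ k, ∀ j ∈ s.filter (κ · = k), 0 ≤ l j :=
    fun k j hj => hl j (Finset.mem_of_mem_filter j hj)
  have hl1k : ∀ k, ∑ j ∈ s.filter (κ · = k), l j ≤ 1 := fun k =>
    (Finset.sum_le_sum_of_subset_of_nonneg (Finset.filter_subset _ s)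
      fun j hj _ => hl j hj).trans hl1
  have hY : ∀ k, OneLeRe (Y k) := fun k => oneLeRe_herglotzSum (hwk k) (hlk k)
  have hY0 : ∀ k, (Y k 0).re ≤ 2 := fun k => by
    simp only [hYdef, herglotzSum_zero, Complex.ofReal_re]
    linarith [hl1k k]
  obtain ⟨N, hN⟩ : ∃ N, ∀ j ∈ s, κ j ∈ Finset.range N :=
    ⟨s.sup κ + 1, fun j hj => Finset.mem_range.2 (Nat.lt_succ_of_le (Finset.le_sup hj))⟩
  have hadm := admissibleMultiplier_sqrtSum (N := N) hY hC hY0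
  set e : ℂ → ℂ := fun z => ((4 + Complex.log (sqrtSum N Y z))⁻¹) ^ 2 with he
  refine ⟨e, hadm, ?_⟩
  have hlim : Tendsto (fun ρ => (∑ j ∈ s, l j • areaIntegral ρ
      (fun z => D (κ j) z * e z * conj (deriv (szegoKernel (w j)) z))).re) (𝓝[<] 1)
      (𝓝 (∑ j ∈ s, l j • primitive (fun z => D (κ j) z * e z) (w j)).re) :=
    (Complex.continuous_re.tendsto _).comp (tendsto_finsetSum s fun j hj =>
      (tendsto_areaIntegral_szegoKernel ((hD _).mul hadm.differentiableOn) (hw j hj)).const_smul _)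
  have hre : (∑ j ∈ s, l j • primitive (fun z => D (κ j) z * e z) (w j)).re =
      ∑ j ∈ s, l j * (primitive (fun z => D (κ j) z * e z) (w j)).re := by
    rw [Complex.re_sum]
    exact Finset.sum_congr rfl fun j _ => Complex.smul_re _ _
  rw [← hre]
  refine le_of_tendsto hlim ?_
  filter_upwards [Ioo_mem_nhdsLT (zero_lt_one (α := ℝ))] with ρ hρ
  rw [← Finset.sum_fiberwise_of_maps_to hN]
  refine (Complex.re_le_norm _).trans ((norm_sum_le _ _).trans ((Finset.sum_le_sum
    fun k hk => ?_).trans (hsum N)))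
  have hfib : ∑ j ∈ s.filter (κ · = k), l j • areaIntegral ρ
        (fun z => D (κ j) z * e z * conj (deriv (szegoKernel (w j)) z)) =
      ∑ j ∈ s.filter (κ · = k), l j • areaIntegral ρ
        (fun z => D k z * e z * conj (deriv (szegoKernel (w j)) z)) :=
    Finset.sum_congr rfl fun j hj => by rw [(Finset.mem_filter.1 hj).2]
  rw [hfib]
  exact norm_sum_areaIntegral_szegoKernel_le (hwk k) (hlk k) (hl1k k) (hD k) (hLP k) (hδ k)
    hadm.differentiableOn (by positivity)
    (fun z hz => norm_inv_sq_sqrtSum_le hY hz (Finset.mem_range.1 hk)) hρ.1.le hρ.2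

lemma exists_admissibleMultiplier_forall_mem_lt (hC : LogPowerBound C)
    (hD : ∀ k, DifferentiableOn ℂ (D k) (ball 0 1))
    (hLP : ∀ k, LPBound (D k) (δ k)) (hδ : ∀ k, 0 ≤ δ k)
    (hsum : ∀ N, ∑ k ∈ Finset.range N, (3 + k : ℝ) ^ 2 * δ k ≤ 1 / 2)
    (s : Finset (ℕ × ball (0 : ℂ) 1)) :
    ∃ e, AdmissibleMultiplier C e ∧
      ∀ j ∈ s, (primitive (fun z => D j.1 z * e z) j.2).re < 1 := by
  classical
  by_contra hcon
  set O : Set (s → ℝ) := Set.univ.pi fun _ => Iio 1 with hO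
  set V : (ℂ → ℂ) → s → ℝ := fun e j => (primitive (fun z => D j.1.1 z * e z) j.1.2).re with hV
  set T : Set (s → ℝ) := {x | ∃ e, AdmissibleMultiplier C e ∧ x = V e}
  have hVadd : ∀ {e₁ e₂ : ℂ → ℂ}, AdmissibleMultiplier C e₁ → AdmissibleMultiplier C e₂ →
      ∀ x y : ℝ, V (fun z => x * e₁ z + y * e₂ z) = x • V e₁ + y • V e₂ := by
    intro e₁ e₂ h₁ h₂ x y
    funext j
    have hint : ∀ {e : ℂ → ℂ}, AdmissibleMultiplier C e → IntervalIntegrable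
        (fun t : ℝ => D j.1.1 (t * (j.1.2 : ℂ)) * e (t * (j.1.2 : ℂ))) volume 0 1 := by
      intro e he
      refine ContinuousOn.intervalIntegrable ?_
      rw [uIcc_of_le zero_le_one]
      exact ((hD j.1.1).continuousOn.mul he.differentiableOn.continuousOn).comp
        (f := fun t : ℝ => (t : ℂ) * (j.1.2 : ℂ)) (by fun_prop)
        fun t ht => ofReal_mul_mem_ball j.1.2.2 ht
    have : primitive (fun z => D j.1.1 z * (x * e₁ z + y * e₂ z)) j.1.2 =
        x * primitive (fun z => D j.1.1 z * e₁ z) j.1.2 +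
        y * primitive (fun z => D j.1.1 z * e₂ z) j.1.2 := by
      simp only [primitive]
      rw [show (fun t : ℝ => D j.1.1 (t * (j.1.2 : ℂ)) * (x * e₁ (t * (j.1.2 : ℂ)) +
        y * e₂ (t * (j.1.2 : ℂ)))) = fun t : ℝ =>
          (x : ℂ) * (D j.1.1 (t * (j.1.2 : ℂ)) * e₁ (t * (j.1.2 : ℂ))) +
          (y : ℂ) * (D j.1.1 (t * (j.1.2 : ℂ)) * e₂ (t * (j.1.2 : ℂ))) by funext t; ring,
        intervalIntegral.integral_add ((hint h₁).const_mul _) ((hint h₂).const_mul _),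
        intervalIntegral.integral_const_mul, intervalIntegral.integral_const_mul]
      ring
    simp only [hV, this, Pi.add_apply, Pi.smul_apply, smul_eq_mul, Complex.add_re,
      Complex.re_ofReal_mul]
  have hOc : Convex ℝ O := convex_pi fun _ _ => convex_Iio 1
  have hOo : IsOpen O := isOpen_set_pi finite_univ fun _ _ => isOpen_Iio
  have hTc : Convex ℝ T := by
    rintro _ ⟨e₁, h₁, rfl⟩ _ ⟨e₂, h₂, rfl⟩ x y hx hy hxy
    exact ⟨_, h₁.convexCombination h₂ hx hy hxy, (hVadd h₁ h₂ x y).symm⟩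
  have hdisj : Disjoint O T := by
    rw [Set.disjoint_left]
    rintro _ hx ⟨e, he, rfl⟩
    exact hcon ⟨e, he, fun j hj => (hx ⟨j, hj⟩ trivial : V e ⟨j, hj⟩ < 1)⟩
  obtain ⟨φ, u, hφO, hφT⟩ := geometric_hahn_banach_open hOc hOo hTc hdisj
  set l : s → ℝ := fun j => φ (Pi.single j 1) with hl
  have hφ : ∀ x, φ x = ∑ j, l j * x j := by
    intro x
    conv_lhs => rw [pi_eq_sum_univ' x, map_sum]
    refine Finset.sum_congr rfl fun j _ => ?_
    rw [map_smul, smul_eq_mul, mul_comm]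
  have h0O : (0 : s → ℝ) ∈ O := fun _ _ => by simp
  have hu : 0 < u := by simpa using hφO 0 h0O
  have hl0 : ∀ j, 0 ≤ l j := by
    intro j
    by_contra! hneg
    have hmem : Pi.single j (u / l j) ∈ O := by
      intro i _
      rw [mem_Iio, Pi.single_apply]
      split_ifs
      · exact (div_neg_of_pos_of_neg hu hneg).trans one_pos
      · exact one_pos
    have := hφO _ hmem
    rw [hφ, Finset.sum_eq_single j (fun i _ hi => by simp [hi]) (by simp), Pi.single_eq_same,
      mul_div_cancel₀ _ hneg.ne] at this
    exact lt_irrefl _ this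
  have hle : ∑ j, l j ≤ u := by
    have hlim : Tendsto (fun x : ℝ => ∑ j, l j * x) (𝓝[<] 1) (𝓝 (∑ j, l j * 1)) :=
      tendsto_nhdsWithin_of_tendsto_nhds
        ((continuous_finsetSum _ fun j _ => continuous_const.mul continuous_id).tendsto 1)
    simp only [mul_one] at hlim
    refine le_of_tendsto hlim ?_
    filter_upwards [self_mem_nhdsWithin] with x hx
    rw [← hφ fun _ => x]
    exact (hφO _ fun _ _ => hx).le
  obtain ⟨e₀, he₀, -⟩ := exists_admissibleMultiplier_sum_le hC hD hLP hδ hsum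
    (∅ : Finset ℕ) id (l := 0) (w := 0) (by simp) (by simp) (by simp)
  have hpos : 0 < ∑ j, l j := by
    refine lt_of_le_of_ne (Finset.sum_nonneg fun j _ => hl0 j) fun h => ?_
    have h2 := (Finset.sum_eq_zero_iff_of_nonneg fun j _ => hl0 j).1 h.symm
    have := hφT (V e₀) ⟨e₀, he₀, rfl⟩
    rw [hφ, Finset.sum_eq_zero fun j hj => by rw [h2 j hj, zero_mul]] at this
    linarith
  obtain ⟨e, he, hle2⟩ := exists_admissibleMultiplier_sum_le hC hD hLP hδ hsum
    (Finset.univ : Finset s) (fun j => j.1.1) (l := fun j => l j / ∑ i, l i)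
    (w := fun j => (j.1.2 : ℂ)) (fun j _ => j.1.2.2) (fun j _ => div_nonneg (hl0 j) hpos.le)
    (by rw [← Finset.sum_div, div_self hpos.ne'])
  have h3 := hφT (V e) ⟨e, he, rfl⟩
  rw [hφ] at h3
  have h4 : ∑ j, l j * V e j = (∑ i, l i) * ∑ j : s, l j / (∑ i, l i) *
      (primitive (fun z => D j.1.1 z * e z) j.1.2).re := by
    rw [Finset.mul_sum]
    refine Finset.sum_congr rfl fun j _ => ?_
    rw [← mul_assoc, mul_div_cancel₀ _ hpos.ne']
  rw [h4] at h3
  nlinarith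

/-- A single multiplier whose products with all the `D k` have primitives with real part at
most one. -/
lemma exists_admissibleMultiplier_forall_le (hC : LogPowerBound C)
    (hD : ∀ k, DifferentiableOn ℂ (D k) (ball 0 1))
    (hLP : ∀ k, LPBound (D k) (δ k)) (hδ : ∀ k, 0 ≤ δ k)
    (hsum : ∀ N, ∑ k ∈ Finset.range N, (3 + k : ℝ) ^ 2 * δ k ≤ 1 / 2) :
    ∃ e, AdmissibleMultiplier C e ∧
    ∀ k, ∀ w ∈ ball (0 : ℂ) 1, (primitive (fun z => D k z * e z) w).re ≤ 1 := by
  choose F hF hlt using exists_admissibleMultiplier_forall_mem_lt hC hD hLP hδ hsum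
  set U : Ultrafilter (Finset (ℕ × ball (0 : ℂ) 1)) := Ultrafilter.of atTop
  obtain ⟨e, he, hlim⟩ := AdmissibleMultiplier.exists_tendstoUniformlyOn U hF
  refine ⟨e, he, fun k w hw => ?_⟩
  have hcont : ∀ {e : ℂ → ℂ}, AdmissibleMultiplier C e → ContinuousOn
      (fun t : ℝ => D k (t * w) * e (t * w)) (Icc 0 1) := fun {e} he =>
    ((hD k).continuousOn.mul he.differentiableOn.continuousOn).comp
      (f := fun t : ℝ => (t : ℂ) * w) (by fun_prop) fun t ht => ofReal_mul_mem_ball hw ht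
  have hint : Tendsto (fun i => ∫ t in (0 : ℝ)..1, D k (t * w) * F i (t * w)) U
      (𝓝 (∫ t in (0 : ℝ)..1, D k (t * w) * e (t * w))) := by
    obtain ⟨M, hM⟩ := (isCompact_Icc (a := (0 : ℝ)) (b := 1)).exists_bound_of_continuousOn
      ((hD k).continuousOn.comp (f := fun t : ℝ => (t : ℂ) * w) (by fun_prop)
        fun t ht => ofReal_mul_mem_ball hw ht)
    have hM0 : 0 ≤ M := (norm_nonneg _).trans (hM 0 (by simp))
    rw [Metric.tendsto_nhds]
    intro ε hε
    filter_upwards [Metric.tendstoUniformlyOn_iff.1 (hlim ‖w‖ (mem_ball_zero_iff.1 hw))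
      (ε / (2 * (M + 1))) (by positivity)] with i hi
    rw [dist_eq_norm, ← intervalIntegral.integral_sub
      (ContinuousOn.intervalIntegrable (by rw [uIcc_of_le zero_le_one]; exact hcont (hF i)))
      (ContinuousOn.intervalIntegrable (by rw [uIcc_of_le zero_le_one]; exact hcont he))]
    refine (intervalIntegral.norm_integral_le_of_norm_le_const (C := ε / 2) fun t ht => ?_).trans_lt
      (by norm_num; linarith)
    rw [uIoc_of_le zero_le_one] at ht
    have ht' : t ∈ Icc (0 : ℝ) 1 := ⟨ht.1.le, ht.2⟩
    have h1 := hi ((t : ℂ) * w) (by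
      rw [mem_closedBall_zero_iff, norm_mul, Complex.norm_real, Real.norm_of_nonneg ht'.1]
      exact mul_le_of_le_one_left (norm_nonneg _) ht'.2)
    rw [dist_comm, dist_eq_norm] at h1
    rw [← mul_sub, norm_mul]
    calc _ ≤ M * (ε / (2 * (M + 1))) := mul_le_mul (hM t ht') h1.le (norm_nonneg _) hM0
      _ ≤ (M + 1) * (ε / (2 * (M + 1))) := by gcongr; linarith
      _ = ε / 2 := by field_simp
  refine le_of_tendsto ((Complex.continuous_re.tendsto _).comp (hint.const_mul w)) ?_
  filter_upwards [(Ultrafilter.of_le atTop) (eventually_ge_atTop {(k, ⟨w, hw⟩)})] with i hi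
  exact (hlt i (k, ⟨w, hw⟩) (hi (by simp))).le

end Minimax

lemma LPBound.sum_weight_le (N : ℕ) :
    ∑ n ∈ Finset.range N, (3 + n : ℝ) ^ 2 * (2 ^ n * (1 / 8) ^ (4 * (n / 4) + 5)) ≤ 1 / 2 := by
  have h1 : ∀ n : ℕ, (3 + n : ℝ) ^ 2 ≤ 9 * 2 ^ n := by
    intro n
    induction n with
    | zero => norm_num
    | succ n ih =>
      rw [pow_succ 2]
      push_cast
      have : (0 : ℝ) ≤ n := n.cast_nonneg
      nlinarith
  have h2 : ∀ n : ℕ, (3 + n : ℝ) ^ 2 * (2 ^ n * (1 / 8) ^ (4 * (n / 4) + 5)) ≤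
      (1 / 2) / 2 / 2 ^ n := by
    intro n
    have h3 : (1 / 8 : ℝ) ^ (4 * (n / 4) + 5) ≤ (1 / 8) ^ (n + 2) :=
      pow_le_pow_of_le_one (by norm_num) (by norm_num) (by omega)
    calc _ ≤ (9 * 2 ^ n) * (2 ^ n * (1 / 8 : ℝ) ^ (n + 2)) := by gcongr; exact h1 n
      _ = 9 / 64 / 2 ^ n := by
          have : (8 : ℝ) ^ n = 2 ^ n * 2 ^ n * 2 ^ n := by
            rw [← mul_pow, ← mul_pow]; norm_num
          rw [one_div, inv_pow, pow_add, this]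
          field_simp
          norm_num
      _ ≤ _ := div_le_div_of_nonneg_right (by norm_num) (by positivity)
  have h4 := (summable_geometric_two' (1 / 2 : ℝ)).sum_le_tsum (Finset.range N)
    (fun n _ => by positivity)
  rw [tsum_geometric_two'] at h4
  exact (Finset.sum_le_sum fun n _ => h2 n).trans h4

section NormLe
variable {D : ℕ → ℂ → ℂ} {C : ℕ → ℝ}

lemma exists_admissibleMultiplier_norm_primitive_le (hC : LogPowerBound C)
    (hD : ∀ k, DifferentiableOn ℂ (D k) (ball 0 1))
    (hLP : ∀ k, LPBound (D k) ((1 / 8) ^ (4 * k + 5))) :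
    ∃ e, AdmissibleMultiplier C e ∧
      ∀ k, ∀ w ∈ ball (0 : ℂ) 1, ‖primitive (fun z => D k z * e z) w‖ ≤ 2 / 2 ^ k := by
  obtain ⟨e, he, hle⟩ := exists_admissibleMultiplier_forall_le
    (D := fun n z => Complex.I ^ n * 2 ^ n * D (n / 4) z)
    (δ := fun n => 2 ^ n * (1 / 8) ^ (4 * (n / 4) + 5)) hC (fun n => (hD _).const_mul _)
    (fun n => by simpa using (hLP (n / 4)).const_mul (Complex.I ^ n * 2 ^ n))
    (fun n => by positivity) LPBound.sum_weight_le
  refine ⟨e, he, fun k w hw => ?_⟩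
  set x := primitive (fun z => D k z * e z) w with hx
  have key : ∀ j < 4, 2 ^ k * (Complex.I ^ j * x).re ≤ 1 := by
    intro j hj
    have h1 := hle (4 * k + j) w hw
    rw [show (4 * k + j) / 4 = k by omega] at h1
    have h2 : primitive (fun z => Complex.I ^ (4 * k + j) * 2 ^ (4 * k + j) * D k z * e z) w =
        ((2 ^ (4 * k + j) : ℝ) : ℂ) * (Complex.I ^ j * x) := by
      rw [hx, primitive, primitive]
      simp only [mul_assoc (Complex.I ^ (4 * k + j) * 2 ^ (4 * k + j))]
      rw [intervalIntegral.integral_const_mul, pow_add Complex.I, pow_mul, Complex.I_pow_four,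
        one_pow]
      push_cast
      ring
    rw [h2, Complex.re_ofReal_mul] at h1
    rcases le_total (Complex.I ^ j * x).re 0 with h | h
    · exact (mul_nonpos_of_nonneg_of_nonpos (by positivity) h).trans zero_le_one
    · refine le_trans (mul_le_mul_of_nonneg_right ?_ h) h1
      exact pow_le_pow_right₀ (by norm_num) (by omega)
  have k0 := key 0 (by norm_num)
  have k1 := key 1 (by norm_num)
  have k2 := key 2 (by norm_num)
  have k3 := key 3 (by norm_num)
  simp only [pow_zero, one_mul, pow_one, Complex.I_sq, Complex.I_pow_three, neg_mul,
    Complex.neg_re, Complex.I_mul_re, neg_neg, mul_neg] at k0 k1 k2 k3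
  refine (Complex.norm_le_abs_re_add_abs_im x).trans ?_
  rw [le_div_iff₀ (by positivity), add_mul]
  have h1 : |x.re| * 2 ^ k ≤ 1 := by
    rw [← abs_of_pos (show (0 : ℝ) < 2 ^ k by positivity), ← abs_mul, abs_le]; constructor <;> linarith
  have h2 : |x.im| * 2 ^ k ≤ 1 := by
    rw [← abs_of_pos (show (0 : ℝ) < 2 ^ k by positivity), ← abs_mul, abs_le]; constructor <;> linarith
  linarith

end NormLe

/-- The dilate `z ↦ f (r z)`. -/
def dilate (r : ℝ) (f : ℂ → ℂ) (z : ℂ) : ℂ := f (r * z)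

section Dilate
variable {M : ℝ}

lemma mul_mem_ball_of_mem_closedBall (h0 : 0 ≤ r) {z : ℂ}
    (hz : z ∈ closedBall (0 : ℂ) 1) : (r : ℂ) * z ∈ closedBall (0 : ℂ) r := by
  rw [mem_closedBall_zero_iff] at hz ⊢
  rw [norm_mul, Complex.norm_real, Real.norm_of_nonneg h0]
  exact mul_le_of_le_one_right h0 hz

lemma closedBall_subset_ball_one (h1 : r < 1) : closedBall (0 : ℂ) r ⊆ ball 0 1 :=
  closedBall_subset_ball h1

lemma hasDerivAt_dilate (hf : DifferentiableOn ℂ f (ball 0 1)) (h0 : 0 ≤ r) (h1 : r < 1) {z : ℂ}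
    (hz : z ∈ closedBall (0 : ℂ) 1) : HasDerivAt (dilate r f) (r * deriv f (r * z)) z := by
  have hm := closedBall_subset_ball_one h1 (mul_mem_ball_of_mem_closedBall h0 hz)
  have h2 : HasDerivAt (fun z : ℂ => (r : ℂ) * z) r z := by
    simpa using (hasDerivAt_id z).const_mul (r : ℂ)
  have h3 := ((hf.differentiableAt (isOpen_ball.mem_nhds hm)).hasDerivAt).comp z h2
  rw [mul_comm]
  exact h3

lemma differentiableOn_dilate (hf : DifferentiableOn ℂ f (ball 0 1)) (h0 : 0 ≤ r) (h1 : r < 1) :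
    DifferentiableOn ℂ (dilate r f) (ball 0 1) := fun _ hz =>
  (hasDerivAt_dilate hf h0 h1 (ball_subset_closedBall hz)).differentiableAt.differentiableWithinAt

lemma diffContOnCl_dilate (hf : DifferentiableOn ℂ f (ball 0 1)) (h0 : 0 ≤ r) (h1 : r < 1) :
    DiffContOnCl ℂ (dilate r f) (ball 0 1) := by
  refine ⟨differentiableOn_dilate hf h0 h1, fun z hz => ?_⟩
  rw [closure_ball 0 one_ne_zero] at hz
  exact (hasDerivAt_dilate hf h0 h1 hz).continuousAt.continuousWithinAt

lemma norm_dilate_le (hfM : ∀ z ∈ ball (0 : ℂ) 1, ‖f z‖ ≤ M) (h0 : 0 ≤ r) (h1 : r < 1) {z : ℂ}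
    (hz : z ∈ ball (0 : ℂ) 1) : ‖dilate r f z‖ ≤ M :=
  hfM _ (closedBall_subset_ball_one h1
    (mul_mem_ball_of_mem_closedBall h0 (ball_subset_closedBall hz)))

lemma exists_norm_deriv_dilate_le (hf : DifferentiableOn ℂ f (ball 0 1)) (h0 : 0 ≤ r)
    (h1 : r < 1) : ∃ K, ∀ z ∈ ball (0 : ℂ) 1, ‖deriv (dilate r f) z‖ ≤ K := by
  obtain ⟨K, hK⟩ := (isCompact_closedBall (0 : ℂ) r).exists_bound_of_continuousOn
    (hf.continuousOn_deriv_ball.mono (closedBall_subset_ball_one h1))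
  refine ⟨K, fun z hz => ?_⟩
  have hz' := ball_subset_closedBall hz
  rw [(hasDerivAt_dilate hf h0 h1 hz').deriv, norm_mul, Complex.norm_real, Real.norm_of_nonneg h0]
  exact (mul_le_of_le_one_left (norm_nonneg _) h1.le).trans
    (hK _ (mul_mem_ball_of_mem_closedBall h0 hz'))

lemma circleAverage_norm_sq_le_of_norm_le (hf : ContinuousOn f (ball 0 1))
    (hfM : ∀ z ∈ ball (0 : ℂ) 1, ‖f z‖ ≤ M) (h0 : 0 ≤ r) (h1 : r < 1) :
    circleAverage (fun z => ‖f z‖ ^ 2) 0 r ≤ M ^ 2 := by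
  refine (circleAverage_mono_of_ball (hf.norm.pow 2) continuousOn_const (fun z hz =>
    pow_le_pow_left₀ (norm_nonneg _) (hfM z hz) 2) h0 h1).trans ?_
  rw [Real.circleAverage_const]

lemma hasSum_circleAverage_dilate_sub (hf : DifferentiableOn ℂ f (ball 0 1)) {s : ℝ}
    (hr : 0 ≤ r) (hrs : r ≤ s) (hs0 : 0 < s) (hs : s < 1) :
    HasSum (fun n => ‖taylorCoef f n‖ ^ 2 * (s ^ n - r ^ n) ^ 2)
      (circleAverage (fun z => ‖dilate s f z - dilate r f z‖ ^ 2) 0 1) := by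
  have h1 : HasDiscSeries (fun n => taylorCoef f n * (1 - ((r / s : ℝ) : ℂ) ^ n))
      (fun z => f z - f ((r / s : ℝ) * z)) := by
    intro z hz
    have hrs1 : r / s ∈ Icc (0 : ℝ) 1 := ⟨by positivity, (div_le_one hs0).2 hrs⟩
    have h2 := (hf.hasDiscSeries z hz).sub (hf.hasDiscSeries _ (ofReal_mul_mem_ball hz hrs1))
    refine h2.congr_fun fun n => ?_
    rw [mul_pow]; ring
  have h2 := h1.hasSum_circleAverage_norm_sq hs0.le hs
  have h3 : circleAverage (fun z => ‖dilate s f z - dilate r f z‖ ^ 2) 0 1 =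
      circleAverage (fun z => ‖f z - f ((r / s : ℝ) * z)‖ ^ 2) 0 s := by
    have := circleAverage_dilate (fun z => ‖f z - f ((r / s : ℝ) * z)‖ ^ 2) s 1
    rw [mul_one] at this
    rw [← this]
    congr 1
    funext z
    rw [dilate, dilate, ← mul_assoc, ← Complex.ofReal_mul, div_mul_cancel₀ _ hs0.ne']
  rw [h3]
  refine h2.congr_fun fun n => ?_
  have h4 : s ^ n - r ^ n = (1 - (r / s) ^ n) * s ^ n := by
    rw [div_pow, sub_mul, one_mul, div_mul_cancel₀ _ (pow_ne_zero n hs0.ne')]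
  rw [norm_mul, mul_pow, ← Complex.ofReal_pow, ← Complex.ofReal_one,
    ← Complex.ofReal_sub, Complex.norm_real, Real.norm_eq_abs, sq_abs, h4]
  ring

/-- Dilates of a bounded analytic function are uniformly Cauchy in `L²` of the circle. -/
lemma eventually_circleAverage_dilate_sub_le (hf : DifferentiableOn ℂ f (ball 0 1))
    (hfM : ∀ z ∈ ball (0 : ℂ) 1, ‖f z‖ ≤ M) {ε : ℝ} (hε : 0 < ε) :
    ∀ᶠ x in 𝓝[<] (1 : ℝ), ∀ r s, x ≤ r → r ≤ s → s < 1 →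
      circleAverage (fun z => ‖dilate s f z - dilate r f z‖ ^ 2) 0 1 ≤ ε := by
  have hsum : Summable fun n => ‖taylorCoef f n‖ ^ 2 :=
    summable_of_sum_le (fun n => by positivity) fun u =>
      hf.hasDiscSeries.sum_norm_sq_le (fun r h0 h1 =>
        circleAverage_norm_sq_le_of_norm_le hf.continuousOn hfM h0.le h1) u
  have hdom : ∀ x ∈ Ioo (0 : ℝ) 1, ∀ n,
      ‖‖taylorCoef f n‖ ^ 2 * (1 - x ^ n) ^ 2‖ ≤ ‖taylorCoef f n‖ ^ 2 := by
    intro x hx n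
    rw [Real.norm_of_nonneg (by positivity)]
    have h1 : x ^ n ≤ 1 := pow_le_one₀ hx.1.le hx.2.le
    have h2 : 0 ≤ x ^ n := pow_nonneg hx.1.le n
    exact mul_le_of_le_one_right (by positivity) (pow_le_one₀ (by linarith) (by linarith))
  have hlim : Tendsto (fun x : ℝ => ∑' n, ‖taylorCoef f n‖ ^ 2 * (1 - x ^ n) ^ 2) (𝓝[<] 1)
      (𝓝 (∑' _ : ℕ, (0 : ℝ))) := by
    refine tendsto_tsum_of_dominated_convergence hsum (fun n => ?_) ?_
    · have : Continuous fun x : ℝ => ‖taylorCoef f n‖ ^ 2 * (1 - x ^ n) ^ 2 := by fun_prop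
      have := (this.tendsto 1).mono_left (nhdsWithin_le_nhds (s := Iio 1))
      simpa using this
    · filter_upwards [Ioo_mem_nhdsLT (zero_lt_one (α := ℝ))] with x hx n using hdom x hx n
  rw [tsum_zero] at hlim
  filter_upwards [hlim.eventually (gt_mem_nhds hε), Ioo_mem_nhdsLT (zero_lt_one (α := ℝ))]
    with x hx hx01 r s hxr hrs hs
  have hr0 := hx01.1.trans_le hxr
  rw [← (hasSum_circleAverage_dilate_sub hf hr0.le hrs (hr0.trans_le hrs) hs).tsum_eq]
  refine le_trans (Summable.tsum_le_tsum (fun n => ?_)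
    (hasSum_circleAverage_dilate_sub hf hr0.le hrs (hr0.trans_le hrs) hs).summable
    (.of_norm_bounded hsum (hdom x hx01))) hx.le
  have h1 : s ^ n ≤ 1 := pow_le_one₀ (hr0.le.trans hrs) hs.le
  have h2 : x ^ n ≤ r ^ n := pow_le_pow_left₀ hx01.1.le hxr n
  have h3 : r ^ n ≤ s ^ n := pow_le_pow_left₀ hr0.le hrs n
  have h4 : (s ^ n - r ^ n) ^ 2 ≤ (1 - x ^ n) ^ 2 :=
    pow_le_pow_left₀ (by linarith) (by linarith) 2
  gcongr

end Dilate

section Difference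
variable {Θ b₀ b₁ k₀ k₁ : ℂ → ℂ} {M δ : ℝ}

lemma lpBound_mul_deriv_sub (hM : 0 < M) (hδ : 0 < δ)
    (hΘ : DifferentiableOn ℂ Θ (ball 0 1)) (hb₀ : DifferentiableOn ℂ b₀ (ball 0 1))
    (hb₁ : DifferentiableOn ℂ b₁ (ball 0 1)) (hk₀ : DifferentiableOn ℂ k₀ (ball 0 1))
    (hk₁ : DifferentiableOn ℂ k₁ (ball 0 1)) (hΘ1 : ∀ z ∈ ball (0 : ℂ) 1, ‖Θ z‖ ≤ 1)
    (hb₀M : ∀ z ∈ ball (0 : ℂ) 1, ‖b₀ z‖ ≤ M) (hk₁M : ∀ z ∈ ball (0 : ℂ) 1, ‖k₁ z‖ ≤ M)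
    (hbδ : ∀ z ∈ ball (0 : ℂ) 1, ‖(b₁ z - b₀ z) * Θ z‖ ≤ δ)
    (hkδ : ∀ z ∈ ball (0 : ℂ) 1, ‖(k₁ z - k₀ z) * Θ z‖ ≤ δ) :
    LPBound (fun z => (b₁ z * deriv k₁ z - b₀ z * deriv k₀ z) * Θ z ^ 2) (8 * M * δ) := by
  have hc : DifferentiableOn ℂ (fun z => (k₁ z - k₀ z) * Θ z ^ 2) (ball 0 1) :=
    (hk₁.sub hk₀).mul (hΘ.pow 2)
  have hd₁ : DifferentiableOn ℂ (fun z => (b₁ z - b₀ z) * Θ z ^ 2) (ball 0 1) :=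
    (hb₁.sub hb₀).mul (hΘ.pow 2)
  have hd₃ : DifferentiableOn ℂ (fun z => -2 * (b₀ z * ((k₁ z - k₀ z) * Θ z))) (ball 0 1) :=
    (hb₀.mul ((hk₁.sub hk₀).mul hΘ)).const_mul _
  have hsmall : ∀ {x y : ℂ}, ‖x * y‖ ≤ δ → ‖y‖ ≤ 1 → ‖x * y ^ 2‖ ≤ δ := by
    intro x y h1 h2
    rw [sq, ← mul_assoc, norm_mul]
    exact (mul_le_of_le_one_right (norm_nonneg _) h2).trans h1
  have h₁ := lpBound_mul_deriv (b := fun z => (b₁ z - b₀ z) * Θ z ^ 2) hδ.le hM hd₁.continuousOn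
    (fun z hz => hsmall (hbδ z hz) (hΘ1 z hz)) hk₁ hk₁M
  have h₂ := lpBound_mul_deriv hM.le hδ hb₀.continuousOn hb₀M hc
    (fun z hz => hsmall (hkδ z hz) (hΘ1 z hz))
  have h₃ := lpBound_mul_deriv (b := fun z => -2 * (b₀ z * ((k₁ z - k₀ z) * Θ z)))
    (β := 2 * (M * δ)) (by positivity) one_pos hd₃.continuousOn (fun z hz => by
      rw [norm_mul, norm_neg, Complex.norm_ofNat, norm_mul]
      have := hb₀M z hz
      have := hkδ z hz
      gcongr) hΘ hΘ1
  have hc₁ : ContinuousOn (fun z => (b₁ z - b₀ z) * Θ z ^ 2 * deriv k₁ z) (ball 0 1) :=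
    hd₁.continuousOn.mul hk₁.continuousOn_deriv_ball
  have hc₂ : ContinuousOn (fun z => b₀ z * deriv (fun z => (k₁ z - k₀ z) * Θ z ^ 2) z)
      (ball 0 1) := hb₀.continuousOn.mul hc.continuousOn_deriv_ball
  have hc₃ : ContinuousOn (fun z => -2 * (b₀ z * ((k₁ z - k₀ z) * Θ z)) * deriv Θ z)
      (ball 0 1) := hd₃.continuousOn.mul hΘ.continuousOn_deriv_ball
  refine (((h₁.add h₂ hc₁ hc₂).add h₃ (hc₁.add hc₂) hc₃).of_norm_le ?_ ((hc₁.add hc₂).add hc₃)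
    fun z hz => ?_).mono (le_of_eq (by ring))
  · exact ((hb₁.continuousOn.mul hk₁.continuousOn_deriv_ball).sub
      (hb₀.continuousOn.mul hk₀.continuousOn_deriv_ball)).mul (hΘ.continuousOn.pow 2)
  · have hat : ∀ {φ : ℂ → ℂ}, DifferentiableOn ℂ φ (ball 0 1) → HasDerivAt φ (deriv φ z) z :=
      fun h => (h.differentiableAt (isOpen_ball.mem_nhds hz)).hasDerivAt
    have hder : deriv (fun z => (k₁ z - k₀ z) * Θ z ^ 2) z =
        (deriv k₁ z - deriv k₀ z) * Θ z ^ 2 + (k₁ z - k₀ z) * (2 * Θ z * deriv Θ z) := by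
      refine HasDerivAt.deriv ?_
      refine (((hat hk₁).sub (hat hk₀)).mul ((hat hΘ).pow 2)).congr_deriv ?_
      simp
    rw [hder]
    refine le_of_eq (congrArg _ ?_)
    ring

/-- A function dominated by an exponentially weighted majorant is small after division by the
logarithm of the majorant. -/
lemma norm_mul_inv_four_add_log_le {d x : ℂ} (hδ : 0 < δ) (hd : ‖d‖ ≤ 2 * M)
    (hx : 1 ≤ x.re) (h : Real.exp (2 * M / δ) / δ ^ 2 * ‖d‖ ^ 2 ≤ x.re) :
    ‖d * (4 + Complex.log x)⁻¹‖ ≤ δ := by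
  rw [norm_mul]
  rcases le_total ‖d‖ δ with hd1 | hd1
  · refine (mul_le_of_le_one_right (norm_nonneg _) ?_).trans hd1
    linarith [norm_inv_four_add_log_le hx]
  · have h1 : Real.exp (2 * M / δ) ≤ ‖x‖ := by
      refine le_trans ?_ (h.trans (Complex.re_le_norm x))
      rw [div_mul_eq_mul_div, le_div_iff₀ (by positivity)]
      gcongr
    have h2 : 2 * M / δ ≤ Real.log ‖x‖ := by
      rw [← Real.log_exp (2 * M / δ)]
      exact Real.log_le_log (Real.exp_pos _) h1
    have h3 := four_add_log_norm_le (x := x)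
    have h4 := four_le_norm_four_add_log hx
    rw [norm_inv, ← div_eq_mul_inv, div_le_iff₀ (by linarith)]
    rw [div_le_iff₀ hδ] at h2
    nlinarith

end Difference

lemma OneLeRe.sum {ι : Type*} [Fintype ι] [Nonempty ι] {U : ι → ℂ → ℂ}
    (hU : ∀ i, OneLeRe (U i)) : OneLeRe (fun z => ∑ i, U i z) where
  differentiableOn := DifferentiableOn.fun_sum fun i _ => (hU i).differentiableOn
  im_zero := by rw [Complex.im_sum]; exact Finset.sum_eq_zero fun i _ => (hU i).im_zero
  one_le_re z hz := by
    rw [Complex.re_sum]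
    obtain ⟨i⟩ := ‹Nonempty ι›
    exact ((hU i).one_le_re z hz).trans (Finset.single_le_sum (f := fun i => (U i z).re)
      (fun j _ => zero_le_one.trans ((hU j).one_le_re z hz)) (Finset.mem_univ i))

section Family
variable {ι : Type*} [Fintype ι] {φ : ι → ℂ → ℂ} {M : ℝ}

/-- Radii along which the dilates of finitely many bounded analytic functions converge in `L²` at a
prescribed rate. -/
lemma exists_radii (hφ : ∀ i, DifferentiableOn ℂ (φ i) (ball 0 1))
    (hφM : ∀ i, ∀ z ∈ ball (0 : ℂ) 1, ‖φ i z‖ ≤ M) {ε : ℕ → ℝ} (hε : ∀ n, 0 < ε n) :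
    ∃ r : ℕ → ℝ, (∀ n, 0 ≤ r n) ∧ (∀ n, r n < 1) ∧ Tendsto r atTop (𝓝 1) ∧
      ∀ n i, circleAverage (fun z => ‖dilate (r (n + 1)) (φ i) z - dilate (r n) (φ i) z‖ ^ 2) 0 1
        ≤ ε n := by
  obtain ⟨u, hu, hu1, hlim⟩ := exists_seq_strictMono_tendsto' (zero_lt_one (α := ℝ))
  have hlim' : Tendsto u atTop (𝓝[<] 1) :=
    tendsto_nhdsWithin_iff.2 ⟨hlim, .of_forall fun n => (hu1 n).2⟩
  obtain ⟨σ, hσ, h⟩ := extraction_forall_of_eventually fun n => hlim'.eventually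
    (eventually_all.2 fun i => eventually_circleAverage_dilate_sub_le (hφ i) (hφM i) (hε n))
  exact ⟨u ∘ σ, fun n => (hu1 _).1.le, fun n => (hu1 _).2, hlim.comp hσ.tendsto_atTop,
    fun n i => h n i _ _ le_rfl (hu.monotone (hσ.monotone n.le_succ)) (hu1 _).2⟩

/-- After multiplication by the reciprocal of a logarithm of a majorant, dilates of finitely many
bounded analytic functions converge uniformly at a prescribed rate. -/
lemma exists_radii_majorant [Nonempty ι] (hφ : ∀ i, DifferentiableOn ℂ (φ i) (ball 0 1))
    (hφM : ∀ i, ∀ z ∈ ball (0 : ℂ) 1, ‖φ i z‖ ≤ M) {δ : ℕ → ℝ} (hδ : ∀ n, 0 < δ n) :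
    ∃ (r : ℕ → ℝ) (V : ℂ → ℂ), (∀ n, 0 ≤ r n) ∧ (∀ n, r n < 1) ∧ Tendsto r atTop (𝓝 1) ∧
      OneLeRe V ∧ ∀ n i, ∀ z ∈ ball (0 : ℂ) 1,
        ‖(dilate (r (n + 1)) (φ i) z - dilate (r n) (φ i) z) * (4 + Complex.log (V z))⁻¹‖
          ≤ δ n := by
  set A : ℕ → ℝ := fun n => Real.exp (2 * M / δ n) / δ n ^ 2 with hA
  have hApos : ∀ n, 0 < A n := fun n => div_pos (Real.exp_pos _) (pow_pos (hδ n) 2)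
  obtain ⟨r, h0, h1, hlim, hr⟩ := exists_radii hφ hφM (ε := fun n => (1 / 2) ^ n / A n)
    fun n => div_pos (by positivity) (hApos n)
  have hmaj := fun i => exists_majorant_of_summable
    (φ := fun n z => dilate (r (n + 1)) (φ i) z - dilate (r n) (φ i) z)
    (fun n => (diffContOnCl_dilate (hφ i) (h0 _) (h1 _)).sub
      (diffContOnCl_dilate (hφ i) (h0 _) (h1 _))) (A := A) (fun n => (hApos n).le)
    summable_geometric_two fun n => by
      have := hr n i
      rwa [le_div_iff₀ (hApos n), mul_comm] at this
  choose U hU hle using hmaj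
  refine ⟨r, fun z => ∑ i, U i z, h0, h1, hlim, OneLeRe.sum hU, fun n i z hz => ?_⟩
  refine norm_mul_inv_four_add_log_le (M := M) (hδ n) ?_ ((OneLeRe.sum hU).one_le_re z hz) ?_
  · refine (norm_sub_le _ _).trans ?_
    linarith [norm_dilate_le (hφM i) (h0 n) (h1 n) hz,
      norm_dilate_le (hφM i) (h0 (n + 1)) (h1 (n + 1)) hz]
  · refine (hle i z hz n).trans ?_
    rw [Complex.re_sum]
    exact Finset.single_le_sum (f := fun i => (U i z).re)
      (fun j _ => zero_le_one.trans ((hU j).one_le_re z hz)) (Finset.mem_univ i)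

end Family

lemma tendsto_primitive {F : ℕ → ℂ → ℂ} (hF : ∀ n, ContinuousOn (F n) (ball 0 1))
    (hbound : ∀ s < 1, ∃ K, ∀ n, ∀ z ∈ closedBall (0 : ℂ) s, ‖F n z‖ ≤ K)
    (hlim : ∀ z ∈ ball (0 : ℂ) 1, Tendsto (fun n => F n z) atTop (𝓝 (f z))) {w : ℂ}
    (hw : w ∈ ball (0 : ℂ) 1) :
    Tendsto (fun n => primitive (F n) w) atTop (𝓝 (primitive f w)) := by
  obtain ⟨K, hK⟩ := hbound ‖w‖ (mem_ball_zero_iff.1 hw)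
  refine Tendsto.const_mul w ?_
  refine intervalIntegral.tendsto_integral_filter_of_dominated_convergence (fun _ => K)
    (.of_forall fun n => ?_) (.of_forall fun n => .of_forall fun t ht => ?_)
    intervalIntegrable_const (.of_forall fun t ht => ?_)
  · rw [uIoc_of_le zero_le_one]
    refine (ContinuousOn.mono ?_ Ioc_subset_Icc_self).aestronglyMeasurable measurableSet_Ioc
    exact (hF n).comp (f := fun t : ℝ => (t : ℂ) * w) (by fun_prop)
      fun t ht => ofReal_mul_mem_ball hw ht
  · rw [uIoc_of_le zero_le_one] at ht
    refine hK n _ ?_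
    rw [mem_closedBall_zero_iff, norm_mul, Complex.norm_real, Real.norm_of_nonneg ht.1.le]
    exact mul_le_of_le_one_left (norm_nonneg _) ht.2
  · rw [uIoc_of_le zero_le_one] at ht
    exact hlim _ (ofReal_mul_mem_ball hw ⟨ht.1.le, ht.2⟩)

lemma primitive_sub (hf : ContinuousOn f (ball 0 1)) (hg : ContinuousOn g (ball 0 1)) {w : ℂ}
    (hw : w ∈ ball (0 : ℂ) 1) :
    primitive (fun z => f z - g z) w = primitive f w - primitive g w := by
  have hint : ∀ {f : ℂ → ℂ}, ContinuousOn f (ball 0 1) → IntervalIntegrable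
      (fun t : ℝ => f (t * w)) volume 0 1 := fun hf' => by
    refine ContinuousOn.intervalIntegrable ?_
    rw [uIcc_of_le zero_le_one]
    exact hf'.comp (f := fun t : ℝ => (t : ℂ) * w) (by fun_prop)
      fun t ht => ofReal_mul_mem_ball hw ht
  simp only [primitive]
  rw [intervalIntegral.integral_sub (hint hf) (hint hg), mul_sub]

lemma uniformContinuousOn_primitive (hf : DifferentiableOn ℂ f (ball 0 1)) {K : ℝ}
    (hK : ∀ z ∈ ball (0 : ℂ) 1, ‖f z‖ ≤ K) : UniformContinuousOn (primitive f) (ball 0 1) := by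
  have h := (convex_ball (0 : ℂ) 1).lipschitzOnWith_of_nnnorm_hasDerivWithin_le (C := K.toNNReal)
    (fun z hz => (hasDerivAt_primitive hf hz).hasDerivWithinAt) (fun z hz => by
      rw [← NNReal.coe_le_coe, coe_nnnorm, Real.coe_toNNReal']
      exact (hK z hz).trans (le_max_left _ _))
  exact h.uniformContinuousOn

lemma exists_norm_dilate_mul_deriv_le {M : ℝ}
    (hfM : ∀ z ∈ ball (0 : ℂ) 1, ‖f z‖ ≤ M) (hg : DifferentiableOn ℂ g (ball 0 1))
    {s : ℝ} (hs : s < 1) : ∃ K, ∀ r, 0 ≤ r → r < 1 → ∀ z ∈ closedBall (0 : ℂ) s,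
      ‖dilate r f z * deriv (dilate r g) z‖ ≤ K := by
  obtain ⟨K, hK⟩ := (isCompact_closedBall (0 : ℂ) s).exists_bound_of_continuousOn
    (hg.continuousOn_deriv_ball.mono (closedBall_subset_ball_one hs))
  refine ⟨M * K, fun r h0 h1 z hz => ?_⟩
  have hz1 := closedBall_subset_ball_one hs hz
  have hrz : (r : ℂ) * z ∈ closedBall (0 : ℂ) s := by
    rw [mem_closedBall_zero_iff] at hz ⊢
    rw [norm_mul, Complex.norm_real, Real.norm_of_nonneg h0]
    exact (mul_le_of_le_one_left (norm_nonneg _) h1.le).trans hz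
  have hM : 0 ≤ M := (norm_nonneg _).trans (hfM 0 (by simp))
  rw [norm_mul, (hasDerivAt_dilate hg h0 h1 (ball_subset_closedBall hz1)).deriv, norm_mul,
    Complex.norm_real, Real.norm_of_nonneg h0]
  exact mul_le_mul (norm_dilate_le hfM h0 h1 hz1)
    ((mul_le_of_le_one_left (norm_nonneg _) h1.le).trans (hK _ hrz)) (by positivity) hM

lemma tendsto_dilate_mul_deriv (hf : DifferentiableOn ℂ f (ball 0 1))
    (hg : DifferentiableOn ℂ g (ball 0 1)) {r : ℕ → ℝ} (h0 : ∀ n, 0 ≤ r n) (h1 : ∀ n, r n < 1)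
    (hr : Tendsto r atTop (𝓝 1)) {z : ℂ} (hz : z ∈ ball (0 : ℂ) 1) :
    Tendsto (fun n => dilate (r n) f z * deriv (dilate (r n) g) z) atTop
      (𝓝 (f z * deriv g z)) := by
  have hrc : Tendsto (fun n => (r n : ℂ)) atTop (𝓝 1) :=
    (Complex.continuous_ofReal.tendsto' 1 1 (by simp)).comp hr
  have hrz : Tendsto (fun n => (r n : ℂ) * z) atTop (𝓝 z) := by
    simpa using hrc.mul_const z
  have hnhds := isOpen_ball.mem_nhds hz
  have h2 := ((hf.continuousOn.continuousAt hnhds).tendsto.comp hrz).mul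
    (hrc.mul ((hg.continuousOn_deriv_ball.continuousAt hnhds).tendsto.comp hrz))
  rw [one_mul] at h2
  refine h2.congr fun n => ?_
  rw [(hasDerivAt_dilate hg (h0 n) (h1 n) (ball_subset_closedBall hz)).deriv]
  rfl

theorem exists_uniformContinuousOn_primitive {C : ℕ → ℝ} (hC : LogPowerBound C)
    {B₁ K₁ B₂ K₂ : ℂ → ℂ} {M : ℝ} (hM : 0 < M)
    (hB₁ : DifferentiableOn ℂ B₁ (ball 0 1)) (hB₁M : ∀ z ∈ ball (0 : ℂ) 1, ‖B₁ z‖ ≤ M)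
    (hK₁ : DifferentiableOn ℂ K₁ (ball 0 1)) (hK₁M : ∀ z ∈ ball (0 : ℂ) 1, ‖K₁ z‖ ≤ M)
    (hB₂ : DifferentiableOn ℂ B₂ (ball 0 1)) (hB₂M : ∀ z ∈ ball (0 : ℂ) 1, ‖B₂ z‖ ≤ M)
    (hK₂ : DifferentiableOn ℂ K₂ (ball 0 1)) (hK₂M : ∀ z ∈ ball (0 : ℂ) 1, ‖K₂ z‖ ≤ M) :
    ∃ V e, OneLeRe V ∧ AdmissibleMultiplier C e ∧ UniformContinuousOn
      (primitive fun z => (B₁ z * deriv K₁ z + B₂ z * deriv K₂ z) *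
        ((4 + Complex.log (V z))⁻¹) ^ 2 * e z) (ball 0 1) := by
  obtain ⟨r, V, h0, h1, hlim, hV, hsmall⟩ := exists_radii_majorant (φ := ![B₁, K₁, B₂, K₂])
    (M := M) (δ := fun n => (1 / 8) ^ (4 * n + 5) / (16 * M))
    (by intro i; fin_cases i <;> assumption) (by intro i; fin_cases i <;> assumption)
    (fun n => by positivity)
  set Θ : ℂ → ℂ := fun z => (4 + Complex.log (V z))⁻¹ with hΘdef
  have hΘ : DifferentiableOn ℂ Θ (ball 0 1) := hV.differentiableOn_inv_four_add_log
  have hΘ1 : ∀ z ∈ ball (0 : ℂ) 1, ‖Θ z‖ ≤ 1 := fun z hz =>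
    (norm_inv_four_add_log_le (hV.one_le_re z hz)).trans (by norm_num)
  have hdil : ∀ {f : ℂ → ℂ} n, DifferentiableOn ℂ f (ball 0 1) →
      DifferentiableOn ℂ (dilate (r n) f) (ball 0 1) := fun n h =>
    differentiableOn_dilate h (h0 n) (h1 n)
  set τ : ℕ → ℂ → ℂ := fun n z => dilate (r n) B₁ z * deriv (dilate (r n) K₁) z +
    dilate (r n) B₂ z * deriv (dilate (r n) K₂) z with hτdef
  have hτ : ∀ n, DifferentiableOn ℂ (τ n) (ball 0 1) := fun n =>
    ((hdil n hB₁).mul ((hdil n hK₁).deriv isOpen_ball)).add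
      ((hdil n hB₂).mul ((hdil n hK₂).deriv isOpen_ball))
  have hLP : ∀ n, LPBound (fun z => (τ (n + 1) z - τ n z) * Θ z ^ 2) ((1 / 8) ^ (4 * n + 5)) := by
    intro n
    have hδ : (0 : ℝ) < (1 / 8) ^ (4 * n + 5) / (16 * M) := by positivity
    have l₁ := lpBound_mul_deriv_sub hM hδ hΘ (hdil n hB₁) (hdil (n + 1) hB₁) (hdil n hK₁)
      (hdil (n + 1) hK₁) hΘ1 (fun z hz => norm_dilate_le hB₁M (h0 n) (h1 n) hz)
      (fun z hz => norm_dilate_le hK₁M (h0 _) (h1 _) hz) (fun z hz => hsmall n 0 z hz)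
      (fun z hz => hsmall n 1 z hz)
    have l₂ := lpBound_mul_deriv_sub hM hδ hΘ (hdil n hB₂) (hdil (n + 1) hB₂) (hdil n hK₂)
      (hdil (n + 1) hK₂) hΘ1 (fun z hz => norm_dilate_le hB₂M (h0 n) (h1 n) hz)
      (fun z hz => norm_dilate_le hK₂M (h0 _) (h1 _) hz) (fun z hz => hsmall n 2 z hz)
      (fun z hz => hsmall n 3 z hz)
    have hcont : ∀ {B K : ℂ → ℂ}, DifferentiableOn ℂ B (ball 0 1) →
        DifferentiableOn ℂ K (ball 0 1) → ContinuousOn (fun z =>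
          (dilate (r (n + 1)) B z * deriv (dilate (r (n + 1)) K) z -
            dilate (r n) B z * deriv (dilate (r n) K) z) * Θ z ^ 2) (ball 0 1) := fun hB hK =>
      (((hdil _ hB).continuousOn.mul (hdil _ hK).continuousOn_deriv_ball).sub
        ((hdil _ hB).continuousOn.mul (hdil _ hK).continuousOn_deriv_ball)).mul
        (hΘ.continuousOn.pow 2)
    have h := l₁.add l₂ (hcont hB₁ hK₁) (hcont hB₂ hK₂)
    have he : (fun z => (τ (n + 1) z - τ n z) * Θ z ^ 2) = fun z =>
        (dilate (r (n + 1)) B₁ z * deriv (dilate (r (n + 1)) K₁) z -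
          dilate (r n) B₁ z * deriv (dilate (r n) K₁) z) * Θ z ^ 2 +
        (dilate (r (n + 1)) B₂ z * deriv (dilate (r (n + 1)) K₂) z -
          dilate (r n) B₂ z * deriv (dilate (r n) K₂) z) * Θ z ^ 2 := by
      funext z; simp only [hτdef]; ring
    rw [he]
    refine h.mono (le_of_eq ?_)
    field_simp
    norm_num
  obtain ⟨e, he, hle⟩ := exists_admissibleMultiplier_norm_primitive_le hC
    (fun n => ((hτ (n + 1)).sub (hτ n)).mul (hΘ.pow 2)) hLP
  refine ⟨V, e, hV, he, ?_⟩
  set F : ℕ → ℂ → ℂ := fun n z => τ n z * Θ z ^ 2 * e z with hFdef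
  have hF : ∀ n, DifferentiableOn ℂ (F n) (ball 0 1) := fun n =>
    ((hτ n).mul (hΘ.pow 2)).mul he.differentiableOn
  have hFτ : ∀ n, ∀ z ∈ ball (0 : ℂ) 1, ‖F n z‖ ≤ ‖τ n z‖ := by
    intro n z hz
    rw [hFdef, norm_mul, norm_mul, norm_pow]
    have h1 := pow_le_one₀ (n := 2) (norm_nonneg _) (hΘ1 z hz)
    have h2 := he.norm_le_one z hz
    rw [mul_assoc]
    exact mul_le_of_le_one_right (norm_nonneg _) (mul_le_one₀ h1 (norm_nonneg _) h2)
  have hlimF : ∀ z ∈ ball (0 : ℂ) 1, Tendsto (fun n => F n z) atTop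
      (𝓝 ((B₁ z * deriv K₁ z + B₂ z * deriv K₂ z) * Θ z ^ 2 * e z)) := fun z hz =>
    (((tendsto_dilate_mul_deriv hB₁ hK₁ h0 h1 hlim hz).add
      (tendsto_dilate_mul_deriv hB₂ hK₂ h0 h1 hlim hz)).mul_const _).mul_const _
  have hbound : ∀ s < 1, ∃ K, ∀ n, ∀ z ∈ closedBall (0 : ℂ) s, ‖F n z‖ ≤ K := by
    intro s hs
    obtain ⟨c₁, hc₁⟩ := exists_norm_dilate_mul_deriv_le hB₁M hK₁ hs
    obtain ⟨c₂, hc₂⟩ := exists_norm_dilate_mul_deriv_le hB₂M hK₂ hs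
    refine ⟨c₁ + c₂, fun n z hz => (hFτ n z (closedBall_subset_ball_one hs hz)).trans ?_⟩
    exact norm_add_le_of_le (hc₁ _ (h0 n) (h1 n) z hz) (hc₂ _ (h0 n) (h1 n) z hz)
  have hdist : ∀ n, ∀ w ∈ ball (0 : ℂ) 1,
      dist (primitive (F n) w) (primitive (F (n + 1)) w) ≤ 4 / 2 / 2 ^ n := by
    intro n w hw
    rw [dist_comm, dist_eq_norm, ← primitive_sub (hF _).continuousOn (hF _).continuousOn hw]
    have : (fun z => F (n + 1) z - F n z) =
        fun z => (τ (n + 1) z - τ n z) * Θ z ^ 2 * e z := by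
      funext z; simp only [hFdef]; ring
    rw [this]
    refine (hle n w hw).trans (le_of_eq ?_)
    norm_num
  refine TendstoUniformlyOn.uniformContinuousOn (F := fun n => primitive (F n)) (p := atTop) ?_
    (Frequently.of_forall fun n => ?_)
  · rw [Metric.tendstoUniformlyOn_iff]
    intro ε hε
    have h4 : Tendsto (fun n : ℕ => (4 : ℝ) / 2 ^ n) atTop (𝓝 0) :=
      tendsto_const_nhds.div_atTop (tendsto_pow_atTop_atTop_of_one_lt one_lt_two)
    filter_upwards [h4.eventually (gt_mem_nhds hε)] with n hn w hw
    rw [dist_comm]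
    exact (dist_le_of_le_geometric_two_of_tendsto (fun n => hdist n w hw)
      (tendsto_primitive (fun n => (hF n).continuousOn) hbound hlimF hw) n).trans_lt hn
  · obtain ⟨c₁, hc₁⟩ := exists_norm_deriv_dilate_le hK₁ (h0 n) (h1 n)
    obtain ⟨c₂, hc₂⟩ := exists_norm_deriv_dilate_le hK₂ (h0 n) (h1 n)
    refine uniformContinuousOn_primitive (hF n) (K := M * c₁ + M * c₂) fun z hz =>
      (hFτ n z hz).trans (norm_add_le_of_le ?_ ?_)
    · rw [norm_mul]
      exact mul_le_mul (norm_dilate_le hB₁M (h0 n) (h1 n) hz) (hc₁ z hz) (norm_nonneg _) hM.le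
    · rw [norm_mul]
      exact mul_le_mul (norm_dilate_le hB₂M (h0 n) (h1 n) hz) (hc₂ z hz) (norm_nonneg _) hM.le

lemma norm_circlePt (θ : ℝ) : ‖circlePt θ‖ = 1 := Complex.norm_exp_ofReal_mul_I θ

lemma continuous_circlePt : Continuous circlePt := by
  unfold circlePt; fun_prop

lemma conj_circlePt (θ : ℝ) : conj (circlePt θ) = (circlePt θ)⁻¹ := by
  rw [Complex.inv_def, Complex.normSq_eq_norm_sq, norm_circlePt]; simp

lemma circlePt_add_two_pi (θ : ℝ) : circlePt (θ + 2 * Real.pi) = circlePt θ := by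
  unfold circlePt
  rw [Complex.exp_eq_exp_iff_exists_int]
  exact ⟨1, by push_cast; ring⟩

/-- **Riesz–Fischer**: a square summable sequence is the sequence of Fourier coefficients of an
integrable function all of whose Fourier coefficients of negative index vanish. -/
lemma exists_integrableOn_fourier_eq {M : ℝ} (ha : ∀ s : Finset ℕ, ∑ n ∈ s, ‖a n‖ ^ 2 ≤ M) :
    ∃ φ : ℝ → ℂ, IntegrableOn φ (Ioc 0 (2 * Real.pi)) ∧
      (∀ n, ((2 * Real.pi)⁻¹ : ℝ) • ∫ θ in Ioc 0 (2 * Real.pi), φ θ * conj (circlePt θ) ^ n = a n) ∧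
      ∀ n, ∫ θ in Ioc 0 (2 * Real.pi), φ θ * circlePt θ ^ (n + 1) = 0 := by
  have : Fact (0 < 2 * Real.pi) := ⟨Real.two_pi_pos⟩
  have hsum : Summable fun n => ‖a n‖ ^ 2 := summable_of_sum_le (fun n => by positivity) ha
  let c : ℤ → ℂ := fun k => if 0 ≤ k then a k.toNat else 0
  have hc : Memℓp c 2 := by
    refine memℓp_gen ?_
    refine Summable.of_nat_of_neg_add_one ?_ ?_
    · simpa [c] using hsum
    · have h0 : ∀ n : ℕ, c (-((n : ℤ) + 1)) = 0 := fun n => if_neg (by omega)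
      simp only [h0]
      simp
  obtain ⟨F, hF⟩ : ∃ F : Lp ℂ 2 (@AddCircle.haarAddCircle (2 * Real.pi) _),
      ∀ k, fourierCoeff F k = c k :=
    ⟨fourierBasis.repr.symm (⟨c, hc⟩ : lp (fun _ : ℤ => ℂ) 2), fun k => by
      rw [← fourierBasis_repr, LinearIsometryEquiv.apply_symm_apply]⟩
  have hcoef : ∀ k : ℤ, ((2 * Real.pi)⁻¹ : ℝ) • ∫ θ in Ioc 0 (2 * Real.pi),
      F ((θ : ℝ) : AddCircle (2 * Real.pi)) * circlePt θ ^ (-k) = c k := fun k => by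
    rw [← hF k, fourierCoeff_eq_intervalIntegral _ k 0, zero_add, one_div,
      intervalIntegral.integral_of_le Real.two_pi_pos.le]
    congr 1
    refine integral_congr_ae (Eventually.of_forall fun θ => ?_)
    simp only [fourier_coe_apply, smul_eq_mul]
    rw [mul_comm, circlePt, ← Complex.exp_int_mul]
    congr 2
    have : (Real.pi : ℂ) ≠ 0 := by exact_mod_cast Real.pi_ne_zero
    push_cast
    field_simp
  refine ⟨fun θ => F (θ : AddCircle (2 * Real.pi)), ?_, fun n => ?_, fun n => ?_⟩
  · have h1 : MemLp F 2 (volume : Measure (AddCircle (2 * Real.pi))) :=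
      memLp_haarAddCircle_iff.1 (Lp.memLp F)
    have h2 := AddCircle.measurePreserving_mk (2 * Real.pi) 0
    rw [zero_add] at h2
    exact h2.integrable_comp_of_integrable (h1.integrable (by norm_num))
  · rw [← show c n = a n by simp [c], ← hcoef n]
    congr 1
    refine integral_congr_ae (Eventually.of_forall fun θ => ?_)
    simp [conj_circlePt]
  · have h := hcoef (-((n : ℤ) + 1))
    rw [show c (-((n : ℤ) + 1)) = 0 from if_neg (by omega), smul_eq_zero] at h
    rcases h with h | h
    · exact absurd h (by positivity)
    · rw [← h]
      refine integral_congr_ae (Eventually.of_forall fun θ => ?_)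
      simp only [neg_neg]
      congr 1

lemma hasSum_schwarzKernel {z ζ : ℂ} (hζ : ‖ζ‖ = 1) (hz : ‖z‖ < 1) :
    HasSum (fun n : ℕ => (if n = 0 then 1 else 2) * (z ^ n * conj ζ ^ n)) ((ζ + z) / (ζ - z)) := by
  have hζ0 : ζ ≠ 0 := norm_pos_iff.1 (by rw [hζ]; norm_num)
  have hconj : conj ζ = ζ⁻¹ := by
    rw [Complex.inv_def, Complex.normSq_eq_norm_sq, hζ]; simp
  have hq : ‖z * conj ζ‖ < 1 := by simpa [hζ] using hz
  have h1 := (hasSum_geometric_of_norm_lt_one hq).mul_left 2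
  have h2 : HasSum (fun n : ℕ => if n = 0 then (1 : ℂ) else 0) 1 := by
    simpa using hasSum_ite_eq 0 (1 : ℂ)
  have h3 := h1.sub h2
  have hne : ζ - z ≠ 0 := sub_ne_zero.2 fun h => by rw [h] at hζ; linarith
  have he : (2 * (1 - z * conj ζ)⁻¹ - 1) = (ζ + z) / (ζ - z) := by
    rw [hconj]
    have : 1 - z * ζ⁻¹ = (ζ - z) / ζ := by field_simp
    rw [this]
    field_simp
    ring
  rw [he] at h3
  refine h3.congr_fun fun n => ?_
  rcases eq_or_ne n 0 with rfl | hn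
  · simp; norm_num
  · simp [hn, mul_pow]

/-- The Schwarz integral formula with an integrable boundary function, for functions with square
summable Taylor coefficients. -/
lemma HasDiscSeries.exists_schwarz_integral (hf : HasDiscSeries a f) (h0 : (f 0).im = 0) {M : ℝ}
    (ha : ∀ s : Finset ℕ, ∑ n ∈ s, ‖a n‖ ^ 2 ≤ M) :
    ∃ h : ℝ → ℝ, IntegrableOn h (Ioc 0 (2 * Real.pi)) ∧ ∀ z ∈ ball (0 : ℂ) 1,
      f z = ((2 * Real.pi)⁻¹ : ℝ) • ∫ θ in Ioc 0 (2 * Real.pi),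
        ((circlePt θ + z) / (circlePt θ - z)) * (h θ : ℂ) := by
  obtain ⟨φ, hφ, hpos, hneg⟩ := exists_integrableOn_fourier_eq ha
  have hφn : ∀ u : ℝ → ℂ, Continuous u → (∀ θ, ‖u θ‖ ≤ 1) →
      IntegrableOn (fun θ => φ θ * u θ) (Ioc 0 (2 * Real.pi)) := fun u hu hu1 =>
    hφ.mul_bdd (c := 1) hu.aestronglyMeasurable (Eventually.of_forall hu1)
  have hpow : ∀ n θ, ‖circlePt θ ^ n‖ ≤ 1 := fun n θ => by simp [norm_circlePt]
  have hcpow : ∀ n θ, ‖conj (circlePt θ) ^ n‖ ≤ 1 := fun n θ => by simp [norm_circlePt]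
  have hcc : ∀ n : ℕ, Continuous fun θ => circlePt θ ^ n := fun n => continuous_circlePt.pow n
  have hccc : ∀ n : ℕ, Continuous fun θ => conj (circlePt θ) ^ n := fun n =>
    (Complex.continuous_conj.comp continuous_circlePt).pow n
  have hre : IntegrableOn (fun θ => (φ θ).re) (Ioc 0 (2 * Real.pi)) := hφ.re
  have hcoef : ∀ n : ℕ, (if n = 0 then 1 else 2) * (((2 * Real.pi)⁻¹ : ℝ) •
      ∫ θ in Ioc 0 (2 * Real.pi), ((φ θ).re : ℂ) * conj (circlePt θ) ^ n) = a n := fun n => by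
    have e1 : ∀ θ, ((φ θ).re : ℂ) * conj (circlePt θ) ^ n =
        (φ θ * conj (circlePt θ) ^ n + conj (φ θ * circlePt θ ^ n)) * (1 / 2) := fun θ => by
      rw [Complex.re_eq_add_conj, map_mul, map_pow]; ring
    have e2 : ∫ θ in Ioc 0 (2 * Real.pi), conj (φ θ * circlePt θ ^ n) =
        conj (∫ θ in Ioc 0 (2 * Real.pi), φ θ * circlePt θ ^ n) := integral_conj
    have i2 : IntegrableOn (fun θ => conj (φ θ * circlePt θ ^ n)) (Ioc 0 (2 * Real.pi)) :=
      (LinearIsometryEquiv.integrable_comp_iff Complex.conjLIE).2 (hφn _ (hcc n) (hpow n))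
    simp only [e1]
    rw [integral_mul_const, integral_add (hφn _ (hccc n) (hcpow n)) i2, e2]
    rcases n with _ | n
    · have h := hpos 0
      have h0' := h0
      rw [hf.apply_zero, ← Complex.conj_eq_iff_im] at h0'
      have hc := congrArg conj h
      simp only [pow_zero, mul_one, Complex.real_smul, map_mul, Complex.conj_ofReal] at h hc ⊢
      simp only [if_true]
      linear_combination (1 / 2 : ℂ) * h + (1 / 2 : ℂ) * hc + (1 / 2 : ℂ) * h0'
    · rw [hneg n, map_zero, add_zero, ← hpos (n + 1)]
      simp only [Complex.real_smul, Nat.add_eq_zero_iff, one_ne_zero, and_false, if_false]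
      ring
  refine ⟨fun θ => (φ θ).re, hre, fun z hz => ?_⟩
  have hz1 : ‖z‖ < 1 := by simpa using hz
  let G : ℕ → ℝ → ℂ := fun n θ =>
    ((if n = 0 then 1 else 2) * (z ^ n * conj (circlePt θ) ^ n)) * ((φ θ).re : ℂ)
  have hrec : IntegrableOn (fun θ => ((φ θ).re : ℂ)) (Ioc 0 (2 * Real.pi)) := hre.ofReal
  have hGi : ∀ n, Integrable (G n) (volume.restrict (Ioc 0 (2 * Real.pi))) := fun n =>
    hrec.bdd_mul (c := 2 * ‖z‖ ^ n) (by
      have := hccc n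
      exact Continuous.aestronglyMeasurable (by fun_prop)) (Eventually.of_forall fun θ => by
        rw [norm_mul, norm_mul, norm_pow]
        have h1 : ‖(if n = 0 then (1 : ℂ) else 2)‖ ≤ 2 := by split_ifs <;> simp
        have h2 := hcpow n θ
        have := mul_le_mul h1 (mul_le_mul_of_nonneg_left h2 (pow_nonneg (norm_nonneg z) n))
          (by positivity) (by norm_num)
        simpa using this)
  have hGn : Summable fun n => ∫ θ in Ioc 0 (2 * Real.pi), ‖G n θ‖ := by
    have hg := (summable_geometric_of_lt_one (norm_nonneg z) hz1).mul_left 2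
    refine Summable.of_nonneg_of_le (fun n => integral_nonneg fun θ => norm_nonneg _) (fun n => ?_)
      (hg.mul_right (∫ θ in Ioc 0 (2 * Real.pi), ‖((φ θ).re : ℂ)‖))
    rw [← integral_const_mul]
    refine integral_mono (hGi n).norm (hrec.norm.const_mul _) fun θ => ?_
    simp only [G, norm_mul, norm_pow, Complex.norm_conj, norm_circlePt, one_pow, mul_one]
    have h1 : ‖(if n = 0 then (1 : ℂ) else 2)‖ ≤ 2 := by split_ifs <;> simp
    gcongr
  have hs := hasSum_integral_of_summable_integral_norm hGi hGn
  have hint : ∀ θ, ∑' n, G n θ = ((circlePt θ + z) / (circlePt θ - z)) * ((φ θ).re : ℂ) := fun θ =>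
    ((hasSum_schwarzKernel (norm_circlePt θ) hz1).mul_right _).tsum_eq
  simp only [hint] at hs
  refine (hf z hz).unique (((hs.const_smul ((2 * Real.pi)⁻¹ : ℝ))).congr_fun fun n => ?_)
  have e3 : ∀ θ, G n θ = ((if n = 0 then 1 else 2) * z ^ n) *
      (((φ θ).re : ℂ) * conj (circlePt θ) ^ n) := fun θ => by simp only [G]; ring
  simp only [e3]
  rw [integral_const_mul, ← hcoef n]
  simp only [Complex.real_smul]
  ring

/-- The mean value property of `(f - f 0) ^ 2`: a bound on the imaginary part bounds the `L²`
means. -/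
lemma circleAverage_norm_sub_sq_le (hf : DifferentiableOn ℂ f (ball 0 1)) (h0 : (f 0).im = 0)
    {M : ℝ} (hM : ∀ z ∈ ball (0 : ℂ) 1, |(f z).im| ≤ M) (hr0 : 0 ≤ r) (hr : r < 1) :
    circleAverage (fun z => ‖f z - f 0‖ ^ 2) 0 r ≤ 2 * M ^ 2 := by
  have hg : DifferentiableOn ℂ (fun z => (f z - f 0) ^ 2) (ball 0 1) :=
    (hf.sub (differentiableOn_const _)).pow 2
  have h1 := circleAverage_re_eq hg hr0 hr
  simp only [sub_self, ne_eq, OfNat.ofNat_ne_zero, not_false_eq_true, zero_pow,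
    Complex.zero_re] at h1
  have hc1 : ContinuousOn (fun z => ‖f z - f 0‖ ^ 2) (ball 0 1) :=
    ((hf.sub (differentiableOn_const _)).continuousOn.norm).pow 2
  have hc2 : ContinuousOn (fun z => ((f z - f 0) ^ 2).re) (ball 0 1) :=
    Complex.continuous_re.comp_continuousOn hg.continuousOn
  have h2 := circleAverage_mono_of_ball (φ := fun z => ‖f z - f 0‖ ^ 2)
    (ψ := fun z => ((f z - f 0) ^ 2).re + 2 * M ^ 2) hc1 (hc2.add continuousOn_const)
    (fun z hz => by
      have h3 : ((f z).im) ^ 2 ≤ M ^ 2 := sq_le_sq' (neg_le_of_abs_le (hM z hz)) (le_of_abs_le (hM z hz))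
      rw [← Complex.normSq_eq_norm_sq, Complex.normSq_apply, pow_two (f z - f 0), Complex.mul_re,
        Complex.sub_im, h0]
      nlinarith) hr0 hr
  have h4 := Real.circleAverage_add (hc2.circleIntegrable_of_ball hr0 hr)
    (circleIntegrable_const (2 * M ^ 2) 0 r)
  have h5 : circleAverage (fun z => ((f z - f 0) ^ 2).re + 2 * M ^ 2) 0 r = 2 * M ^ 2 := by
    have h6 : circleAverage (fun z => ((f z - f 0) ^ 2).re + 2 * M ^ 2) 0 r = _ := h4
    rw [h6, h1, Real.circleAverage_const]; simp
  exact h2.trans h5.le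

/-- The exponential of an analytic function whose imaginary part is bounded, and vanishes at the
origin, is outer. -/
lemma isOuter_exp (hf : DifferentiableOn ℂ f (ball 0 1)) (h0 : (f 0).im = 0)
    {M : ℝ} (hM : ∀ z ∈ ball (0 : ℂ) 1, |(f z).im| ≤ M) :
    IsOuter fun z => Complex.exp (f z) := by
  have hball : unitDisc = ball (0 : ℂ) 1 := by ext z; simp [unitDisc]
  have hg : DifferentiableOn ℂ (fun z => f z - f 0) (ball 0 1) :=
    hf.sub (differentiableOn_const _)
  have hs := hg.hasDiscSeries
  obtain ⟨h, hi, hh⟩ := hs.exists_schwarz_integral (by simp)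
    (hs.sum_norm_sq_le fun r h1 h2 => circleAverage_norm_sub_sq_le hf h0 hM h1.le h2)
  obtain ⟨k, ki, hk⟩ := HasDiscSeries.exists_schwarz_integral (a := fun n => if n = 0 then f 0 else 0)
    (f := fun _ => f 0) (fun z _ => by
      have := hasSum_ite_eq 0 (f 0)
      refine this.congr_fun fun n => ?_
      rcases eq_or_ne n 0 with rfl | hn <;> simp [*]) h0 (M := ‖f 0‖ ^ 2) (fun s => by
      have : ∀ n : ℕ, ‖(if n = 0 then f 0 else 0)‖ ^ 2 = if n = 0 then ‖f 0‖ ^ 2 else 0 := fun n => by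
        split_ifs <;> simp
      simp only [this, Finset.sum_ite_eq']
      split_ifs
      · exact le_rfl
      · positivity)
  rw [IsOuter, hball]
  refine ⟨hf.cexp, fun θ => h θ + k θ, hi.add ki, fun z hz => ?_⟩
  have hz1 : ‖z‖ < 1 := by simpa using hz
  have hker : Continuous fun θ => (circlePt θ + z) / (circlePt θ - z) :=
    (continuous_circlePt.add continuous_const).div (continuous_circlePt.sub continuous_const)
      fun θ => sub_ne_zero.2 fun h => by
        have := norm_circlePt θ
        rw [h] at this
        linarith
  have hbd : ∀ θ, ‖(circlePt θ + z) / (circlePt θ - z)‖ ≤ 2 / (1 - ‖z‖) := fun θ => by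
    rw [norm_div]
    have h1 := norm_add_le (circlePt θ) z
    have h2 := norm_sub_norm_le (circlePt θ) z
    rw [norm_circlePt] at h1 h2
    have : 0 < 1 - ‖z‖ := by linarith
    gcongr
    linarith
  have key : ∀ u : ℝ → ℝ, IntegrableOn u (Ioc 0 (2 * Real.pi)) → IntegrableOn
      (fun θ => (circlePt θ + z) / (circlePt θ - z) * (u θ : ℂ)) (Ioc 0 (2 * Real.pi)) :=
    fun u hu => Integrable.bdd_mul (c := 2 / (1 - ‖z‖)) hu.ofReal hker.aestronglyMeasurable
      (Eventually.of_forall hbd)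
  simp only [Complex.ofReal_add, mul_add]
  rw [integral_add (key h hi) (key k ki), smul_add, ← hh z hz, ← hk z hz, sub_add_cancel]

lemma unitDisc_eq_ball : unitDisc = ball (0 : ℂ) 1 := by ext z; simp [unitDisc]

lemma ofReal_mul_circlePt (r θ : ℝ) : (r : ℂ) * circlePt θ = circleMap 0 r θ := by
  simp [circleMap, circlePt]

lemma hardyIntegral_eq (p : ℝ) (f : ℂ → ℂ) (r : ℝ) :
    hardyIntegral p f r = 2 * Real.pi * circleAverage (fun z => ‖f z‖ ^ p) 0 r := by
  rw [hardyIntegral, Real.circleAverage, intervalIntegral.integral_of_le Real.two_pi_pos.le,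
    smul_eq_mul, ← mul_assoc, mul_inv_cancel₀ Real.two_pi_pos.ne', one_mul]
  simp only [ofReal_mul_circlePt]

lemma memHardy_iff {p : ℝ} : MemHardy p f ↔ DifferentiableOn ℂ f (ball 0 1) ∧
    ∃ M, ∀ r, 0 < r → r < 1 → circleAverage (fun z => ‖f z‖ ^ p) 0 r ≤ M := by
  rw [MemHardy, unitDisc_eq_ball]
  refine and_congr_right fun _ => ⟨fun ⟨M, hM⟩ => ⟨(2 * Real.pi)⁻¹ * M, fun r h0 h1 => ?_⟩,
    fun ⟨M, hM⟩ => ⟨2 * Real.pi * M, fun r h0 h1 => ?_⟩⟩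
  · have := hM r h0 h1
    rw [hardyIntegral_eq] at this
    rwa [inv_mul_eq_div, le_div_iff₀' Real.two_pi_pos]
  · rw [hardyIntegral_eq]
    exact mul_le_mul_of_nonneg_left (hM r h0 h1) Real.two_pi_pos.le

lemma rpow_mul_rpow_mul_rpow_le {x y z α β γ : ℝ} (hx : 1 ≤ x) (hy : 1 ≤ y) (hz : 1 ≤ z)
    (hα : 0 ≤ α) (hβ : 0 ≤ β) (hγ : 0 ≤ γ) :
    x ^ α * y ^ β * z ^ γ ≤ x ^ (α + β + γ) + y ^ (α + β + γ) + z ^ (α + β + γ) := by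
  have hs : 0 ≤ α + β + γ := by positivity
  have key : ∀ w, 1 ≤ w → x ≤ w → y ≤ w → z ≤ w → x ^ α * y ^ β * z ^ γ ≤ w ^ (α + β + γ) :=
    fun w hw h1 h2 h3 => by
      rw [Real.rpow_add (by linarith), Real.rpow_add (by linarith)]
      gcongr
  have px : 0 ≤ x ^ (α + β + γ) := by positivity
  have py : 0 ≤ y ^ (α + β + γ) := by positivity
  have pz : 0 ≤ z ^ (α + β + γ) := by positivity
  rcases le_total x y with hxy | hxy
  · rcases le_total y z with hyz | hyz
    · linarith [key z hz (hxy.trans hyz) hyz le_rfl]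
    · linarith [key y hy hxy le_rfl hyz]
  · rcases le_total x z with hxz | hxz
    · linarith [key z hz hxz (hxy.trans hxz) le_rfl]
    · linarith [key x hx le_rfl hxy hxz]

lemma norm_four_add_log_sq_rpow_le {ε q : ℝ} (hq : 0 < q) (hε : 0 < ε) :
    ∃ C, 0 < C ∧ ∀ x : ℂ, 1 ≤ x.re → (‖4 + Complex.log x‖ ^ 2) ^ q ≤ C * ‖x‖ ^ ε := by
  obtain ⟨C, hC, h⟩ := exists_log_rpow_le (s := 2 * q) (by positivity) hε
  refine ⟨C, hC, fun x hx => ?_⟩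
  refine le_trans ?_ (h ‖x‖ (one_le_norm_of_one_le_re hx))
  rw [Real.rpow_mul (by linarith [Real.log_nonneg (one_le_norm_of_one_le_re hx)]), Real.rpow_two]
  have := norm_four_add_log_le hx
  gcongr

lemma AdmissibleMultiplier.exists_norm_inv_rpow_le {C : ℕ → ℝ} {e : ℂ → ℂ} {q ε : ℝ}
    (hC : LogPowerBound C) (he : AdmissibleMultiplier C e) (hq : 0 < q) (hε : 0 < ε) :
    ∃ P K, OneLeRe P ∧ 0 ≤ K ∧ ∀ z ∈ ball (0 : ℂ) 1, (‖e z‖⁻¹) ^ q ≤ K * ‖P z‖ ^ ε := by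
  obtain ⟨P, hP, -, h⟩ := he.exists_majorant
  obtain ⟨m, hm⟩ := exists_nat_gt (q / ε)
  have hm0 : (0 : ℝ) < m := lt_trans (by positivity) hm
  have hCm := (hC m).1
  refine ⟨P, C m ^ (q / m), hP, Real.rpow_nonneg hCm _, fun z hz => ?_⟩
  have hre := he.re_pos hz
  have hx := one_le_norm_of_one_le_re (hP.one_le_re z hz)
  have hle : (e z).re ≤ ‖e z‖ := Complex.re_le_norm _
  have he0 : 0 < ‖e z‖ := hre.trans_le hle
  have h1 : 1 ≤ C m * ‖P z‖ * ‖e z‖ ^ m := (h z hz m).trans (by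
    have := Complex.re_le_norm (P z)
    gcongr)
  have h2 : (‖e z‖⁻¹) ^ m ≤ C m * ‖P z‖ := by
    rw [inv_pow]
    exact (inv_le_iff_one_le_mul₀ (by positivity)).2 h1
  have h3 : (‖e z‖⁻¹) ^ q = ((‖e z‖⁻¹) ^ m) ^ (q / m) := by
    rw [← Real.rpow_natCast, ← Real.rpow_mul (by positivity), mul_div_cancel₀ _ hm0.ne']
  rw [h3]
  calc ((‖e z‖⁻¹) ^ m) ^ (q / m) ≤ (C m * ‖P z‖) ^ (q / m) := by gcongr
    _ = C m ^ (q / m) * ‖P z‖ ^ (q / m) := Real.mul_rpow hCm (by positivity)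
    _ ≤ C m ^ (q / m) * ‖P z‖ ^ ε := by
      refine mul_le_mul_of_nonneg_left (Real.rpow_le_rpow_of_exponent_le hx ?_)
        (Real.rpow_nonneg hCm _)
      rw [div_lt_iff₀ hε] at hm
      rw [div_le_iff₀ hm0]
      linarith

lemma OneLeRe.continuousOn_norm_rpow {U : ℂ → ℂ} (hU : OneLeRe U) {s : ℝ} (hs : 0 ≤ s) :
    ContinuousOn (fun z => ‖U z‖ ^ s) (ball 0 1) :=
  hU.differentiableOn.continuousOn.norm.rpow_const fun _ _ => Or.inr hs

/-- The multiplier built from two functions of real part at least one and an admissible multiplier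
lies in all Hardy spaces of exponent smaller than `p`. -/
lemma memHardy_of_norm_eq {C : ℕ → ℝ} {U V e H : ℂ → ℂ} {p q : ℝ} (hp : 0 < p) (hq : 0 < q)
    (hqp : q < p) (hC : LogPowerBound C) (hU : OneLeRe U) (hV : OneLeRe V)
    (he : AdmissibleMultiplier C e) (hd : DifferentiableOn ℂ H (ball 0 1))
    (hH : ∀ z ∈ ball (0 : ℂ) 1, ‖H z‖ = ‖U z‖ ^ p⁻¹ * ‖4 + Complex.log (U z)‖ ^ 2 *
      ‖4 + Complex.log (V z)‖ ^ 2 * ‖e z‖⁻¹) :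
    MemHardy q H := by
  have hqp1 : q / p < 1 := (div_lt_one hp).2 hqp
  obtain ⟨ε, hε, hs1⟩ : ∃ ε > 0, (q / p + ε) + ε + ε < 1 := ⟨(1 - q / p) / 4, by linarith, by linarith⟩
  have hqp0 : 0 < q / p := by positivity
  set s := (q / p + ε) + ε + ε with hs
  have hs0 : 0 ≤ s := by positivity
  obtain ⟨D, hD, hlog⟩ := norm_four_add_log_sq_rpow_le hq hε
  obtain ⟨P, K, hP, hK, hinv⟩ := he.exists_norm_inv_rpow_le hC hq hε
  obtain ⟨A₁, h₁⟩ := hU.exists_circleAverage_rpow_le hs0 hs1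
  obtain ⟨A₂, h₂⟩ := hV.exists_circleAverage_rpow_le hs0 hs1
  obtain ⟨A₃, h₃⟩ := hP.exists_circleAverage_rpow_le hs0 hs1
  refine memHardy_iff.2 ⟨hd, D * D * K * (A₁ + A₂ + A₃), fun r h0 h1 => ?_⟩
  have hpt : ∀ z ∈ ball (0 : ℂ) 1, ‖H z‖ ^ q ≤
      D * D * K * (‖U z‖ ^ s + ‖V z‖ ^ s + ‖P z‖ ^ s) := fun z hz => by
    have hu := one_le_norm_of_one_le_re (hU.one_le_re z hz)
    have hv := one_le_norm_of_one_le_re (hV.one_le_re z hz)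
    have hw := one_le_norm_of_one_le_re (hP.one_le_re z hz)
    rw [hH z hz, Real.mul_rpow (by positivity) (by positivity),
      Real.mul_rpow (by positivity) (by positivity), Real.mul_rpow (by positivity) (by positivity),
      ← Real.rpow_mul (norm_nonneg _), inv_mul_eq_div]
    calc ‖U z‖ ^ (q / p) * (‖4 + Complex.log (U z)‖ ^ 2) ^ q * (‖4 + Complex.log (V z)‖ ^ 2) ^ q *
          ‖e z‖⁻¹ ^ q
        ≤ ‖U z‖ ^ (q / p) * (D * ‖U z‖ ^ ε) * (D * ‖V z‖ ^ ε) * (K * ‖P z‖ ^ ε) := by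
          have i1 := hlog _ (hU.one_le_re z hz)
          have i2 := hlog _ (hV.one_le_re z hz)
          have i3 := hinv z hz
          gcongr
      _ = D * D * K * (‖U z‖ ^ (q / p + ε) * ‖V z‖ ^ ε * ‖P z‖ ^ ε) := by
          rw [Real.rpow_add (by linarith)]; ring
      _ ≤ _ := by
          have := rpow_mul_rpow_mul_rpow_le hu hv hw (add_pos hqp0 hε).le hε.le hε.le
          gcongr
  have c1 := hU.continuousOn_norm_rpow hs0
  have c2 := hV.continuousOn_norm_rpow hs0
  have c3 := hP.continuousOn_norm_rpow hs0
  have c12 : ContinuousOn (fun z => ‖U z‖ ^ s + ‖V z‖ ^ s) (ball 0 1) := c1.add c2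
  have c123 : ContinuousOn (fun z => ‖U z‖ ^ s + ‖V z‖ ^ s + ‖P z‖ ^ s) (ball 0 1) := c12.add c3
  have e1 : circleAverage (fun z => ‖U z‖ ^ s + ‖V z‖ ^ s) 0 r = _ :=
    Real.circleAverage_add (c1.circleIntegrable_of_ball h0.le h1)
      (c2.circleIntegrable_of_ball h0.le h1)
  have e2 : circleAverage (fun z => ‖U z‖ ^ s + ‖V z‖ ^ s + ‖P z‖ ^ s) 0 r = _ :=
    Real.circleAverage_add (c12.circleIntegrable_of_ball h0.le h1)
      (c3.circleIntegrable_of_ball h0.le h1)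
  have e3 : circleAverage (fun z => D * D * K * (‖U z‖ ^ s + ‖V z‖ ^ s + ‖P z‖ ^ s)) 0 r = _ :=
    Real.circleAverage_fun_smul (a := D * D * K)
      (f := fun z => ‖U z‖ ^ s + ‖V z‖ ^ s + ‖P z‖ ^ s) (c := 0) (R := r)
  refine (circleAverage_mono_of_ball (φ := fun z => ‖H z‖ ^ q)
    (ψ := fun z => D * D * K * (‖U z‖ ^ s + ‖V z‖ ^ s + ‖P z‖ ^ s))
    (hd.continuousOn.norm.rpow_const fun _ _ => Or.inr hq.le) (continuousOn_const.mul c123)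
    hpt h0.le h1).trans ?_
  rw [e3, e2, e1, smul_eq_mul]
  have := h₁ r h0.le h1
  have := h₂ r h0.le h1
  have := h₃ r h0.le h1
  gcongr

lemma ofReal_mul_circlePt_mem_ball {r : ℝ} (θ : ℝ) (h0 : 0 ≤ r) (h1 : r < 1) :
    (r : ℂ) * circlePt θ ∈ ball (0 : ℂ) 1 := by
  simpa [norm_circlePt, abs_of_nonneg h0] using h1

lemma dist_circlePt_le (θ θ' : ℝ) : dist (circlePt θ) (circlePt θ') ≤ |θ - θ'| := by
  have h := (lipschitzWith_circleMap 0 1).dist_le_mul θ θ'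
  rw [← ofReal_mul_circlePt, ← ofReal_mul_circlePt] at h
  simpa [Real.dist_eq] using h

lemma eventually_mem_Ioo_left_one : ∀ᶠ r : ℝ in 𝓝[<] 1, 0 ≤ r ∧ r < 1 := by
  filter_upwards [Ioo_mem_nhdsLT (zero_lt_one' ℝ)] with r hr using ⟨hr.1.le, hr.2⟩

lemma UniformContinuousOn.exists_tendsto_radial (h : UniformContinuousOn f (ball 0 1)) (θ : ℝ) :
    ∃ l, Tendsto (fun r : ℝ => f ((r : ℂ) * circlePt θ)) (𝓝[<] 1) (𝓝 l) := by
  have h1 : Tendsto (fun r : ℝ => (r : ℂ) * circlePt θ) (𝓝[<] 1) (𝓝 (((1 : ℝ) : ℂ) * circlePt θ)) :=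
    Tendsto.mono_left (Continuous.tendsto (by fun_prop) 1) nhdsWithin_le_nhds
  have h2 := (cauchy_map_iff.1 h1.cauchy_map).2
  have h3 : ∀ᶠ r : ℝ in 𝓝[<] 1, (r : ℂ) * circlePt θ ∈ ball (0 : ℂ) 1 :=
    eventually_mem_Ioo_left_one.mono fun r hr => ofReal_mul_circlePt_mem_ball θ hr.1 hr.2
  refine cauchy_map_iff_exists_tendsto.1 (cauchy_map_iff.2 ⟨inferInstance, ?_⟩)
  refine Tendsto.comp h (tendsto_inf.2 ⟨h2, tendsto_principal.2 ?_⟩)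
  exact (h3.prod_mk h3)

lemma UniformContinuousOn.exists_norm_le_ball (h : UniformContinuousOn f (ball 0 1)) :
    ∃ M, ∀ z ∈ ball (0 : ℂ) 1, ‖f z‖ ≤ M := by
  obtain ⟨δ, hδ, hf⟩ := Metric.uniformContinuousOn_iff.1 h 1 one_pos
  set R : ℝ := 1 - min δ 1 / 2 with hR
  have hm : 0 < min δ 1 := lt_min hδ one_pos
  have hR1 : R < 1 := by linarith
  have hR0 : 0 < R := by linarith [min_le_right δ 1]
  obtain ⟨M, hM⟩ := (isCompact_closedBall (0 : ℂ) R).exists_bound_of_continuousOn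
    (h.continuousOn.mono (closedBall_subset_ball hR1))
  refine ⟨M + 1, fun z hz => ?_⟩
  have hz1 : ‖z‖ < 1 := by simpa using hz
  have hRz : ‖(R : ℂ) * z‖ ≤ R := by
    rw [norm_mul, Complex.norm_real, Real.norm_of_nonneg hR0.le]
    nlinarith
  have hd : dist z (R * z) < δ := by
    have : z - R * z = ((1 - R : ℝ) : ℂ) * z := by push_cast; ring
    rw [dist_eq_norm, this, norm_mul, Complex.norm_real, Real.norm_of_nonneg (by linarith)]
    have := min_le_left δ 1
    nlinarith [norm_nonneg z]
  have h1 := hf z hz _ (by simpa using hRz.trans_lt hR1) hd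
  have h2 := hM ((R : ℂ) * z) (by rwa [mem_closedBall_zero_iff])
  rw [dist_eq_norm] at h1
  linarith [norm_le_norm_add_norm_sub' (f z) (f (R * z))]

lemma meanOsc_le {φ : ℝ → ℂ} (hφ : Continuous φ) {θ₀ t ε : ℝ} (ht : 0 < t)
    (h : ∀ θ, |θ - θ₀| < Real.pi * t → ‖φ θ - φ θ₀‖ ≤ ε) : meanOsc φ θ₀ t ≤ 2 * ε := by
  have hpt : 0 < Real.pi * t := by positivity
  set I := Set.Ioo (θ₀ - Real.pi * t) (θ₀ + Real.pi * t) with hI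
  have hvol : volume.real I = 2 * Real.pi * t := by
    rw [hI, Real.volume_real_Ioo_of_le (by linarith)]; ring
  have hfin : volume I < ⊤ := by rw [hI]; exact measure_Ioo_lt_top
  have h2 : (0 : ℝ) < 2 * Real.pi * t := by positivity
  have hmem : ∀ θ ∈ I, ‖φ θ - φ θ₀‖ ≤ ε := fun θ hθ => h θ (by
    rw [abs_lt]; constructor <;> linarith [hθ.1, hθ.2])
  have hint : IntegrableOn φ I := (hφ.integrableOn_Icc (a := θ₀ - Real.pi * t)
    (b := θ₀ + Real.pi * t)).mono_set Ioo_subset_Icc_self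
  have hconst : ∀ c : ℂ, IntegrableOn (fun _ : ℝ => c) I := fun c =>
    integrableOn_const hfin.ne
  have havg : ‖φ θ₀ - arcAvg φ θ₀ t‖ ≤ ε := by
    have e1 : arcAvg φ θ₀ t - φ θ₀ = ((2 * Real.pi * t)⁻¹ : ℝ) • ∫ θ in I, (φ θ - φ θ₀) := by
      rw [integral_sub hint (hconst _), setIntegral_const, hvol, smul_sub, smul_smul,
        inv_mul_cancel₀ h2.ne', one_smul, arcAvg]
    rw [norm_sub_rev, e1, norm_smul, norm_inv, Real.norm_of_nonneg h2.le,
      inv_mul_le_iff₀ h2]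
    have := norm_setIntegral_le_of_norm_le_const hfin hmem
    rw [hvol] at this
    linarith
  rw [meanOsc, inv_mul_le_iff₀ h2]
  have h3 := norm_setIntegral_le_of_norm_le_const (f := fun θ => ‖φ θ - arcAvg φ θ₀ t‖)
    (C := 2 * ε) hfin fun θ hθ => by
      rw [norm_norm]
      linarith [norm_sub_le_norm_sub_add_norm_sub (φ θ) (φ θ₀) (arcAvg φ θ₀ t), hmem θ hθ]
  rw [hvol] at h3
  have h4 := le_trans (le_abs_self _) h3
  linarith

lemma exists_memQA_of_uniformContinuousOn (hf : DifferentiableOn ℂ f (ball 0 1))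
    (h : UniformContinuousOn f (ball 0 1)) : ∃ φ, MemQA f φ := by
  choose φ hφ using h.exists_tendsto_radial
  obtain ⟨M, hM⟩ := h.exists_norm_le_ball
  have hmod : ∀ ε > 0, ∃ δ > 0, ∀ θ θ', |θ - θ'| < δ → ‖φ θ - φ θ'‖ ≤ ε := fun ε hε => by
    obtain ⟨δ, hδ, hd⟩ := Metric.uniformContinuousOn_iff.1 h ε hε
    refine ⟨δ, hδ, fun θ θ' hθ => ?_⟩
    refine le_of_tendsto ((hφ θ).sub (hφ θ')).norm ?_
    filter_upwards [eventually_mem_Ioo_left_one] with r hr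
    rw [← dist_eq_norm]
    refine (hd _ (ofReal_mul_circlePt_mem_ball θ hr.1 hr.2) _
      (ofReal_mul_circlePt_mem_ball θ' hr.1 hr.2) ?_).le
    rw [dist_eq_norm, ← mul_sub, norm_mul, Complex.norm_real, Real.norm_of_nonneg hr.1]
    have h1 := dist_circlePt_le θ θ'
    rw [dist_eq_norm] at h1
    nlinarith [norm_nonneg (circlePt θ - circlePt θ'), hr.1, hr.2]
  have hcont : Continuous φ := Metric.continuous_iff.2 fun θ' ε hε => by
    obtain ⟨δ, hδ, hd⟩ := hmod (ε / 2) (by positivity)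
    exact ⟨δ, hδ, fun θ hθ => by
      rw [dist_eq_norm]
      rw [Real.dist_eq] at hθ
      linarith [hd θ θ' hθ]⟩
  have hbd : ∀ θ, ‖φ θ‖ ≤ M := fun θ => by
    refine le_of_tendsto (hφ θ).norm ?_
    filter_upwards [eventually_mem_Ioo_left_one] with r hr
    exact hM _ (ofReal_mul_circlePt_mem_ball θ hr.1 hr.2)
  have hper : ∀ θ, φ (θ + 2 * Real.pi) = φ θ := fun θ => by
    have := hφ (θ + 2 * Real.pi)
    rw [circlePt_add_two_pi] at this
    exact tendsto_nhds_unique this (hφ θ)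
  refine ⟨φ, ⟨by rwa [unitDisc_eq_ball], M, by rwa [unitDisc_eq_ball]⟩, Eventually.of_forall hφ,
    ⟨hper, ?_, 2 * (M + M), fun θ₀ t ht _ => meanOsc_le hcont ht fun θ _ => ?_⟩, fun ε hε => ?_⟩
  · exact (hcont.integrableOn_Icc).mono_set Ioc_subset_Icc_self
  · exact (norm_sub_le _ _).trans (add_le_add (hbd _) (hbd _))
  · obtain ⟨δ, hδ, hd⟩ := hmod (ε / 2) (by positivity)
    refine ⟨δ / Real.pi, by positivity, fun θ₀ t ht htδ => ?_⟩
    rw [lt_div_iff₀' Real.pi_pos] at htδ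
    have := meanOsc_le hcont ht (ε := ε / 2) fun θ hθ => hd θ θ₀ (hθ.trans htδ)
    linarith

lemma abs_im_log_le_pi (x : ℂ) : |(Complex.log x).im| ≤ Real.pi := by
  rw [Complex.log_im]; exact Complex.abs_arg_le_pi x

lemma im_log_eq_zero {x : ℂ} (hx : 0 ≤ x.re) (h : x.im = 0) : (Complex.log x).im = 0 := by
  rw [Complex.log_im, Complex.arg_eq_zero_iff]; exact ⟨hx, h⟩

lemma OneLeRe.four_add_log_zero_im {U : ℂ → ℂ} (hU : OneLeRe U) :
    (4 + Complex.log (U 0)).im = 0 := by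
  rw [hU.log_zero_eq]; simp

lemma four_le_re_four_add_log {x : ℂ} (hx : 1 ≤ x.re) : 4 ≤ (4 + Complex.log x).re := by
  rw [← re_four_add_log]
  linarith [Real.log_nonneg (one_le_norm_of_one_le_re hx)]

/-- The logarithm of the multiplier `U ^ p⁻¹ (4 + log U)² (4 + log V)² e⁻¹`. -/
def logMultiplier (p : ℝ) (U V e : ℂ → ℂ) (z : ℂ) : ℂ :=
  (p⁻¹ : ℝ) * Complex.log (U z) + 2 * Complex.log (4 + Complex.log (U z)) +
    2 * Complex.log (4 + Complex.log (V z)) - Complex.log (e z)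

section
variable {C : ℕ → ℝ} {U V e : ℂ → ℂ} {p : ℝ}

lemma exp_logMultiplier (hU : OneLeRe U) (hV : OneLeRe V) (he : AdmissibleMultiplier C e) {z : ℂ}
    (hz : z ∈ ball (0 : ℂ) 1) : Complex.exp (logMultiplier p U V e z) =
      Complex.exp ((p⁻¹ : ℝ) * Complex.log (U z)) * (4 + Complex.log (U z)) ^ 2 *
        (4 + Complex.log (V z)) ^ 2 * (e z)⁻¹ := by
  have h2 : ∀ x : ℂ, x ≠ 0 → Complex.exp (2 * Complex.log x) = x ^ 2 := fun x hx => by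
    rw [two_mul, Complex.exp_add, Complex.exp_log hx, sq]
  have he0 : e z ≠ 0 := fun h => by simpa [h] using he.re_pos hz
  rw [logMultiplier, Complex.exp_sub, Complex.exp_add, Complex.exp_add,
    h2 _ (four_add_log_ne_zero (hU.one_le_re z hz)),
    h2 _ (four_add_log_ne_zero (hV.one_le_re z hz)), Complex.exp_log he0, div_eq_mul_inv]

lemma isOuter_exp_logMultiplier (hU : OneLeRe U) (hV : OneLeRe V)
    (he : AdmissibleMultiplier C e) : IsOuter fun z => Complex.exp (logMultiplier p U V e z) := by
  have h0 : (0 : ℂ) ∈ ball (0 : ℂ) 1 := by simp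
  have hslit : ∀ {Y : ℂ → ℂ}, OneLeRe Y → ∀ z ∈ ball (0 : ℂ) 1,
      4 + Complex.log (Y z) ∈ Complex.slitPlane := fun hY z hz =>
    Or.inl (by linarith [four_le_re_four_add_log (hY.one_le_re z hz)])
  have hlog : ∀ {Y : ℂ → ℂ}, OneLeRe Y →
      (Complex.log (4 + Complex.log (Y 0))).im = 0 := fun hY =>
    im_log_eq_zero (by linarith [four_le_re_four_add_log (hY.one_le_re 0 h0)])
      hY.four_add_log_zero_im
  have him : ∀ z, (logMultiplier p U V e z).im = p⁻¹ * (Complex.log (U z)).im +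
      2 * (Complex.log (4 + Complex.log (U z))).im +
      2 * (Complex.log (4 + Complex.log (V z))).im - (Complex.log (e z)).im := fun z => by
    simp only [logMultiplier, Complex.sub_im, Complex.add_im, Complex.im_ofReal_mul]
    simp [Complex.mul_im]
  refine isOuter_exp (M := |p⁻¹| * Real.pi + 5 * Real.pi) ?_ ?_ fun z _ => ?_
  · exact (((hU.differentiableOn_log.const_mul _).add
      ((hU.differentiableOn_four_add_log.clog (hslit hU)).const_mul _)).add
      ((hV.differentiableOn_four_add_log.clog (hslit hV)).const_mul _)).sub
      (he.differentiableOn.clog fun z hz => Or.inl (he.re_pos hz))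
  · rw [him, hlog hU, hlog hV, im_log_eq_zero (he.re_pos h0).le he.im_zero, hU.log_zero_eq]
    simp
  · rw [him]
    have i1 : |p⁻¹ * (Complex.log (U z)).im| ≤ |p⁻¹| * Real.pi := by
      rw [abs_mul]
      exact mul_le_mul_of_nonneg_left (abs_im_log_le_pi _) (abs_nonneg _)
    have i2 := abs_le.1 (abs_im_log_le_pi (4 + Complex.log (U z)))
    have i3 := abs_le.1 (abs_im_log_le_pi (4 + Complex.log (V z)))
    have i4 := abs_le.1 (abs_im_log_le_pi (e z))
    rw [abs_le] at i1 ⊢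
    constructor <;> linarith [i1.1, i1.2, i2.1, i2.2, i3.1, i3.2, i4.1, i4.2]

lemma norm_exp_logMultiplier (hU : OneLeRe U) (hV : OneLeRe V) (he : AdmissibleMultiplier C e)
    {z : ℂ} (hz : z ∈ ball (0 : ℂ) 1) : ‖Complex.exp (logMultiplier p U V e z)‖ =
      ‖U z‖ ^ p⁻¹ * ‖4 + Complex.log (U z)‖ ^ 2 * ‖4 + Complex.log (V z)‖ ^ 2 * ‖e z‖⁻¹ := by
  rw [exp_logMultiplier hU hV he hz]
  simp only [norm_mul, norm_pow, norm_inv]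
  rw [norm_exp_mul_log (ne_zero_of_one_le_re (hU.one_le_re z hz))]

end

/-- The quotient of `f` by the outer function `U ^ p⁻¹`. -/
def outerQuotient (p : ℝ) (U f : ℂ → ℂ) (z : ℂ) : ℂ :=
  f z * Complex.exp (-((p⁻¹ : ℝ) * Complex.log (U z)))

section
variable {U : ℂ → ℂ} {p : ℝ}

lemma differentiableOn_outerQuotient (hf : DifferentiableOn ℂ f (ball 0 1)) (hU : OneLeRe U) :
    DifferentiableOn ℂ (outerQuotient p U f) (ball 0 1) :=
  hf.mul (hU.differentiableOn_log.const_mul _).neg.cexp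

lemma norm_outerQuotient_le (hp : 0 < p) (hU : OneLeRe U)
    (h : ∀ z ∈ ball (0 : ℂ) 1, ‖f z‖ ^ p ≤ (U z).re) {z : ℂ} (hz : z ∈ ball (0 : ℂ) 1) :
    ‖outerQuotient p U f z‖ ≤ 1 := by
  have hU1 := hU.one_le_re z hz
  have hpos : 0 < ‖U z‖ ^ p⁻¹ :=
    Real.rpow_pos_of_pos (one_pos.trans_le (one_le_norm_of_one_le_re hU1)) _
  rw [outerQuotient, norm_mul, Complex.exp_neg, norm_inv,
    norm_exp_mul_log (ne_zero_of_one_le_re hU1), ← div_eq_mul_inv, div_le_one hpos]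
  calc ‖f z‖ = (‖f z‖ ^ p) ^ p⁻¹ := (Real.rpow_rpow_inv (norm_nonneg _) hp.ne').symm
    _ ≤ ‖U z‖ ^ p⁻¹ := by
      have := (h z hz).trans (Complex.re_le_norm _)
      gcongr

/-- The derivative of `f` in terms of those of the bounded functions `outerQuotient p U f` and
`(4 + log U)⁻¹`. -/
lemma deriv_eq_outerQuotient (hf : DifferentiableOn ℂ f (ball 0 1)) (hU : OneLeRe U) {z : ℂ}
    (hz : z ∈ ball (0 : ℂ) 1) : deriv f z =
      (((4 + Complex.log (U z))⁻¹) ^ 2 * deriv (outerQuotient p U f) z +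
        (-(p⁻¹ : ℝ) * outerQuotient p U f z) * deriv (fun w => (4 + Complex.log (U w))⁻¹) z) *
      (Complex.exp ((p⁻¹ : ℝ) * Complex.log (U z)) * (4 + Complex.log (U z)) ^ 2) := by
  have hl := hU.hasDerivAt_log hz
  have hx := four_add_log_ne_zero (hU.one_le_re z hz)
  have hF := (hf.differentiableAt (isOpen_ball.mem_nhds hz)).hasDerivAt
  have hn : HasDerivAt (fun w => -((p⁻¹ : ℝ) * Complex.log (U w)))
      (-((p⁻¹ : ℝ) * (deriv U z / U z))) z := (hl.const_mul _).neg
  have h1 : HasDerivAt (outerQuotient p U f) _ z := hF.mul hn.cexp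
  have h2 : HasDerivAt (fun w => (4 + Complex.log (U w))⁻¹) _ z := (hl.const_add 4).fun_inv hx
  rw [h1.deriv, h2.deriv, outerQuotient, Complex.exp_neg]
  have he := Complex.exp_ne_zero ((p⁻¹ : ℝ) * Complex.log (U z))
  field_simp
  ring

end

end

/-- Lemma 4.1: for `0 < p < ∞` and `F ∈ ℍ^p` there are `G ∈ QA` and an outer
function `H ∈ ℍ^q` for every `q < p` with `F' = G' H`. -/
theorem stmt_12 (p : ℝ) (hp : 0 < p) (F : ℂ → ℂ) (hF : MemHardy p F) :
    ∃ (G : ℂ → ℂ) (Gb : ℝ → ℂ) (H : ℂ → ℂ),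
      MemQA G Gb ∧ IsOuter H ∧
      (∀ q : ℝ, 0 < q → q < p → MemHardy q H) ∧
      ∀ z ∈ unitDisc, deriv F z = deriv G z * H z := by
  obtain ⟨hFd, M, hM⟩ := memHardy_iff.1 hF
  obtain ⟨U, hU, hFU⟩ := exists_majorant_of_circleAverage_le hp hFd hM
  obtain ⟨C, hC⟩ := exists_logPowerBound
  have hBd : DifferentiableOn ℂ (outerQuotient p U F) (Metric.ball 0 1) :=
    differentiableOn_outerQuotient hFd hU
  have hB : ∀ z ∈ Metric.ball (0 : ℂ) 1, ‖outerQuotient p U F z‖ ≤ 1 := fun z hz =>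
    norm_outerQuotient_le hp hU hFU hz
  have hχ : ∀ z ∈ Metric.ball (0 : ℂ) 1, ‖(4 + Complex.log (U z))⁻¹‖ ≤ 1 := fun z hz =>
    (norm_inv_four_add_log_le (hU.one_le_re z hz)).trans (by norm_num)
  have hp' : 0 < p⁻¹ := inv_pos.2 hp
  have hone : (1 : ℝ) ≤ 1 + p⁻¹ := by linarith
  obtain ⟨V, e, hV, he, hT⟩ := exists_uniformContinuousOn_primitive hC
    (B₁ := fun z => ((4 + Complex.log (U z))⁻¹) ^ 2) (K₁ := outerQuotient p U F)
    (B₂ := fun z => -(p⁻¹ : ℝ) * outerQuotient p U F z)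
    (K₂ := fun z => (4 + Complex.log (U z))⁻¹) (M := 1 + p⁻¹) (by positivity)
    (hU.differentiableOn_inv_four_add_log.pow 2)
    (fun z hz => by
      rw [norm_pow]
      exact (pow_le_one₀ (norm_nonneg _) (hχ z hz)).trans hone)
    hBd (fun z hz => (hB z hz).trans hone) (hBd.const_mul _)
    (fun z hz => by
      rw [norm_mul, norm_neg, Complex.norm_real, Real.norm_of_nonneg hp'.le]
      nlinarith [hB z hz])
    hU.differentiableOn_inv_four_add_log (fun z hz => (hχ z hz).trans hone)
  set g : ℂ → ℂ := fun z => (((4 + Complex.log (U z))⁻¹) ^ 2 * deriv (outerQuotient p U F) z +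
    (-(p⁻¹ : ℝ) * outerQuotient p U F z) * deriv (fun w => (4 + Complex.log (U w))⁻¹) z) *
    ((4 + Complex.log (V z))⁻¹) ^ 2 * e z with hg
  have hgd : DifferentiableOn ℂ g (Metric.ball 0 1) :=
    ((((hU.differentiableOn_inv_four_add_log.pow 2).mul (hBd.deriv Metric.isOpen_ball)).add
      ((hBd.const_mul _).mul (hU.differentiableOn_inv_four_add_log.deriv Metric.isOpen_ball))).mul
      (hV.differentiableOn_inv_four_add_log.pow 2)).mul he.differentiableOn
  obtain ⟨Gb, hGb⟩ := exists_memQA_of_uniformContinuousOn (differentiableOn_primitive hgd) hT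
  have hO : IsOuter fun z => Complex.exp (logMultiplier p U V e z) :=
    isOuter_exp_logMultiplier hU hV he
  refine ⟨primitive g, Gb, fun z => Complex.exp (logMultiplier p U V e z), hGb, hO,
    fun q hq hqp => memHardy_of_norm_eq hp hq hqp hC hU hV he (by simpa [unitDisc_eq_ball] using hO.1)
      fun z hz => norm_exp_logMultiplier hU hV he hz, fun z hz => ?_⟩
  rw [unitDisc_eq_ball] at hz
  have he0 : e z ≠ 0 := fun h => by simpa [h] using he.re_pos hz
  have hV0 := four_add_log_ne_zero (hV.one_le_re z hz)
  beta_reduce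
  rw [(hasDerivAt_primitive hgd hz).deriv, exp_logMultiplier hU hV he hz,
    deriv_eq_outerQuotient (p := p) hFd hU hz]
  simp only [hg]
  generalize (((4 + Complex.log (U z))⁻¹) ^ 2 * deriv (outerQuotient p U F) z +
    (-(p⁻¹ : ℝ) * outerQuotient p U F z) * deriv (fun w => (4 + Complex.log (U w))⁻¹) z) = T
  field_simp
end
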